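/- arXiv:2403.08623 — 2 statements merged into one kernel-verified Lean document; each statement's English description precedes it below -/
import Mathlib

section
/- Let Θ ⊆ ℝ² be a realization of the generalized theta graph Θ_4 (i.e. with m = 4 arcs). Then for every basepoint x of UConf_3(Θ), the fundamental group π₁(UConf_3(Θ), x) is isomorphic to the genus-3 surface group, namely the presented group on generators x₁, y₁, x₂, y₂, x₃, y₃ with the single relator [x₁,y₁][x₂,y₂][x₃,y₃] (product of commutators). (Indeed, Conf_3(Θ_4) is homotopy equivalent to the closed orientable surface of genus 3.) -/
/-- The relation identifying two injective tuples of points that differ by a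
permutation of the coordinates. -/
def permRel (n : ℕ) (X : Type*) (f g : {f : Fin n → X // Function.Injective f}) : Prop :=
  ∃ σ : Equiv.Perm (Fin n), (f : Fin n → X) ∘ σ = (g : Fin n → X)

/-- The unordered configuration space of `n` points on `X`. -/
def UConf (n : ℕ) (X : Type*) [TopologicalSpace X] : Type _ :=
  Quot (permRel n X)

instance (n : ℕ) (X : Type*) [TopologicalSpace X] : TopologicalSpace (UConf n X) :=
  inferInstanceAs (TopologicalSpace (Quot (permRel n X)))

/-- The genus-3 surface relator `[x₁,y₁][x₂,y₂][x₃,y₃]` in the free group on the six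
generators `xᵢ = (i, false)`, `yᵢ = (i, true)` for `i : Fin 3`. -/
def genus3Relator : FreeGroup (Fin 3 × Bool) :=
  (FreeGroup.of ((0 : Fin 3), false) * FreeGroup.of ((0 : Fin 3), true) *
      (FreeGroup.of ((0 : Fin 3), false))⁻¹ * (FreeGroup.of ((0 : Fin 3), true))⁻¹) *
  (FreeGroup.of ((1 : Fin 3), false) * FreeGroup.of ((1 : Fin 3), true) *
      (FreeGroup.of ((1 : Fin 3), false))⁻¹ * (FreeGroup.of ((1 : Fin 3), true))⁻¹) *
  (FreeGroup.of ((2 : Fin 3), false) * FreeGroup.of ((2 : Fin 3), true) *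
      (FreeGroup.of ((2 : Fin 3), false))⁻¹ * (FreeGroup.of ((2 : Fin 3), true))⁻¹)

/-- The genus-3 surface group, presented on `x₁,y₁,x₂,y₂,x₃,y₃` with the single
relator `[x₁,y₁][x₂,y₂][x₃,y₃]`. -/
def genus3SurfaceGroup : Type :=
  PresentedGroup ({genus3Relator} : Set (FreeGroup (Fin 3 × Bool)))

noncomputable instance : Group genus3SurfaceGroup :=
  inferInstanceAs (Group (PresentedGroup ({genus3Relator} : Set (FreeGroup (Fin 3 × Bool)))))

open scoped commutatorElement

/-- Families of group elements indexed by pairs of edges satisfying the relations between the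
elementary moves of three points on the theta graph. -/
structure SwapData {H : Type*} [Group H] (p q : Fin 4 → Fin 4 → H) : Prop where
  p_self : ∀ i, p i i = 1
  q_self : ∀ i, q i i = 1
  p_inv : ∀ i j, p j i = (p i j)⁻¹
  q_inv : ∀ i j, q j i = (q i j)⁻¹
  p_zero : ∀ j, p 0 j = 1
  hex : ∀ i j k, i < j → j < k → p j i * q i k * p k j = q j k * p k i * q i j

/-- The family of lower swaps determined by three free parameters. -/
def lowerSwaps {H : Type*} [Group H] (b c d : H) : Fin 4 → Fin 4 → H :=
  ![![1, 1, 1, 1], ![1, 1, b, c], ![1, b⁻¹, 1, d], ![1, c⁻¹, d⁻¹, 1]]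

/-- The family of upper swaps determined by six free parameters. -/
def upperSwaps {H : Type*} [Group H] (a b c b' c' d' : H) : Fin 4 → Fin 4 → H :=
  ![![1, a, b, c], ![a⁻¹, 1, b', c'], ![b⁻¹, b'⁻¹, 1, d'], ![c⁻¹, c'⁻¹, d'⁻¹, 1]]

/-- A family satisfying the relations is determined by `p 1 2`, `p 1 3`, `p 2 3` and `q 0 k`. -/
theorem SwapData.p_eq {H : Type*} [Group H] {p q : Fin 4 → Fin 4 → H} (h : SwapData p q) :
    p = lowerSwaps (p 1 2) (p 1 3) (p 2 3) := by
  funext i j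
  fin_cases i <;> fin_cases j <;>
    simp [lowerSwaps, h.p_self, h.p_zero, h.p_inv 0 1, h.p_inv 0 2, h.p_inv 0 3, h.p_inv 1 2,
      h.p_inv 1 3, h.p_inv 2 3]

theorem SwapData.q_eq {H : Type*} [Group H] {p q : Fin 4 → Fin 4 → H} (h : SwapData p q) :
    q = upperSwaps (q 0 1) (q 0 2) (q 0 3) (q 0 2 * (p 1 2)⁻¹ * (q 0 1)⁻¹)
      (q 0 3 * (p 1 3)⁻¹ * (q 0 1)⁻¹) (q 0 3 * (p 2 3)⁻¹ * (q 0 2)⁻¹) := by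
  have h1 := h.hex 0 1 2 (by decide) (by decide)
  have h2 := h.hex 0 1 3 (by decide) (by decide)
  have h3 := h.hex 0 2 3 (by decide) (by decide)
  simp only [h.p_inv 0, h.p_zero, h.p_inv 1 2, h.p_inv 1 3, h.p_inv 2 3, inv_one, one_mul,
    mul_one] at h1 h2 h3
  rw [h1, h2, h3]
  funext i j
  fin_cases i <;> fin_cases j <;>
    simp [upperSwaps, h.q_self, h.q_inv 0 1, h.q_inv 0 2, h.q_inv 0 3, h.q_inv 1 2,
      h.q_inv 1 3, h.q_inv 2 3]

/-- The standard generators of the surface group. -/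
noncomputable def surfaceGen (i : Fin 3) (b : Bool) : genus3SurfaceGroup :=
  PresentedGroup.of (i, b)

theorem surfaceGen_relation :
    (surfaceGen 0 false * surfaceGen 0 true * (surfaceGen 0 false)⁻¹ * (surfaceGen 0 true)⁻¹) *
    (surfaceGen 1 false * surfaceGen 1 true * (surfaceGen 1 false)⁻¹ * (surfaceGen 1 true)⁻¹) *
    (surfaceGen 2 false * surfaceGen 2 true * (surfaceGen 2 false)⁻¹ * (surfaceGen 2 true)⁻¹)
      = 1 :=
  PresentedGroup.one_of_mem (rels := {genus3Relator}) rfl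

/-- The lower swaps in the surface group. -/
noncomputable def pG : Fin 4 → Fin 4 → genus3SurfaceGroup :=
  let a3 := (surfaceGen 1 true)⁻¹ * surfaceGen 2 false * surfaceGen 2 true * (surfaceGen 2 false)⁻¹
  lowerSwaps (surfaceGen 1 false) (surfaceGen 2 true)
    ((surfaceGen 1 false * surfaceGen 2 false * surfaceGen 2 true * (surfaceGen 2 false)⁻¹)⁻¹ *
      surfaceGen 0 true * surfaceGen 2 true * a3⁻¹ * surfaceGen 1 false * a3)

/-- The upper swaps in the surface group. -/
noncomputable def qG : Fin 4 → Fin 4 → genus3SurfaceGroup :=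
  let a3 := (surfaceGen 1 true)⁻¹ * surfaceGen 2 false * surfaceGen 2 true * (surfaceGen 2 false)⁻¹
  let a1 := (surfaceGen 2 true * a3⁻¹ * surfaceGen 1 false * a3)⁻¹ * surfaceGen 0 false
  let a2 := (surfaceGen 2 false)⁻¹
  upperSwaps a1 a2 a3 (a2 * (pG 1 2)⁻¹ * a1⁻¹) (a3 * (pG 1 3)⁻¹ * a1⁻¹) (a3 * (pG 2 3)⁻¹ * a2⁻¹)

theorem swapData_of_relation {H : Type*} [Group H] {a1 a2 a3 b c d : H}
    (h : b⁻¹ * a3 * c⁻¹ * a1⁻¹ * d⁻¹ * a1 * b * a2⁻¹ * c * a2 * d * a3⁻¹ = 1) :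
    SwapData (lowerSwaps b c d) (upperSwaps a1 a2 a3 (a2 * b⁻¹ * a1⁻¹) (a3 * c⁻¹ * a1⁻¹)
      (a3 * d⁻¹ * a2⁻¹)) where
  p_self i := by fin_cases i <;> rfl
  q_self i := by fin_cases i <;> rfl
  p_inv i j := by fin_cases i <;> fin_cases j <;> simp [lowerSwaps]
  q_inv i j := by fin_cases i <;> fin_cases j <;> simp [upperSwaps]
  p_zero j := by fin_cases j <;> rfl
  hex i j k hij hjk := by
    have h' : b⁻¹ * (a3 * c⁻¹ * a1⁻¹) * d⁻¹ = a3 * d⁻¹ * a2⁻¹ * c⁻¹ * (a2 * b⁻¹ * a1⁻¹) := by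
      rw [← mul_inv_eq_one, ← h]; group
    fin_cases i <;> fin_cases j <;> fin_cases k <;>
      first
        | exact absurd hij (by decide)
        | exact absurd hjk (by decide)
        | (simp [lowerSwaps, upperSwaps]; done)
        | simpa [lowerSwaps, upperSwaps] using h'

theorem surface_relator_eq_conj {H : Type*} [Group H] (a1 a2 a3 b c d : H) :
    b⁻¹ * a3 * c⁻¹ * a1⁻¹ * d⁻¹ * a1 * b * a2⁻¹ * c * a2 * d * a3⁻¹ =
      (b⁻¹ * a3 * c⁻¹ * a1⁻¹ * d⁻¹ * (c * a3⁻¹ * b * a3)⁻¹) *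
      (⁅c * a3⁻¹ * b * a3 * a1, b * a2⁻¹ * c * a2 * d * a3⁻¹ * b⁻¹ * a3 * c⁻¹⁆ *
        ⁅b, a2⁻¹ * c * a2 * a3⁻¹⁆ * ⁅a2⁻¹, c⁆) *
      (b⁻¹ * a3 * c⁻¹ * a1⁻¹ * d⁻¹ * (c * a3⁻¹ * b * a3)⁻¹)⁻¹ := by
  simp only [commutatorElement_def]
  group

/-- The surface generators expressed through the swaps. -/
def swapWord {H : Type*} [Group H] (p q : Fin 4 → Fin 4 → H) : Fin 3 → Bool → H :=
  ![fun t => if t then p 1 2 * (q 0 2)⁻¹ * p 1 3 * q 0 2 * p 2 3 * (q 0 3)⁻¹ * (p 1 2)⁻¹ *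
        q 0 3 * (p 1 3)⁻¹
      else p 1 3 * (q 0 3)⁻¹ * p 1 2 * q 0 3 * q 0 1,
    fun t => if t then (q 0 2)⁻¹ * p 1 3 * q 0 2 * (q 0 3)⁻¹ else p 1 2,
    fun t => if t then p 1 3 else (q 0 2)⁻¹]

theorem swapWord_pG_qG (i : Fin 3) (t : Bool) : swapWord pG qG i t = surfaceGen i t := by
  fin_cases i <;> cases t <;> simp [swapWord, pG, qG, lowerSwaps, upperSwaps] <;> group

theorem swapData_pG_qG : SwapData pG qG := by
  refine swapData_of_relation ?_
  rw [surface_relator_eq_conj, conj_eq_one_iff]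
  have h := surfaceGen_relation
  simp only [← swapWord_pG_qG] at h
  exact h

theorem swapWord_relation {H : Type*} [Group H] {p q : Fin 4 → Fin 4 → H} (h : SwapData p q) :
    ⁅swapWord p q 0 false, swapWord p q 0 true⁆ * ⁅swapWord p q 1 false, swapWord p q 1 true⁆ *
      ⁅swapWord p q 2 false, swapWord p q 2 true⁆ = 1 := by
  have h1 := h.hex 1 2 3 (by decide) (by decide)
  rw [h.p_inv 1 2, h.p_inv 1 3, h.p_inv 2 3, h.q_eq] at h1
  simp only [upperSwaps] at h1
  change (p 1 2)⁻¹ * (q 0 3 * (p 1 3)⁻¹ * (q 0 1)⁻¹) * (p 2 3)⁻¹ =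
    q 0 3 * (p 2 3)⁻¹ * (q 0 2)⁻¹ * (p 1 3)⁻¹ * (q 0 2 * (p 1 2)⁻¹ * (q 0 1)⁻¹) at h1
  have h2 := surface_relator_eq_conj (q 0 1) (q 0 2) (q 0 3) (p 1 2) (p 1 3) (p 2 3)
  rw [← mul_inv_eq_one] at h1
  rw [show (p 1 2)⁻¹ * q 0 3 * (p 1 3)⁻¹ * (q 0 1)⁻¹ * (p 2 3)⁻¹ * q 0 1 * p 1 2 * (q 0 2)⁻¹ *
    p 1 3 * q 0 2 * p 2 3 * (q 0 3)⁻¹ = 1 by rw [← h1]; group, eq_comm, conj_eq_one_iff] at h2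
  exact h2

/-- Any family satisfying the relations is the image of the universal one. -/
theorem SwapData.exists_hom {H : Type*} [Group H] {p q : Fin 4 → Fin 4 → H} (h : SwapData p q) :
    ∃ ψ : genus3SurfaceGroup →* H, (∀ i j, ψ (pG i j) = p i j) ∧ ∀ i j, ψ (qG i j) = q i j := by
  let ψ : genus3SurfaceGroup →* H :=
    PresentedGroup.toGroup (rels := {genus3Relator}) (f := fun x => swapWord p q x.1 x.2) (by
      rintro r rfl
      simpa [genus3Relator, commutatorElement_def] using swapWord_relation h)
  have hψ (i : Fin 3) (t : Bool) : ψ (surfaceGen i t) = swapWord p q i t :=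
    PresentedGroup.toGroup.of _
  have hp : (fun i j => ψ (pG i j)) = p := by
    rw [h.p_eq]
    funext i j
    fin_cases i <;> fin_cases j <;> simp [pG, lowerSwaps, hψ, swapWord] <;> group
  have hp' (i j) : ψ (pG i j) = p i j := congrFun (congrFun hp i) j
  refine ⟨ψ, hp', fun i j => ?_⟩
  rw [h.q_eq]
  fin_cases i <;> fin_cases j <;>
    simp [qG, upperSwaps, hψ, swapWord, hp'] <;> group

theorem closure_pG_qG (S : Subgroup genus3SurfaceGroup) (hp : ∀ i j, pG i j ∈ S)
    (hq : ∀ i j, qG i j ∈ S) : S = ⊤ := by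
  have h (x : Fin 3 × Bool) : PresentedGroup.of x ∈ S := by
    change surfaceGen x.1 x.2 ∈ S
    rw [← swapWord_pG_qG]
    obtain ⟨i, t⟩ := x
    fin_cases i <;> cases t <;> simp [swapWord] <;>
      repeat' first | exact hp _ _ | exact hq _ _ | apply S.mul_mem | apply S.inv_mem
  refine eq_top_iff.2 ((PresentedGroup.closure_range_of ({genus3Relator} : Set _)).symm.le.trans ?_)
  exact (Subgroup.closure_le S).2 (by rintro _ ⟨x, rfl⟩; exact h x)

open Topology Set

/-- A property of homotopy classes of paths that is stable under concatenation and holds for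
paths inside the members of an open cover holds for all classes. -/
theorem Path.Homotopic.Quotient.induction_openCover {X ι : Type*} [TopologicalSpace X]
    {U : ι → Set X} (hU : ∀ i, IsOpen (U i)) (hcov : ∀ x, ∃ i, x ∈ U i)
    {P : ∀ {x y : X}, Path.Homotopic.Quotient x y → Prop}
    (htrans : ∀ {x y z : X} (p : Path.Homotopic.Quotient x y) (q : Path.Homotopic.Quotient y z),
      P p → P q → P (p.trans q))
    (hloc : ∀ i {x y : X} (γ : Path x y), range γ ⊆ U i → P (.mk γ))
    {x y : X} (q : Path.Homotopic.Quotient x y) : P q := by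
  induction q using Path.Homotopic.Quotient.ind with | _ γ
  obtain ⟨t, ht0, htm, ⟨n, hn⟩, ht⟩ := exists_monotone_Icc_subset_open_cover_unitInterval
    (c := fun i => γ ⁻¹' U i) (fun i => (hU i).preimage γ.continuous)
    (fun u _ => mem_iUnion.2 (hcov (γ u)))
  have key : ∀ m, P (.mk (γ.subpath (t 0) (t m))) := by
    intro m
    induction m with
    | zero =>
      obtain ⟨i, hi⟩ := hcov (γ (t 0))
      refine hloc i _ ?_
      rw [Path.range_subpath_of_le _ _ _ le_rfl]
      simpa using hi
    | succ m ih =>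
      obtain ⟨i, hi⟩ := ht m
      have h2 : P (.mk (γ.subpath (t m) (t (m + 1)))) := by
        refine hloc i _ ?_
        rw [Path.range_subpath_of_le _ _ _ (htm (Nat.le_succ m))]
        exact image_subset_iff.2 hi
      have h3 := htrans _ _ ih h2
      rwa [← Path.Homotopic.Quotient.mk_trans,
        Path.Homotopic.Quotient.eq.2 ⟨Path.Homotopy.subpathTransSubpath γ _ _ _⟩] at h3
  have h := key n
  rw [ht0, hn n le_rfl] at h
  rw [Path.subpath_zero_one] at h
  obtain ⟨γ, rfl, rfl⟩ := γ
  exact h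

/-- The principal bundle glued from locally constant quotients of potentials. -/
noncomputable def potentialBundle {X ι G : Type*} [TopologicalSpace X] [Group G] [TopologicalSpace G]
    [DiscreteTopology G]
    (U : ι → Set X) (hU : ∀ i, IsOpen (U i)) (hcov : ∀ x, ∃ i, x ∈ U i) (g : ι → X → G)
    (hg : ∀ i j s, s ∈ U i → s ∈ U j → ∀ᶠ t in 𝓝 s, g i t * (g j t)⁻¹ = g i s * (g j s)⁻¹) :
    FiberBundleCore ι X G where
  baseSet := U
  isOpen_baseSet := hU
  indexAt x := (hcov x).choose
  mem_baseSet_at x := (hcov x).choose_spec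
  coordChange i j s w := w * (g i s * (g j s)⁻¹)
  coordChange_self i s _ w := by simp
  continuousOn_coordChange i j := by
    rintro ⟨s, w⟩ ⟨⟨hi, hj⟩, -⟩
    refine ContinuousAt.continuousWithinAt ?_
    refine ContinuousAt.congr (f := fun x : X × G => x.2 * (g i s * (g j s)⁻¹)) ?_ ?_
    · exact ((continuous_of_discreteTopology (f := fun w : G => w * (g i s * (g j s)⁻¹))).comp
        continuous_snd).continuousAt
    · filter_upwards [continuous_fst.continuousAt.eventually (hg i j s hi hj)] with x hx
      simp only [hx]
  coordChange_comp i j k s _ w := by simp [mul_assoc]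

/-- Locally constant transition data on an open cover define a multiplicative function on homotopy
classes of paths. -/
theorem exists_cocycle {X ι G : Type*} [TopologicalSpace X] [Group G]
    {U : ι → Set X} (hU : ∀ i, IsOpen (U i)) (hcov : ∀ x, ∃ i, x ∈ U i) {g : ι → X → G}
    (hg : ∀ i j s, s ∈ U i → s ∈ U j → ∀ᶠ t in 𝓝 s, g i t * (g j t)⁻¹ = g i s * (g j s)⁻¹) :
    ∃ Φ : ∀ {s t : X}, Path.Homotopic.Quotient s t → G,
      (∀ {s t r : X} (p : Path.Homotopic.Quotient s t) (q : Path.Homotopic.Quotient t r),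
        Φ (p.trans q) = Φ p * Φ q) ∧
      ∀ i {s t : X} (γ : Path s t), range γ ⊆ U i → Φ (.mk γ) = (g i s)⁻¹ * g i t := by
  let _ : TopologicalSpace G := ⊥
  have _ : DiscreteTopology G := ⟨rfl⟩
  let Z := potentialBundle U hU hcov g hg
  have cov : IsCoveringMap Z.proj := FiberBundle.isCoveringMap (F := G) (E := Z.Fiber)
  let v (e : Z.TotalSpace) : G := (show G from e.2) * g (Z.indexAt e.1) e.1
  have loc : ∀ i {s t : X} (γ : Path s t), range γ ⊆ U i → ∀ e,
      v (cov.monodromy (.mk γ) e) = v e * ((g i s)⁻¹ * g i t) := by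
    rintro i s t γ hγ ⟨⟨s', w⟩, hs⟩
    obtain rfl : s' = s := hs
    let w' : G := Z.coordChange (Z.indexAt s') i s' w
    let Γ : C(unitInterval, Z.TotalSpace) :=
      ⟨fun u => (Z.localTriv i).toOpenPartialHomeomorph.symm (γ u, w'), by
        refine (Z.localTriv i).continuousOn_invFun.comp_continuous
          (γ.continuous.prodMk continuous_const) fun u => ?_
        exact (Bundle.Trivialization.mem_target _).2 (hγ ⟨u, rfl⟩)⟩
    have hv (u : unitInterval) : v (Γ u) = w' * g i (γ u) := by
      change w' * (g i (γ u) * (g (Z.indexAt (γ u)) (γ u))⁻¹) * g (Z.indexAt (γ u)) (γ u) = _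
      group
    have hs : Γ 0 = ⟨s', w⟩ := by
      change (⟨γ 0, Z.coordChange i (Z.indexAt (γ 0)) (γ 0) w'⟩ : Z.TotalSpace) = _
      rw [γ.source]
      congr 1
      have aux (w a b : G) : w * (a * b⁻¹) * (b * a⁻¹) = w := by group
      exact aux _ _ _
    have h1 : Γ = cov.liftPath γ ⟨s', w⟩ γ.source := (cov.eq_liftPath_iff' ..).2 ⟨rfl, hs⟩
    have h2 : ((cov.monodromy (.mk γ) ⟨⟨s', w⟩, rfl⟩ : Z.proj ⁻¹' {t}) : Z.TotalSpace) = Γ 1 := by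
      rw [h1]; rfl
    have h3 : v ⟨s', w⟩ = w' * g i s' := by rw [← hs, hv, γ.source]
    rw [h2, hv, γ.target, h3]
    group
  have ex : ∀ {s t : X} (q : Path.Homotopic.Quotient s t),
      ∃ a : G, ∀ e, v (cov.monodromy q e) = v e * a := by
    intro s t q
    refine Path.Homotopic.Quotient.induction_openCover hU hcov
      (P := fun {s t} q => ∃ a : G, ∀ e, v (cov.monodromy q e) = v e * a) ?_ ?_ q
    · rintro x y z p q ⟨a, ha⟩ ⟨b, hb⟩
      exact ⟨a * b, fun e => by rw [cov.monodromy_trans_apply, hb, ha, mul_assoc]⟩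
    · exact fun i x y γ hγ => ⟨_, loc i γ hγ⟩
  have pt (s : X) : Nonempty (Z.proj ⁻¹' {s}) := ⟨⟨⟨s, (1 : G)⟩, rfl⟩⟩
  choose Φ hΦ using @ex
  refine ⟨@Φ, fun {s t r} p q => ?_, fun i {s t} γ hγ => ?_⟩
  · obtain ⟨e⟩ := pt s
    refine mul_left_cancel (a := v e) ?_
    rw [← hΦ, cov.monodromy_trans_apply, hΦ, hΦ, mul_assoc]
  · obtain ⟨e⟩ := pt s
    refine mul_left_cancel (a := v e) ?_
    rw [← hΦ, loc i γ hγ]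

theorem IsSimplyConnected.mk_eq_mk {X : Type*} [TopologicalSpace X] {U : Set X}
    (hU : IsSimplyConnected U) {s t : X} {γ δ : Path s t} (hγ : range γ ⊆ U) (hδ : range δ ⊆ U) :
    Path.Homotopic.Quotient.mk γ = Path.Homotopic.Quotient.mk δ := by
  have : SimplyConnectedSpace U := hU
  have h (δ : Path s t) (hδ : range δ ⊆ U) : ∃ δ' : Path (⟨s, hγ ⟨0, γ.source⟩⟩ : U)
      ⟨t, hγ ⟨1, γ.target⟩⟩, δ'.map continuous_subtype_val = δ :=
    ⟨⟨⟨fun u => ⟨δ u, hδ ⟨u, rfl⟩⟩, by fun_prop⟩, Subtype.ext δ.source, Subtype.ext δ.target⟩,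
      Path.ext rfl⟩
  obtain ⟨γ', hγ'⟩ := h γ hγ
  obtain ⟨δ', hδ'⟩ := h δ hδ
  rw [← hγ', ← hδ', Path.Homotopic.Quotient.eq]
  exact (SimplyConnectedSpace.paths_homotopic γ' δ').map ⟨_, continuous_subtype_val⟩

/-- A multiplicative function on homotopy classes of paths. -/
structure PathCocycle (X G : Type*) [TopologicalSpace X] [Group G] where
  /-- The value on a homotopy class of paths. -/
  val : ∀ {s t : X}, Path.Homotopic.Quotient s t → G
  val_trans : ∀ {s t r : X} (p : Path.Homotopic.Quotient s t) (q : Path.Homotopic.Quotient t r),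
    val (p.trans q) = val p * val q

namespace PathCocycle

variable {X G H ι : Type*} [TopologicalSpace X] [Group G] [Group H]

theorem val_refl (Φ : PathCocycle X G) (s : X) : Φ.val (.refl s) = 1 := by
  have h := Φ.val_trans (.refl s) (.refl s)
  rw [Path.Homotopic.Quotient.refl_trans] at h
  exact left_eq_mul.1 h

theorem val_symm (Φ : PathCocycle X G) {s t : X} (q : Path.Homotopic.Quotient s t) :
    Φ.val q.symm = (Φ.val q)⁻¹ := by
  rw [← mul_eq_one_iff_eq_inv, ← Φ.val_trans, Path.Homotopic.Quotient.symm_trans, Φ.val_refl]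

/-- Two cocycles agree on all paths between points of `D` if they agree on those inside the members
of an open cover, provided that every point can be moved slightly into `D`. -/
theorem val_eq_of_cover [Finite ι] {U : ι → Set X} (hU : ∀ i, IsOpen (U i))
    (hcov : ∀ x, ∃ i, x ∈ U i) {D : Set X}
    (hD : ∀ s, ∀ N : Set X, IsOpen N → s ∈ N → ∃ s' ∈ D, JoinedIn N s' s)
    (Φ Ψ : PathCocycle X G)
    (h : ∀ i, ∀ s ∈ D, ∀ t ∈ D, ∀ γ : Path s t, range γ ⊆ U i → Φ.val (.mk γ) = Ψ.val (.mk γ))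
    {s t : X} (hs : s ∈ D) (ht : t ∈ D) (q : Path.Homotopic.Quotient s t) :
    Φ.val q = Ψ.val q := by
  have hN (s : X) : ∃ s' ∈ D, ∃ δ : Path s' s, ∀ i, s ∈ U i → range δ ⊆ U i := by
    obtain ⟨s', hs', hj⟩ := hD s (⋂ i, ⋂ _ : s ∈ U i, U i)
      (isOpen_iInter_of_finite fun i => isOpen_iInter_of_finite fun _ => hU i)
      (by simp)
    refine ⟨s', hs', hj.somePath, fun i hi => ?_⟩
    rintro _ ⟨u, rfl⟩
    exact mem_iInter₂.1 (hj.somePath_mem u) i hi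
  choose r hr δ hδ using hN
  have hδ' (s : X) (hs : s ∈ D) : Φ.val (.mk (δ s)) = Ψ.val (.mk (δ s)) := by
    obtain ⟨i, hi⟩ := hcov s
    exact h i _ (hr s) _ hs _ (hδ s i hi)
  have key : Φ.val (.mk (δ s)) * Φ.val q * (Φ.val (.mk (δ t)))⁻¹ =
      Ψ.val (.mk (δ s)) * Ψ.val q * (Ψ.val (.mk (δ t)))⁻¹ := by
    refine Path.Homotopic.Quotient.induction_openCover hU hcov
      (P := fun {s t} q => Φ.val (.mk (δ s)) * Φ.val q * (Φ.val (.mk (δ t)))⁻¹ =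
        Ψ.val (.mk (δ s)) * Ψ.val q * (Ψ.val (.mk (δ t)))⁻¹) ?_ ?_ q
    · intro x y z p q hp hq
      have := congrArg₂ (· * ·) hp hq
      simpa [val_trans, mul_assoc] using this
    · intro i x y γ hγ
      have hx : x ∈ U i := hγ ⟨0, γ.source⟩
      have hy : y ∈ U i := hγ ⟨1, γ.target⟩
      have := h i _ (hr x) _ (hr y) (((δ x).trans γ).trans (δ y).symm) (by
        rw [Path.trans_range, Path.trans_range, Path.symm_range]
        exact union_subset (union_subset (hδ x i hx) hγ) (hδ y i hy))
      simpa [Path.Homotopic.Quotient.mk_trans, Path.Homotopic.Quotient.mk_symm, val_trans,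
        val_symm, mul_assoc] using this
  rw [hδ' s hs, hδ' t ht] at key
  simpa using key

/-- Close up paths to loops at `x₀` along chosen classes `b`. -/
noncomputable def closeUp {x₀ : X} (b : ∀ s, Path.Homotopic.Quotient x₀ s) :
    PathCocycle X (FundamentalGroup X x₀)ᵐᵒᵖ where
  val {s t} q := .op (show FundamentalGroup X x₀ from ((b s).trans q).trans (b t).symm)
  val_trans {s t r} p q := by
    rw [← MulOpposite.op_mul, FundamentalGroup.mul_def]
    congr 1
    change ((b s).trans (p.trans q)).trans (b r).symm =
      (((b s).trans p).trans (b t).symm).trans (((b t).trans q).trans (b r).symm)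
    simp only [Path.Homotopic.Quotient.trans_assoc]
    rw [← Path.Homotopic.Quotient.trans_assoc (b t).symm, Path.Homotopic.Quotient.symm_trans,
      Path.Homotopic.Quotient.refl_trans]

theorem closeUp_val {x₀ : X} (b : ∀ s, Path.Homotopic.Quotient x₀ s) {s t : X}
    (q : Path.Homotopic.Quotient s t) :
    (closeUp b).val q =
      .op (show FundamentalGroup X x₀ from ((b s).trans q).trans (b t).symm) := rfl

/-- Push a cocycle forward along a homomorphism. -/
def comp (Φ : PathCocycle X G) (ψ : G →* H) : PathCocycle X H where
  val q := ψ (Φ.val q)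
  val_trans p q := by rw [Φ.val_trans, map_mul]

/-- The value of a cocycle on a path from `s` to `t` inside `U`. -/
noncomputable def on (Φ : PathCocycle X G) (U : Set X) (s t : X) : G :=
  open Classical in if h : JoinedIn U s t then Φ.val (.mk h.somePath) else 1

theorem val_eq_on (Φ : PathCocycle X G) {U : Set X} (hU : IsSimplyConnected U) {s t : X}
    (γ : Path s t) (hγ : range γ ⊆ U) : Φ.val (.mk γ) = Φ.on U s t := by
  have hj : JoinedIn U s t := ⟨γ, fun u => hγ ⟨u, rfl⟩⟩
  rw [on, dif_pos hj, hU.mk_eq_mk hγ (range_subset_iff.2 hj.somePath_mem)]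

theorem on_mul_on (Φ : PathCocycle X G) {U : Set X} (hU : IsSimplyConnected U) {s t r : X}
    (hs : s ∈ U) (ht : t ∈ U) (hr : r ∈ U) : Φ.on U s t * Φ.on U t r = Φ.on U s r := by
  obtain ⟨γ, hγ⟩ := hU.isPathConnected.joinedIn s hs t ht
  obtain ⟨δ, hδ⟩ := hU.isPathConnected.joinedIn t ht r hr
  rw [← Φ.val_eq_on hU γ (range_subset_iff.2 hγ), ← Φ.val_eq_on hU δ (range_subset_iff.2 hδ),
    ← Φ.val_eq_on hU (γ.trans δ), Path.Homotopic.Quotient.mk_trans, Φ.val_trans]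
  rw [Path.trans_range]
  exact union_subset (range_subset_iff.2 hγ) (range_subset_iff.2 hδ)

theorem on_self (Φ : PathCocycle X G) {U : Set X} (hU : IsSimplyConnected U) {s : X}
    (hs : s ∈ U) : Φ.on U s s = 1 :=
  mul_eq_left.1 (Φ.on_mul_on hU hs hs hs)

theorem inv_on (Φ : PathCocycle X G) {U : Set X} (hU : IsSimplyConnected U) {s t : X}
    (hs : s ∈ U) (ht : t ∈ U) : (Φ.on U s t)⁻¹ = Φ.on U t s := by
  rw [inv_eq_iff_mul_eq_one, Φ.on_mul_on hU hs ht hs, Φ.on_self hU hs]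

/-- The value inside a member of the cover only depends on a path in a smaller set. -/
theorem on_eq_on (Φ : PathCocycle X G) {U U' V : Set X} (hU : IsSimplyConnected U)
    (hU' : IsSimplyConnected U') (hV : V ⊆ U) (hV' : V ⊆ U') {s t : X} (h : JoinedIn V s t) :
    Φ.on U s t = Φ.on U' s t := by
  obtain ⟨γ, hγ⟩ := h
  rw [← Φ.val_eq_on hU γ (range_subset_iff.2 fun u => hV (hγ u)),
    ← Φ.val_eq_on hU' γ (range_subset_iff.2 fun u => hV' (hγ u))]

/-- A cocycle computes the fundamental group if it has a one-sided inverse and its values on loops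
generate. -/
theorem nonempty_mulEquiv (Φ : PathCocycle X G) {x₀ : X}
    (ψ : G →* (FundamentalGroup X x₀)ᵐᵒᵖ)
    (hψ : ∀ q : Path.Homotopic.Quotient x₀ x₀, ψ (Φ.val q) = .op (show FundamentalGroup X x₀ from q))
    (hgen : ∀ S : Subgroup G, (∀ q : Path.Homotopic.Quotient x₀ x₀, Φ.val q ∈ S) → S = ⊤) :
    Nonempty (FundamentalGroup X x₀ ≃* G) := by
  let φ : FundamentalGroup X x₀ →* Gᵐᵒᵖ :=
    { toFun := fun q => .op (Φ.val q)
      map_one' := congrArg MulOpposite.op (Φ.val_refl x₀)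
      map_mul' := fun p q => congrArg MulOpposite.op (Φ.val_trans q p) }
  have hinj : Function.Injective φ := by
    intro p q hpq
    have h : Φ.val p = Φ.val q := MulOpposite.op_injective hpq
    have h' := congrArg ψ h
    rw [hψ, hψ] at h'
    exact MulOpposite.op_injective h'
  have hsurj : Function.Surjective φ := by
    intro y
    have htop := hgen ((φ.range.comap (MulEquiv.inv' G).toMonoidHom)) (fun q =>
      ⟨show FundamentalGroup X x₀ from q.symm, by
        change MulOpposite.op (Φ.val q.symm) = MulOpposite.op (Φ.val q)⁻¹
        rw [Φ.val_symm]⟩)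
    have : (MulEquiv.inv' G).symm y ∈ φ.range.comap (MulEquiv.inv' G).toMonoidHom := by
      rw [htop]; trivial
    obtain ⟨q, hq⟩ := this
    exact ⟨q, by simpa using hq⟩
  exact ⟨(MulEquiv.ofBijective φ ⟨hinj, hsurj⟩).trans (MulEquiv.inv' G).symm⟩

end PathCocycle

/-- A theta graph with four edges, recorded by a height function and a parametrization of every
edge by height. -/
structure ThetaSpace (Y : Type*) [TopologicalSpace Y] where
  /-- The height function. -/
  h : Y → ℝ
  /-- The closed edges. -/
  E : Fin 4 → Set Y
  /-- The parametrization of the edges by height. -/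
  arc : Fin 4 → ℝ → Y
  continuous_h : Continuous h
  h_nonneg : ∀ x, 0 ≤ h x
  h_le_one : ∀ x, h x ≤ 1
  isClosed_E : ∀ i, IsClosed (E i)
  exists_mem_E : ∀ x, ∃ i, x ∈ E i
  continuous_arc : ∀ i, Continuous (arc i)
  arc_mem : ∀ i t, arc i t ∈ E i
  h_arc : ∀ i t, 0 ≤ t → t ≤ 1 → h (arc i t) = t
  arc_h : ∀ i x, x ∈ E i → arc i (h x) = x
  eq_of_mem_E : ∀ i j x, x ∈ E i → x ∈ E j → 0 < h x → h x < 1 → i = j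
  eq_of_h_eq_zero : ∀ x y, h x = 0 → h y = 0 → x = y
  eq_of_h_eq_one : ∀ x y, h x = 1 → h y = 1 → x = y

/-- A planar realization of the theta graph is a `ThetaSpace`. -/
theorem nonempty_thetaSpace (p q : ℝ × ℝ)
    (γ : Fin 4 → C(unitInterval, ℝ × ℝ))
    (hγinj : ∀ i, Function.Injective (γ i))
    (hγ0 : ∀ i, γ i 0 = p) (hγ1 : ∀ i, γ i 1 = q)
    (hγint : ∀ i j, i ≠ j → Set.range (γ i) ∩ Set.range (γ j) = {p, q})
    (Θ : Set (ℝ × ℝ)) (hΘ : Θ = ⋃ i, Set.range (γ i)) : Nonempty (ThetaSpace Θ) := by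
  have hparam {i j : Fin 4} {t t' : unitInterval} (h : γ i t = γ j t') : t = t' := by
    by_cases hij : i = j
    · subst hij; exact hγinj i h
    · have : γ i t ∈ ({p, q} : Set (ℝ × ℝ)) := by
        rw [← hγint i j hij]; exact ⟨⟨t, rfl⟩, ⟨t', h.symm⟩⟩
      rcases this with hp | hq
      · rw [hγinj i (hp.trans (hγ0 i).symm), hγinj j ((h.symm.trans hp).trans (hγ0 j).symm)]
      · rw [hγinj i (hq.trans (hγ1 i).symm), hγinj j ((h.symm.trans hq).trans (hγ1 j).symm)]
  have hex (x : Θ) : ∃ t : unitInterval, ∃ i, γ i t = x := by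
    have : (x : ℝ × ℝ) ∈ ⋃ i, Set.range (γ i) := hΘ ▸ x.2
    obtain ⟨i, t, ht⟩ := mem_iUnion.1 this
    exact ⟨t, i, ht⟩
  choose t ht using hex
  have ht' {x : Θ} {i : Fin 4} {u : unitInterval} (h : γ i u = x) : t x = u := by
    obtain ⟨j, hj⟩ := ht x
    exact hparam (hj.trans h.symm)
  have hmem (i : Fin 4) (u : unitInterval) : γ i u ∈ Θ := hΘ ▸ mem_iUnion.2 ⟨i, u, rfl⟩
  have htc : Continuous t := by
    refine continuous_iff_isClosed.2 fun C hC => ?_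
    have : t ⁻¹' C = Subtype.val ⁻¹' ⋃ i, γ i '' C := by
      ext x
      simp only [mem_preimage, mem_iUnion, mem_image]
      constructor
      · intro hx
        obtain ⟨j, hj⟩ := ht x
        exact ⟨j, t x, hx, hj⟩
      · rintro ⟨i, u, hu, h⟩
        rwa [ht' h]
    rw [this]
    exact (isClosed_iUnion_of_finite fun i =>
      (hC.isCompact.image (γ i).continuous).isClosed).preimage continuous_subtype_val
  refine ⟨{
    h := fun x => t x
    E := fun i => {x | (x : ℝ × ℝ) ∈ range (γ i)}
    arc := fun i u => ⟨γ i (projIcc 0 1 zero_le_one u), hmem _ _⟩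
    continuous_h := continuous_subtype_val.comp htc
    h_nonneg := fun x => (t x).2.1
    h_le_one := fun x => (t x).2.2
    isClosed_E := fun i => (isCompact_range (γ i).continuous).isClosed.preimage
      continuous_subtype_val
    exists_mem_E := fun x => (ht x).imp fun i hi => ⟨_, hi⟩
    continuous_arc := fun i => ((γ i).continuous.comp continuous_projIcc).subtype_mk _
    arc_mem := fun i u => ⟨_, rfl⟩
    h_arc := fun i u h0 h1 => by
      rw [ht' (i := i) (u := projIcc 0 1 zero_le_one u) rfl, projIcc_of_mem _ ⟨h0, h1⟩]
    arc_h := fun i x ⟨u, hu⟩ => by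
      refine Subtype.ext ?_
      rw [ht' hu, projIcc_val]
      exact hu
    eq_of_mem_E := fun i j x hi hj h0 h1 => by
      by_contra hij
      have : (x : ℝ × ℝ) ∈ ({p, q} : Set (ℝ × ℝ)) := by
        rw [← hγint i j hij]; exact ⟨hi, hj⟩
      rcases this with hp | hq
      · rw [ht' (i := i) (u := 0) ((hγ0 i).trans hp.symm)] at h0
        exact lt_irrefl _ h0
      · rw [ht' (i := i) (u := 1) ((hγ1 i).trans hq.symm)] at h1
        exact lt_irrefl _ h1
    eq_of_h_eq_zero := fun x y hx hy => by
      obtain ⟨i, hi⟩ := ht x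
      obtain ⟨j, hj⟩ := ht y
      rw [show t x = 0 from Subtype.ext hx, hγ0] at hi
      rw [show t y = 0 from Subtype.ext hy, hγ0] at hj
      exact Subtype.ext (hi.symm.trans hj)
    eq_of_h_eq_one := fun x y hx hy => by
      obtain ⟨i, hi⟩ := ht x
      obtain ⟨j, hj⟩ := ht y
      rw [show t x = 1 from Subtype.ext hx, hγ1] at hi
      rw [show t y = 1 from Subtype.ext hy, hγ1] at hj
      exact Subtype.ext (hi.symm.trans hj) }⟩

/-- The type of positions of a point on the theta graph: below the top vertex, above the bottom
vertex, or inside an edge. -/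
inductive ThetaLabel
  | lo
  | hi
  | edge (i : Fin 4)

/-- Target heights towards which points of a given label can be moved. -/
def ThetaLabel.Admissible : ThetaLabel → ℝ → Prop
  | lo, c => c = 0
  | hi, c => c = 1
  | edge _, c => 0 < c ∧ c < 1

theorem ThetaLabel.Admissible.mem_Icc {ℓ : ThetaLabel} {c : ℝ} (h : ℓ.Admissible c) :
    0 ≤ c ∧ c ≤ 1 := by
  cases ℓ <;> simp only [Admissible] at h
  · simp [h]
  · simp [h]
  · exact ⟨h.1.le, h.2.le⟩

namespace ThetaSpace

variable {Y : Type*} [TopologicalSpace Y] (T : ThetaSpace Y)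

/-- The open set of points with a given label. -/
def stratum : ThetaLabel → Set Y
  | .lo => {x | T.h x < 1}
  | .hi => {x | 0 < T.h x}
  | .edge i => {x | x ∈ T.E i ∧ 0 < T.h x ∧ T.h x < 1}

theorem isOpen_stratum (ℓ : ThetaLabel) : IsOpen (T.stratum ℓ) := by
  cases ℓ with
  | lo => exact isOpen_lt T.continuous_h continuous_const
  | hi => exact isOpen_lt continuous_const T.continuous_h
  | edge i =>
    have : T.stratum (.edge i) =
        (⋂ j, ⋂ _ : j ≠ i, (T.E j)ᶜ) ∩ ({x | 0 < T.h x} ∩ {x | T.h x < 1}) := by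
      ext x
      simp only [stratum, mem_ofPred_eq, mem_inter_iff, mem_iInter, mem_compl_iff]
      refine and_congr_left fun hx => ⟨fun hi j hj hxj => ?_, fun H => ?_⟩
      · exact hj (T.eq_of_mem_E j i x hxj hi hx.1 hx.2)
      · obtain ⟨j, hj⟩ := T.exists_mem_E x
        by_cases hji : j = i
        · rwa [← hji]
        · exact absurd hj (H j hji)
    rw [this]
    exact (isOpen_iInter_of_finite fun j => isOpen_iInter_of_finite fun _ =>
      (T.isClosed_E j).isOpen_compl).inter
      ((isOpen_lt continuous_const T.continuous_h).inter
        (isOpen_lt T.continuous_h continuous_const))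

/-- Move a point along its edge towards height `c`. -/
noncomputable def move (c : ℝ) (x : Y) (s : ℝ) : Y :=
  T.arc (T.exists_mem_E x).choose ((1 - s) * T.h x + s * c)

theorem move_zero (c : ℝ) (x : Y) : T.move c x 0 = x := by
  simp [move, T.arc_h _ x (T.exists_mem_E x).choose_spec]

theorem convexComb_mem {a c s : ℝ} (ha : 0 ≤ a ∧ a ≤ 1) (hc : 0 ≤ c ∧ c ≤ 1)
    (hs : s ∈ unitInterval) : 0 ≤ (1 - s) * a + s * c ∧ (1 - s) * a + s * c ≤ 1 := by
  obtain ⟨h0, h1⟩ := hs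
  constructor
  · nlinarith [mul_nonneg (sub_nonneg.2 h1) ha.1, mul_nonneg h0 hc.1]
  · nlinarith [mul_nonneg (sub_nonneg.2 h1) (sub_nonneg.2 ha.2), mul_nonneg h0 (sub_nonneg.2 hc.2)]

theorem h_move {c : ℝ} (hc : 0 ≤ c ∧ c ≤ 1) (x : Y) {s : ℝ} (hs : s ∈ unitInterval) :
    T.h (T.move c x s) = (1 - s) * T.h x + s * c :=
  have h := convexComb_mem ⟨T.h_nonneg x, T.h_le_one x⟩ hc hs
  T.h_arc _ _ h.1 h.2

theorem move_eq {ℓ : ThetaLabel} {c : ℝ} (hc : ℓ.Admissible c) {x : Y} (hx : x ∈ T.stratum ℓ)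
    {s : ℝ} (hs : s ∈ unitInterval) {i : Fin 4} (hi : x ∈ T.E i) :
    T.move c x s = T.arc i ((1 - s) * T.h x + s * c) := by
  have hc' := hc.mem_Icc
  have hb := convexComb_mem ⟨T.h_nonneg x, T.h_le_one x⟩ hc' hs
  have h1 := T.h_move hc' x hs
  have h2 := T.h_arc i _ hb.1 hb.2
  rcases (T.h_nonneg x).eq_or_lt with h0 | h0
  · have : c = 0 := by
      cases ℓ with
      | lo => exact hc
      | hi => exact absurd h0 (ne_of_lt hx)
      | edge j => exact absurd h0 (ne_of_lt hx.2.1)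
    refine T.eq_of_h_eq_zero _ _ (h1.trans ?_) (h2.trans ?_) <;> simp [← h0, this]
  rcases (T.h_le_one x).eq_or_lt with h0' | h0'
  · have : c = 1 := by
      cases ℓ with
      | lo => exact absurd h0' (ne_of_lt hx)
      | hi => exact hc
      | edge j => exact absurd h0' (ne_of_lt hx.2.2)
    refine T.eq_of_h_eq_one _ _ (h1.trans ?_) (h2.trans ?_) <;> simp [h0', this]
  · rw [move, T.eq_of_mem_E _ i x (T.exists_mem_E x).choose_spec hi h0 h0']

theorem move_mem {ℓ : ThetaLabel} {c : ℝ} (hc : ℓ.Admissible c) {x : Y} (hx : x ∈ T.stratum ℓ)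
    {s : ℝ} (hs : s ∈ unitInterval) : T.move c x s ∈ T.stratum ℓ := by
  have h1 := T.h_move hc.mem_Icc x hs
  obtain ⟨h0, h1'⟩ := hs
  cases ℓ with
  | lo =>
    obtain rfl : c = 0 := hc
    have hx : T.h x < 1 := hx
    change T.h _ < 1
    rw [h1]
    nlinarith [T.h_nonneg x]
  | hi =>
    obtain rfl : c = 1 := hc
    have hx : 0 < T.h x := hx
    change 0 < T.h _
    rw [h1]
    nlinarith [T.h_le_one x]
  | edge i =>
    obtain ⟨hc0, hc1⟩ : 0 < c ∧ c < 1 := hc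
    obtain ⟨hxi, hx0, hx1⟩ := hx
    refine ⟨?_, ?_, ?_⟩
    · rw [T.move_eq (ℓ := .edge i) ⟨hc0, hc1⟩ ⟨hxi, hx0, hx1⟩ ⟨h0, h1'⟩ hxi]
      exact T.arc_mem _ _
    · rw [h1]
      rcases h0.eq_or_lt with rfl | h
      · simpa using hx0
      · nlinarith [mul_pos h hc0, mul_nonneg (sub_nonneg.2 h1') hx0.le]
    · rw [h1]
      rcases h0.eq_or_lt with rfl | h
      · simpa using hx1
      · nlinarith [mul_pos h (sub_pos.2 hc1), mul_nonneg (sub_nonneg.2 h1') (sub_pos.2 hx1).le]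

theorem move_one_eq {ℓ : ThetaLabel} {c : ℝ} (hc : ℓ.Admissible c) {x y : Y}
    (hx : x ∈ T.stratum ℓ) (hy : y ∈ T.stratum ℓ) : T.move c x 1 = T.move c y 1 := by
  have h1 (x : Y) : T.h (T.move c x 1) = c := by
    rw [T.h_move hc.mem_Icc x ⟨zero_le_one, le_rfl⟩]; ring
  cases ℓ with
  | lo => exact T.eq_of_h_eq_zero _ _ ((h1 x).trans hc) ((h1 y).trans hc)
  | hi => exact T.eq_of_h_eq_one _ _ ((h1 x).trans hc) ((h1 y).trans hc)
  | edge i =>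
    rw [T.move_eq hc hx ⟨zero_le_one, le_rfl⟩ hx.1, T.move_eq hc hy ⟨zero_le_one, le_rfl⟩ hy.1]
    simp

theorem continuous_move {ℓ : ThetaLabel} {c : ℝ} (hc : ℓ.Admissible c) :
    Continuous fun z : T.stratum ℓ × unitInterval => T.move c z.1 z.2 := by
  refine (locallyFinite_of_finite fun i => {z : T.stratum ℓ × unitInterval | (z.1 : Y) ∈ T.E i}).continuous
    ?_ ?_ ?_
  · exact eq_univ_of_forall fun z => mem_iUnion.2 (T.exists_mem_E z.1)
  · exact fun i => (T.isClosed_E i).preimage (continuous_subtype_val.comp continuous_fst)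
  · intro i
    refine ContinuousOn.congr (f := fun z : T.stratum ℓ × unitInterval =>
      T.arc i ((1 - (z.2 : ℝ)) * T.h z.1 + z.2 * c)) ?_ fun z hz => T.move_eq hc z.1.2 z.2.2 hz
    have h1 := T.continuous_h
    exact ((T.continuous_arc i).comp (by fun_prop)).continuousOn

/-- Triples of points with given labels whose heights satisfy a given relation. -/
def region (a b c : ThetaLabel) (K : ℝ → ℝ → ℝ → Prop) : Set (Y × Y × Y) :=
  {v | v.1 ∈ T.stratum a ∧ v.2.1 ∈ T.stratum b ∧ v.2.2 ∈ T.stratum c ∧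
    K (T.h v.1) (T.h v.2.1) (T.h v.2.2)}

/-- The relation `K` is star-shaped about `(α, β, γ)`. -/
def StarAbout (K : ℝ → ℝ → ℝ → Prop) (α β γ : ℝ) : Prop :=
  ∀ x y z s, K x y z → s ∈ unitInterval →
    K ((1 - s) * x + s * α) ((1 - s) * y + s * β) ((1 - s) * z + s * γ)

theorem exists_arc_mem_stratum {ℓ : ThetaLabel} {c : ℝ} (hc : ℓ.Admissible c) :
    ∃ x ∈ T.stratum ℓ, T.h x = c := by
  have hc' := hc.mem_Icc
  cases ℓ with
  | lo => exact ⟨T.arc 0 c, (T.h_arc _ _ hc'.1 hc'.2).trans_lt (lt_of_eq_of_lt hc zero_lt_one),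
      T.h_arc _ _ hc'.1 hc'.2⟩
  | hi => exact ⟨T.arc 0 c, (lt_of_lt_of_eq zero_lt_one hc.symm).trans_eq
      (T.h_arc _ _ hc'.1 hc'.2).symm, T.h_arc _ _ hc'.1 hc'.2⟩
  | edge i => exact ⟨T.arc i c, ⟨T.arc_mem _ _, by rwa [T.h_arc _ _ hc'.1 hc'.2]⟩,
      T.h_arc _ _ hc'.1 hc'.2⟩

theorem contractibleSpace_region {a b c : ThetaLabel} {K : ℝ → ℝ → ℝ → Prop} {α β γ : ℝ}
    (ha : a.Admissible α) (hb : b.Admissible β) (hc : c.Admissible γ)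
    (hK : StarAbout K α β γ) (hK' : K α β γ) : ContractibleSpace (T.region a b c K) := by
  obtain ⟨x, hx, hxα⟩ := T.exists_arc_mem_stratum ha
  obtain ⟨y, hy, hyβ⟩ := T.exists_arc_mem_stratum hb
  obtain ⟨z, hz, hzγ⟩ := T.exists_arc_mem_stratum hc
  have mem (v : T.region a b c K) (s : unitInterval) :
      (T.move α v.1.1 s, T.move β v.1.2.1 s, T.move γ v.1.2.2 s) ∈ T.region a b c K := by
    obtain ⟨h1, h2, h3, h4⟩ := v.2
    refine ⟨T.move_mem ha h1 s.2, T.move_mem hb h2 s.2, T.move_mem hc h3 s.2, ?_⟩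
    simp only [T.h_move ha.mem_Icc _ s.2, T.h_move hb.mem_Icc _ s.2, T.h_move hc.mem_Icc _ s.2]
    exact hK _ _ _ _ h4 s.2
  let v₀ : T.region a b c K := ⟨(x, y, z), hx, hy, hz, by simpa [hxα, hyβ, hzγ] using hK'⟩
  have cont : Continuous fun w : unitInterval × T.region a b c K =>
      (T.move α w.2.1.1 w.1, T.move β w.2.1.2.1 w.1, T.move γ w.2.1.2.2 w.1) := by
    refine Continuous.prodMk ?_ (Continuous.prodMk ?_ ?_)
    · exact (T.continuous_move ha).comp
        (f := fun w : unitInterval × T.region a b c K => (⟨w.2.1.1, w.2.2.1⟩, w.1)) (by fun_prop)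
    · exact (T.continuous_move hb).comp
        (f := fun w : unitInterval × T.region a b c K => (⟨w.2.1.2.1, w.2.2.2.1⟩, w.1))
        (by fun_prop)
    · exact (T.continuous_move hc).comp
        (f := fun w : unitInterval × T.region a b c K => (⟨w.2.1.2.2, w.2.2.2.2.1⟩, w.1))
        (by fun_prop)
  refine (contractible_iff_id_nullhomotopic _).2 ⟨⟨_, mem v₀ 1⟩, ⟨⟨⟨_, cont.subtype_mk
    fun w => mem w.2 w.1⟩, fun v => ?_, fun v => ?_⟩⟩⟩
  · simp [T.move_zero]
  · refine Subtype.ext (Prod.ext ?_ (Prod.ext ?_ ?_))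
    · exact T.move_one_eq ha v.2.1 hx
    · exact T.move_one_eq hb v.2.2.1 hy
    · exact T.move_one_eq hc v.2.2.2.1 hz

end ThetaSpace

/-- The unordered configuration `s` consists of the points `x`, `y`, `z`. -/
def IsConf {Y : Type*} [TopologicalSpace Y] (s : UConf 3 Y) (x y z : Y) : Prop :=
  ∃ h : Function.Injective ![x, y, z], s = Quot.mk (permRel 3 Y) ⟨![x, y, z], h⟩

theorem injective_triple {Y : Type*} {x y z : Y} :
    Function.Injective ![x, y, z] ↔ x ≠ y ∧ x ≠ z ∧ y ≠ z := by
  constructor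
  · intro h
    refine ⟨fun e => ?_, fun e => ?_, fun e => ?_⟩
    · exact absurd (@h 0 1 e) (by decide)
    · exact absurd (@h 0 2 e) (by decide)
    · exact absurd (@h 1 2 e) (by decide)
  · rintro ⟨h1, h2, h3⟩ i j hij
    fin_cases i <;> fin_cases j <;> first | rfl | (exfalso; simp_all)

section UConf

variable {Y : Type*} [TopologicalSpace Y]

theorem exists_isConf (s : UConf 3 Y) : ∃ x y z, IsConf s x y z := by
  obtain ⟨⟨f, hf⟩, rfl⟩ := Quot.exists_rep s
  have : f = ![f 0, f 1, f 2] := by funext i; fin_cases i <;> rfl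
  exact ⟨f 0, f 1, f 2, this ▸ hf, congrArg _ (Subtype.ext this)⟩

theorem IsConf.of_perm {s : UConf 3 Y} {x y z : Y} (h : IsConf s x y z) {x' y' z' : Y}
    (σ : Equiv.Perm (Fin 3)) (hσ : ![x, y, z] ∘ σ = ![x', y', z']) : IsConf s x' y' z' := by
  obtain ⟨hi, rfl⟩ := h
  exact ⟨hσ ▸ hi.comp σ.injective, Quot.sound ⟨σ, hσ⟩⟩

theorem IsConf.swap₀₁ {s : UConf 3 Y} {x y z : Y} (h : IsConf s x y z) : IsConf s y x z :=
  h.of_perm (Equiv.swap 0 1) (by funext i; fin_cases i <;> rfl)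

theorem IsConf.swap₁₂ {s : UConf 3 Y} {x y z : Y} (h : IsConf s x y z) : IsConf s x z y :=
  h.of_perm (Equiv.swap 1 2) (by funext i; fin_cases i <;> rfl)

theorem IsConf.ne {s : UConf 3 Y} {x y z : Y} (h : IsConf s x y z) : x ≠ y ∧ x ≠ z ∧ y ≠ z :=
  injective_triple.1 h.1

theorem permRel_equivalence (n : ℕ) (Y : Type*) : Equivalence (permRel n Y) where
  refl f := ⟨1, rfl⟩
  symm := by
    rintro f g ⟨σ, h⟩
    exact ⟨σ⁻¹, by rw [← h]; funext i; simp⟩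
  trans := by
    rintro f g k ⟨σ, h⟩ ⟨τ, h'⟩
    exact ⟨σ * τ, by rw [← h', ← h]; rfl⟩

theorem quot_permRel_eq {n : ℕ} {Y : Type*} {f g : {f : Fin n → Y // Function.Injective f}} :
    Quot.mk (permRel n Y) f = Quot.mk (permRel n Y) g ↔ permRel n Y f g :=
  Quot.eq.trans (by rw [(permRel_equivalence n Y).eqvGen_iff])

theorem IsConf.eq_or {s : UConf 3 Y} {x y z x' y' z' : Y} (h : IsConf s x y z)
    (h' : IsConf s x' y' z') :
    (x' = x ∧ y' = y ∧ z' = z) ∨ (x' = x ∧ y' = z ∧ z' = y) ∨ (x' = y ∧ y' = x ∧ z' = z) ∨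
    (x' = y ∧ y' = z ∧ z' = x) ∨ (x' = z ∧ y' = x ∧ z' = y) ∨ (x' = z ∧ y' = y ∧ z' = x) := by
  obtain ⟨hi, rfl⟩ := h
  obtain ⟨hi', he⟩ := h'
  obtain ⟨σ, hσ⟩ := quot_permRel_eq.1 he
  have h0 : ![x, y, z] (σ 0) = x' := congrFun hσ 0
  have h1 : ![x, y, z] (σ 1) = y' := congrFun hσ 1
  have h2 : ![x, y, z] (σ 2) = z' := congrFun hσ 2
  have d01 : σ 0 ≠ σ 1 := σ.injective.ne (by decide)
  have d02 : σ 0 ≠ σ 2 := σ.injective.ne (by decide)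
  have d12 : σ 1 ≠ σ 2 := σ.injective.ne (by decide)
  generalize σ 0 = a at *
  generalize σ 1 = b at *
  generalize σ 2 = c at *
  subst h0 h1 h2
  clear hσ hi' he
  fin_cases a <;> fin_cases b <;> fin_cases c <;> simp at d01 d02 d12 ⊢

theorem isOpenMap_quot_permRel (n : ℕ) (Y : Type*) [TopologicalSpace Y] :
    IsOpenMap (Quot.mk (permRel n Y)) := by
  intro O hO
  change IsOpen (Quot.mk (permRel n Y) ⁻¹' _)
  have : Quot.mk (permRel n Y) ⁻¹' (Quot.mk (permRel n Y) '' O) =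
      ⋃ σ : Equiv.Perm (Fin n), (fun f : {f : Fin n → Y // Function.Injective f} =>
        (⟨f.1 ∘ σ, f.2.comp σ.injective⟩ : {f : Fin n → Y // Function.Injective f})) ⁻¹' O := by
    ext f
    simp only [mem_preimage, mem_image, mem_iUnion]
    constructor
    · rintro ⟨g, hg, h⟩
      obtain ⟨σ, hσ⟩ := quot_permRel_eq.1 h.symm
      exact ⟨σ, by convert hg⟩
    · rintro ⟨σ, hσ⟩
      exact ⟨_, hσ, (Quot.sound ⟨σ, rfl⟩ : Quot.mk _ f = _).symm⟩
  rw [this]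
  refine isOpen_iUnion fun σ => hO.preimage ?_
  refine Continuous.subtype_mk (continuous_pi fun i => ?_) _
  exact (continuous_apply (σ i)).comp
    (continuous_subtype_val (p := fun f : Fin n → Y => Function.Injective f))

end UConf

namespace ThetaSpace

variable {Y : Type*} [TopologicalSpace Y] (T : ThetaSpace Y)

theorem edge_unique {i j : Fin 4} {x : Y} (hi : x ∈ T.stratum (.edge i))
    (hj : x ∈ T.stratum (.edge j)) : i = j :=
  T.eq_of_mem_E i j x hi.1 hj.1 hi.2.1 hi.2.2

/-- Configurations that admit a labelling of their points in a given region. -/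
def cell (a b c : ThetaLabel) (K : ℝ → ℝ → ℝ → Prop) : Set (UConf 3 Y) :=
  {s | ∃ x y z, (x, y, z) ∈ T.region a b c K ∧ IsConf s x y z}

theorem isOpen_setOf_isConf {V : Set (Y × Y × Y)} (hV : IsOpen V) :
    IsOpen {s : UConf 3 Y | ∃ x y z, (x, y, z) ∈ V ∧ IsConf s x y z} := by
  have : {s : UConf 3 Y | ∃ x y z, (x, y, z) ∈ V ∧ IsConf s x y z} = Quot.mk (permRel 3 Y) ''
      {f : {f : Fin 3 → Y // Function.Injective f} | (f.1 0, f.1 1, f.1 2) ∈ V} := by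
    ext s
    constructor
    · rintro ⟨x, y, z, hv, h, rfl⟩
      exact ⟨⟨_, h⟩, hv, rfl⟩
    · rintro ⟨⟨f, hf⟩, hv, rfl⟩
      have : f = ![f 0, f 1, f 2] := by funext i; fin_cases i <;> rfl
      exact ⟨_, _, _, hv, this ▸ hf, congrArg _ (Subtype.ext this)⟩
  rw [this]
  refine isOpenMap_quot_permRel 3 Y _ (hV.preimage ?_)
  have h (i : Fin 3) : Continuous fun f : {f : Fin 3 → Y // Function.Injective f} => f.1 i :=
    (continuous_apply i).comp continuous_subtype_val
  exact (h 0).prodMk ((h 1).prodMk (h 2))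

theorem isOpen_region {K : ℝ → ℝ → ℝ → Prop} (hK : IsOpen {v : ℝ × ℝ × ℝ | K v.1 v.2.1 v.2.2})
    (a b c : ThetaLabel) : IsOpen (T.region a b c K) := by
  have h1 := T.continuous_h
  have e : T.region a b c K = (Prod.fst ⁻¹' T.stratum a) ∩ ((fun v => v.2.1) ⁻¹' T.stratum b ∩
      ((fun v => v.2.2) ⁻¹' T.stratum c ∩ (fun v => (T.h v.1, T.h v.2.1, T.h v.2.2)) ⁻¹'
        {v : ℝ × ℝ × ℝ | K v.1 v.2.1 v.2.2})) := rfl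
  rw [e]
  exact ((T.isOpen_stratum a).preimage continuous_fst).inter
    (((T.isOpen_stratum b).preimage (by fun_prop)).inter
      (((T.isOpen_stratum c).preimage (by fun_prop)).inter (hK.preimage (by fun_prop))))

theorem isOpen_cell {K : ℝ → ℝ → ℝ → Prop} (hK : IsOpen {v : ℝ × ℝ × ℝ | K v.1 v.2.1 v.2.2})
    (a b c : ThetaLabel) : IsOpen (T.cell a b c K) :=
  isOpen_setOf_isConf (T.isOpen_region hK a b c)

theorem continuous_conf {Z : Type*} [TopologicalSpace Z] {x y z : Z → Y} (hx : Continuous x)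
    (hy : Continuous y) (hz : Continuous z) (h : ∀ w, Function.Injective ![x w, y w, z w]) :
    Continuous fun w => (Quot.mk _ ⟨![x w, y w, z w], h w⟩ : UConf 3 Y) := by
  refine continuous_quot_mk.comp (Continuous.subtype_mk (continuous_pi fun i => ?_) _)
  fin_cases i
  · exact hx
  · exact hy
  · exact hz

/-- All triples in the region consist of distinct points. -/
def Separated (a b c : ThetaLabel) (K : ℝ → ℝ → ℝ → Prop) : Prop :=
  ∀ x y z, (x, y, z) ∈ T.region a b c K → x ≠ y ∧ x ≠ z ∧ y ≠ z

variable {T} {a b c : ThetaLabel} {K : ℝ → ℝ → ℝ → Prop} {α β γ : ℝ}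

/-- The configuration of a triple in a separated region. -/
def cellMap (hs : T.Separated a b c K) (v : T.region a b c K) : UConf 3 Y :=
  Quot.mk _ ⟨![v.1.1, v.1.2.1, v.1.2.2], injective_triple.2 (hs _ _ _ v.2)⟩

theorem continuous_cellMap (hs : T.Separated a b c K) : Continuous (cellMap hs) :=
  continuous_conf (x := fun v : T.region a b c K => v.1.1) (y := fun v => v.1.2.1)
    (z := fun v => v.1.2.2) (by fun_prop) (by fun_prop) (by fun_prop) _

theorem range_cellMap (hs : T.Separated a b c K) : range (cellMap hs) = T.cell a b c K := by
  ext s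
  constructor
  · rintro ⟨v, rfl⟩
    exact ⟨_, _, _, v.2, _, rfl⟩
  · rintro ⟨x, y, z, hv, h, rfl⟩
    exact ⟨⟨_, hv⟩, rfl⟩

theorem isPathConnected_cell (hs : T.Separated a b c K) (ha : a.Admissible α)
    (hb : b.Admissible β) (hc : c.Admissible γ) (hK : StarAbout K α β γ) (hK' : K α β γ) :
    IsPathConnected (T.cell a b c K) := by
  have := T.contractibleSpace_region ha hb hc hK hK'
  rw [← range_cellMap hs]
  exact isPathConnected_range (continuous_cellMap hs)

theorem isSimplyConnected_cell (hs : T.Separated a b c K)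
    (hu : ∀ s x y z x' y' z', (x, y, z) ∈ T.region a b c K → (x', y', z') ∈ T.region a b c K →
      IsConf s x y z → IsConf s x' y' z' → x = x' ∧ y = y' ∧ z = z')
    (ho : IsOpen {v : ℝ × ℝ × ℝ | K v.1 v.2.1 v.2.2}) (ha : a.Admissible α)
    (hb : b.Admissible β) (hc : c.Admissible γ) (hK : StarAbout K α β γ) (hK' : K α β γ) :
    IsSimplyConnected (T.cell a b c K) := by
  have := T.contractibleSpace_region ha hb hc hK hK'
  have hinj : Function.Injective (cellMap hs) := by
    intro v w hvw
    obtain ⟨h1, h2, h3⟩ := hu (cellMap hs v) _ _ _ _ _ _ v.2 w.2 ⟨_, rfl⟩ ⟨_, hvw⟩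
    exact Subtype.ext (Prod.ext h1 (Prod.ext h2 h3))
  have hopen : IsOpenMap (cellMap hs) := by
    intro O hO
    convert isOpen_setOf_isConf ((T.isOpen_region ho a b c).isOpenMap_subtype_val O hO) using 1
    ext s
    constructor
    · rintro ⟨v, hv, rfl⟩
      exact ⟨_, _, _, ⟨v, hv, rfl⟩, _, rfl⟩
    · rintro ⟨x, y, z, ⟨⟨_, hr⟩, hv, rfl⟩, h, rfl⟩
      exact ⟨⟨_, hr⟩, hv, rfl⟩
  have he := (IsOpenEmbedding.of_continuous_injective_isOpenMap (continuous_cellMap hs) hinj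
    hopen).isEmbedding
  rw [← range_cellMap hs]
  exact he.toHomeomorph.toHomotopyEquiv.simplyConnectedSpace_iff.1 inferInstance

variable (T)

/-- Every configuration is sorted by height and can be pushed to a generic one. -/
theorem exists_sorted (s : UConf 3 Y) : ∃ x y z, IsConf s x y z ∧ T.h x ≤ T.h y ∧ T.h y ≤ T.h z := by
  obtain ⟨x, y, z, h⟩ := exists_isConf s
  rcases le_total (T.h x) (T.h y) with h1 | h1 <;> rcases le_total (T.h y) (T.h z) with h2 | h2 <;>
    rcases le_total (T.h x) (T.h z) with h3 | h3
  · exact ⟨_, _, _, h, h1, h2⟩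
  · exact ⟨_, _, _, h, h1, h2⟩
  · exact ⟨_, _, _, h.swap₁₂, h3, h2⟩
  · exact ⟨_, _, _, h.swap₁₂.swap₀₁, h3, h1⟩
  · exact ⟨_, _, _, h.swap₀₁, h1, h3⟩
  · exact ⟨_, _, _, h.swap₀₁.swap₁₂, h2, h3⟩
  · exact ⟨_, _, _, h.swap₀₁.swap₁₂.swap₀₁, h2, h1⟩
  · exact ⟨_, _, _, h.swap₀₁.swap₁₂.swap₀₁, h2, h1⟩

theorem exists_mem_edge {x : Y} (h0 : 0 < T.h x) (h1 : T.h x < 1) : ∃ i, x ∈ T.stratum (.edge i) :=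
  (T.exists_mem_E x).imp fun _ hi => ⟨hi, h0, h1⟩

theorem exists_edges_of_tie {x y : Y} (hxy : x ≠ y) (h : T.h x = T.h y) :
    ∃ i j, i ≠ j ∧ x ∈ T.stratum (.edge i) ∧ y ∈ T.stratum (.edge j) := by
  have h0 : 0 < T.h x := (T.h_nonneg x).lt_of_ne fun e => hxy
    (T.eq_of_h_eq_zero _ _ e.symm (h ▸ e.symm))
  have h1 : T.h x < 1 := (T.h_le_one x).lt_of_ne fun e => hxy
    (T.eq_of_h_eq_one _ _ e (h ▸ e))
  obtain ⟨i, hi⟩ := T.exists_mem_edge h0 h1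
  obtain ⟨j, hj⟩ := T.exists_mem_edge (h ▸ h0) (h ▸ h1)
  refine ⟨i, j, ?_, hi, hj⟩
  rintro rfl
  exact hxy (by rw [← T.arc_h i x hi.1, ← T.arc_h i y hj.1, h])

theorem ne_of_edge {i j : Fin 4} (hij : i ≠ j) {x y : Y} (hx : x ∈ T.stratum (.edge i))
    (hy : y ∈ T.stratum (.edge j)) : x ≠ y := by
  rintro rfl
  exact hij (T.edge_unique hx hy)

theorem ne_of_h_lt {x y : Y} (h : T.h x < T.h y) : x ≠ y := by
  rintro rfl
  exact lt_irrefl _ h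

theorem exists_generic_target (s : UConf 3 Y) : ∃ (x y z : Y) (a b c : ThetaLabel) (α β γ : ℝ),
    IsConf s x y z ∧ T.h x ≤ T.h y ∧ T.h y ≤ T.h z ∧ x ∈ T.stratum a ∧ y ∈ T.stratum b ∧
    z ∈ T.stratum c ∧ a.Admissible α ∧ b.Admissible β ∧ c.Admissible γ ∧ α < β ∧ β < γ := by
  obtain ⟨x, y, z, h, hxy, hyz⟩ := T.exists_sorted s
  obtain ⟨n1, n2, n3⟩ := h.ne
  rcases hxy.eq_or_lt with h1 | h1 <;> rcases hyz.eq_or_lt with h2 | h2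
  · obtain ⟨i, j, -, hi, hj⟩ := T.exists_edges_of_tie n1 h1
    obtain ⟨-, k, -, -, hk⟩ := T.exists_edges_of_tie n3 h2
    exact ⟨x, y, z, _, _, _, 1 / 4, 1 / 2, 3 / 4, h, hxy, hyz, hi, hj, hk, by constructor <;> norm_num,
      by constructor <;> norm_num, by constructor <;> norm_num, by norm_num, by norm_num⟩
  · obtain ⟨i, j, -, hi, hj⟩ := T.exists_edges_of_tie n1 h1
    exact ⟨x, y, z, _, _, .hi, 1 / 4, 1 / 2, 1, h, hxy, hyz, hi, hj, hj.2.1.trans h2,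
      by constructor <;> norm_num, by constructor <;> norm_num, rfl, by norm_num, by norm_num⟩
  · obtain ⟨i, j, -, hi, hj⟩ := T.exists_edges_of_tie n3 h2
    exact ⟨x, y, z, .lo, _, _, 0, 1 / 2, 3 / 4, h, hxy, hyz, h1.trans hi.2.2, hi, hj, rfl,
      by constructor <;> norm_num, by constructor <;> norm_num, by norm_num, by norm_num⟩
  · obtain ⟨i, hi⟩ := T.exists_mem_edge ((T.h_nonneg x).trans_lt h1) (h2.trans_le (T.h_le_one z))
    exact ⟨x, y, z, .lo, _, .hi, 0, 1 / 2, 1, h, hxy, hyz, h1.trans hi.2.2, hi, hi.2.1.trans h2, rfl,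
      by constructor <;> norm_num, rfl, by norm_num, by norm_num⟩

/-- Configurations of points at distinct heights. -/
def generic : Set (UConf 3 Y) := {s | ∃ x y z, IsConf s x y z ∧ T.h x < T.h y ∧ T.h y < T.h z}

theorem exists_generic_joinedIn (s : UConf 3 Y) (N : Set (UConf 3 Y)) (hN : IsOpen N)
    (hs : s ∈ N) : ∃ s' ∈ T.generic, JoinedIn N s' s := by
  obtain ⟨x, y, z, a, b, c, α, β, γ, h, hxy, hyz, hx, hy, hz, ha, hb, hc, hαβ, hβγ⟩ :=
    T.exists_generic_target s
  have lt {u v μ ν : ℝ} (huv : u ≤ v) (hμν : μ < ν) {t : unitInterval} (ht : 0 < t) :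
      (1 - (t : ℝ)) * u + t * μ < (1 - (t : ℝ)) * v + t * ν := by
    have h0 : (0 : ℝ) < t := ht
    nlinarith [mul_le_mul_of_nonneg_left huv (sub_nonneg.2 t.2.2), mul_lt_mul_of_pos_left hμν h0]
  have lt1 {t : unitInterval} (ht : 0 < t) : T.h (T.move α x t) < T.h (T.move β y t) := by
    rw [T.h_move ha.mem_Icc _ t.2, T.h_move hb.mem_Icc _ t.2]
    exact lt hxy hαβ ht
  have lt2 {t : unitInterval} (ht : 0 < t) : T.h (T.move β y t) < T.h (T.move γ z t) := by
    rw [T.h_move hb.mem_Icc _ t.2, T.h_move hc.mem_Icc _ t.2]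
    exact lt hyz hβγ ht
  have hinj (t : unitInterval) :
      Function.Injective ![T.move α x t, T.move β y t, T.move γ z t] := by
    rcases t.2.1.eq_or_lt with h0 | h0
    · simpa only [← h0, T.move_zero] using h.1
    · exact injective_triple.2 ⟨T.ne_of_h_lt (lt1 h0), T.ne_of_h_lt ((lt1 h0).trans (lt2 h0)),
        T.ne_of_h_lt (lt2 h0)⟩
  let f : unitInterval → UConf 3 Y := fun t => Quot.mk _ ⟨_, hinj t⟩
  have hf : Continuous f := continuous_conf
    (x := fun t : unitInterval => T.move α x t) (y := fun t => T.move β y t)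
    (z := fun t => T.move γ z t)
    ((T.continuous_move ha).comp
      (f := fun t : unitInterval => ((⟨x, hx⟩ : T.stratum a), t)) (by fun_prop))
    ((T.continuous_move hb).comp
      (f := fun t : unitInterval => ((⟨y, hy⟩ : T.stratum b), t)) (by fun_prop))
    ((T.continuous_move hc).comp
      (f := fun t : unitInterval => ((⟨z, hz⟩ : T.stratum c), t)) (by fun_prop)) hinj
  have hf0 : f 0 = s := by
    obtain ⟨hi, rfl⟩ := h
    refine congrArg (Quot.mk _) (Subtype.ext ?_)
    simp [T.move_zero]
  obtain ⟨u, hu, hsub⟩ := exists_Ico_subset_of_mem_nhds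
    ((hN.preimage hf).mem_nhds (by rwa [mem_preimage, hf0])) ⟨1, zero_lt_one⟩
  obtain ⟨t, ht0, htu⟩ := exists_between hu
  refine ⟨f t, ⟨_, _, _, ⟨hinj t, rfl⟩, lt1 ht0, lt2 ht0⟩, ?_⟩
  refine JoinedIn.symm ⟨⟨⟨fun r => f (t * r), by fun_prop⟩, by simp [hf0], by simp⟩, fun r => ?_⟩
  exact hsub ⟨zero_le, lt_of_le_of_lt unitInterval.mul_le_left htu⟩

end ThetaSpace

namespace ThetaSpace

variable {Y : Type*} [TopologicalSpace Y] (T : ThetaSpace Y)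

/-- The middle point lies inside the edge `m`. -/
def chartW (m : Fin 4) : Set (UConf 3 Y) :=
  T.cell .lo (.edge m) .hi fun k₀ k₁ k₂ => k₀ < k₁ ∧ k₁ < k₂

/-- The two lower points lie inside the edges `i` and `j`. -/
def chartP (i j : Fin 4) : Set (UConf 3 Y) :=
  T.cell (.edge i) (.edge j) .hi fun k₀ k₁ k₂ => i ≠ j ∧ k₀ < k₂ ∧ k₁ < k₂

/-- The two upper points lie inside the edges `i` and `j`. -/
def chartQ (i j : Fin 4) : Set (UConf 3 Y) :=
  T.cell .lo (.edge i) (.edge j) fun k₀ k₁ k₂ => i ≠ j ∧ k₀ < k₁ ∧ k₀ < k₂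

/-- The three points lie inside the edges `i`, `j` and `k`. -/
def chartT (i j k : Fin 4) : Set (UConf 3 Y) :=
  T.cell (.edge i) (.edge j) (.edge k) fun _ _ _ => i ≠ j ∧ i ≠ k ∧ j ≠ k

/-- The part of `chartP l m` where the point on edge `l` is the lowest. -/
def chamberP (l m : Fin 4) : Set (UConf 3 Y) :=
  T.cell (.edge l) (.edge m) .hi fun k₀ k₁ k₂ => l ≠ m ∧ k₀ < k₁ ∧ k₁ < k₂

/-- The part of `chartQ m u` where the point on edge `u` is the highest. -/
def chamberQ (m u : Fin 4) : Set (UConf 3 Y) :=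
  T.cell .lo (.edge m) (.edge u) fun k₀ k₁ k₂ => m ≠ u ∧ k₀ < k₁ ∧ k₁ < k₂

/-- The part of `chartT l m u` where the points on `l`, `m`, `u` are in increasing order. -/
def chamberT (l m u : Fin 4) : Set (UConf 3 Y) :=
  T.cell (.edge l) (.edge m) (.edge u) fun k₀ k₁ k₂ =>
    (l ≠ m ∧ l ≠ u ∧ m ≠ u) ∧ k₀ < k₁ ∧ k₁ < k₂

/-- The part of `chartT l m u` where the point on edge `u` is the highest. -/
def wallP (l m u : Fin 4) : Set (UConf 3 Y) :=
  T.cell (.edge l) (.edge m) (.edge u) fun k₀ k₁ k₂ =>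
    (l ≠ m ∧ l ≠ u ∧ m ≠ u) ∧ k₀ < k₂ ∧ k₁ < k₂

/-- The part of `chartT l m u` where the point on edge `l` is the lowest. -/
def wallQ (l m u : Fin 4) : Set (UConf 3 Y) :=
  T.cell (.edge l) (.edge m) (.edge u) fun k₀ k₁ k₂ =>
    (l ≠ m ∧ l ≠ u ∧ m ≠ u) ∧ k₀ < k₁ ∧ k₀ < k₂

section Open

theorem isOpen_order₀₁ : IsOpen {v : ℝ × ℝ × ℝ | v.1 < v.2.1} :=
  isOpen_lt (by fun_prop) (by fun_prop)

theorem isOpen_order₀₂ : IsOpen {v : ℝ × ℝ × ℝ | v.1 < v.2.2} :=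
  isOpen_lt (by fun_prop) (by fun_prop)

theorem isOpen_order₁₂ : IsOpen {v : ℝ × ℝ × ℝ | v.2.1 < v.2.2} :=
  isOpen_lt (by fun_prop) (by fun_prop)

theorem isOpen_chartW (m : Fin 4) : IsOpen (T.chartW m) :=
  T.isOpen_cell (isOpen_order₀₁.and isOpen_order₁₂) _ _ _

theorem isOpen_chartP (i j : Fin 4) : IsOpen (T.chartP i j) :=
  T.isOpen_cell (isOpen_const.and (isOpen_order₀₂.and isOpen_order₁₂)) _ _ _

theorem isOpen_chartQ (i j : Fin 4) : IsOpen (T.chartQ i j) :=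
  T.isOpen_cell (isOpen_const.and (isOpen_order₀₁.and isOpen_order₀₂)) _ _ _

theorem isOpen_chartT (i j k : Fin 4) : IsOpen (T.chartT i j k) :=
  T.isOpen_cell isOpen_const _ _ _

theorem isOpen_chamberP (l m : Fin 4) : IsOpen (T.chamberP l m) :=
  T.isOpen_cell (isOpen_const.and (isOpen_order₀₁.and isOpen_order₁₂)) _ _ _

theorem isOpen_chamberQ (m u : Fin 4) : IsOpen (T.chamberQ m u) :=
  T.isOpen_cell (isOpen_const.and (isOpen_order₀₁.and isOpen_order₁₂)) _ _ _

theorem isOpen_chamberT (l m u : Fin 4) : IsOpen (T.chamberT l m u) :=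
  T.isOpen_cell (isOpen_const.and (isOpen_order₀₁.and isOpen_order₁₂)) _ _ _

theorem isOpen_wallP (l m u : Fin 4) : IsOpen (T.wallP l m u) :=
  T.isOpen_cell (isOpen_const.and (isOpen_order₀₂.and isOpen_order₁₂)) _ _ _

theorem isOpen_wallQ (l m u : Fin 4) : IsOpen (T.wallQ l m u) :=
  T.isOpen_cell (isOpen_const.and (isOpen_order₀₁.and isOpen_order₀₂)) _ _ _

end Open

section Inclusions

variable {T} {i j k l m u : Fin 4}

theorem chamberP_subset_chartP : T.chamberP l m ⊆ T.chartP l m := by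
  rintro s ⟨x, y, z, ⟨h1, h2, h3, hd, h4, h5⟩, h⟩
  exact ⟨x, y, z, ⟨h1, h2, h3, hd, h4.trans h5, h5⟩, h⟩

theorem chamberP_subset_chartW : T.chamberP l m ⊆ T.chartW m := by
  rintro s ⟨x, y, z, ⟨h1, h2, h3, hd, h4, h5⟩, h⟩
  exact ⟨x, y, z, ⟨h1.2.2, h2, h3, h4, h5⟩, h⟩

theorem chamberQ_subset_chartQ : T.chamberQ m u ⊆ T.chartQ m u := by
  rintro s ⟨x, y, z, ⟨h1, h2, h3, hd, h4, h5⟩, h⟩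
  exact ⟨x, y, z, ⟨h1, h2, h3, hd, h4, h4.trans h5⟩, h⟩

theorem chamberQ_subset_chartW : T.chamberQ m u ⊆ T.chartW m := by
  rintro s ⟨x, y, z, ⟨h1, h2, h3, hd, h4, h5⟩, h⟩
  exact ⟨x, y, z, ⟨h1, h2, h3.2.1, h4, h5⟩, h⟩

theorem chamberT_subset_chamberP : T.chamberT l m u ⊆ T.chamberP l m := by
  rintro s ⟨x, y, z, ⟨h1, h2, h3, hd, h4, h5⟩, h⟩
  exact ⟨x, y, z, ⟨h1, h2, h3.2.1, hd.1, h4, h5⟩, h⟩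

theorem chamberT_subset_chamberQ : T.chamberT l m u ⊆ T.chamberQ m u := by
  rintro s ⟨x, y, z, ⟨h1, h2, h3, hd, h4, h5⟩, h⟩
  exact ⟨x, y, z, ⟨h1.2.2, h2, h3, hd.2.2, h4, h5⟩, h⟩

theorem chamberT_subset_wallP : T.chamberT l m u ⊆ T.wallP l m u := by
  rintro s ⟨x, y, z, ⟨h1, h2, h3, hd, h4, h5⟩, h⟩
  exact ⟨x, y, z, ⟨h1, h2, h3, hd, h4.trans h5, h5⟩, h⟩

theorem chamberT_subset_wallQ : T.chamberT l m u ⊆ T.wallQ l m u := by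
  rintro s ⟨x, y, z, ⟨h1, h2, h3, hd, h4, h5⟩, h⟩
  exact ⟨x, y, z, ⟨h1, h2, h3, hd, h4, h4.trans h5⟩, h⟩

theorem wallP_subset_chartP : T.wallP l m u ⊆ T.chartP l m := by
  rintro s ⟨x, y, z, ⟨h1, h2, h3, hd, h4, h5⟩, h⟩
  exact ⟨x, y, z, ⟨h1, h2, h3.2.1, hd.1, h4, h5⟩, h⟩

theorem wallQ_subset_chartQ : T.wallQ l m u ⊆ T.chartQ m u := by
  rintro s ⟨x, y, z, ⟨h1, h2, h3, hd, h4, h5⟩, h⟩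
  exact ⟨x, y, z, ⟨h1.2.2, h2, h3, hd.2.2, h4, h5⟩, h⟩

theorem wallP_subset_chartT : T.wallP l m u ⊆ T.chartT l m u := by
  rintro s ⟨x, y, z, ⟨h1, h2, h3, hd, h4, h5⟩, h⟩
  exact ⟨x, y, z, ⟨h1, h2, h3, hd⟩, h⟩

theorem wallQ_subset_chartT : T.wallQ l m u ⊆ T.chartT l m u := by
  rintro s ⟨x, y, z, ⟨h1, h2, h3, hd, h4, h5⟩, h⟩
  exact ⟨x, y, z, ⟨h1, h2, h3, hd⟩, h⟩

theorem chamberT_subset_chartT : T.chamberT l m u ⊆ T.chartT l m u :=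
  chamberT_subset_wallP.trans wallP_subset_chartT

theorem chamberT_subset_chartW : T.chamberT l m u ⊆ T.chartW m :=
  chamberT_subset_chamberP.trans chamberP_subset_chartW

theorem chartP_comm (i j : Fin 4) : T.chartP i j = T.chartP j i := by
  have (i j : Fin 4) : T.chartP i j ⊆ T.chartP j i := by
    rintro s ⟨x, y, z, ⟨h1, h2, h3, hd, h4, h5⟩, h⟩
    exact ⟨y, x, z, ⟨h2, h1, h3, hd.symm, h5, h4⟩, h.swap₀₁⟩
  exact (this i j).antisymm (this j i)

theorem chartQ_comm (i j : Fin 4) : T.chartQ i j = T.chartQ j i := by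
  have (i j : Fin 4) : T.chartQ i j ⊆ T.chartQ j i := by
    rintro s ⟨x, y, z, ⟨h1, h2, h3, hd, h4, h5⟩, h⟩
    exact ⟨x, z, y, ⟨h1, h3, h2, hd.symm, h5, h4⟩, h.swap₁₂⟩
  exact (this i j).antisymm (this j i)

theorem chartT_swap₀₁ (i j k : Fin 4) : T.chartT i j k = T.chartT j i k := by
  have (i j k : Fin 4) : T.chartT i j k ⊆ T.chartT j i k := by
    rintro s ⟨x, y, z, ⟨h1, h2, h3, hd⟩, h⟩
    exact ⟨y, x, z, ⟨h2, h1, h3, hd.1.symm, hd.2.2, hd.2.1⟩, h.swap₀₁⟩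
  exact (this i j k).antisymm (this j i k)

theorem chartT_swap₁₂ (i j k : Fin 4) : T.chartT i j k = T.chartT i k j := by
  have (i j k : Fin 4) : T.chartT i j k ⊆ T.chartT i k j := by
    rintro s ⟨x, y, z, ⟨h1, h2, h3, hd⟩, h⟩
    exact ⟨x, z, y, ⟨h1, h3, h2, hd.2.1, hd.1, hd.2.2.symm⟩, h.swap₁₂⟩
  exact (this i j k).antisymm (this i k j)

theorem wallP_comm (l m u : Fin 4) : T.wallP l m u = T.wallP m l u := by
  have (i j k : Fin 4) : T.wallP i j k ⊆ T.wallP j i k := by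
    rintro s ⟨x, y, z, ⟨h1, h2, h3, hd, h4, h5⟩, h⟩
    exact ⟨y, x, z, ⟨h2, h1, h3, ⟨hd.1.symm, hd.2.2, hd.2.1⟩, h5, h4⟩, h.swap₀₁⟩
  exact (this l m u).antisymm (this m l u)

theorem wallQ_comm (l m u : Fin 4) : T.wallQ l m u = T.wallQ l u m := by
  have (i j k : Fin 4) : T.wallQ i j k ⊆ T.wallQ i k j := by
    rintro s ⟨x, y, z, ⟨h1, h2, h3, hd, h4, h5⟩, h⟩
    exact ⟨x, z, y, ⟨h1, h3, h2, ⟨hd.2.1, hd.1, hd.2.2.symm⟩, h5, h4⟩, h.swap₁₂⟩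
  exact (this l m u).antisymm (this l u m)

theorem ne_of_mem_chartP {s : UConf 3 Y} (hs : s ∈ T.chartP i j) : i ≠ j := by
  obtain ⟨x, y, z, ⟨-, -, -, h, -⟩, -⟩ := hs
  exact h

theorem ne_of_mem_chartQ {s : UConf 3 Y} (hs : s ∈ T.chartQ i j) : i ≠ j := by
  obtain ⟨x, y, z, ⟨-, -, -, h, -⟩, -⟩ := hs
  exact h

theorem ne_of_mem_chartT {s : UConf 3 Y} (hs : s ∈ T.chartT i j k) : i ≠ j ∧ i ≠ k ∧ j ≠ k := by
  obtain ⟨x, y, z, ⟨-, -, -, h⟩, -⟩ := hs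
  exact h

end Inclusions

section Topology

theorem starAbout_and {K K' : ℝ → ℝ → ℝ → Prop} {α β γ : ℝ} (h : StarAbout K α β γ)
    (h' : StarAbout K' α β γ) : StarAbout (fun x y z => K x y z ∧ K' x y z) α β γ :=
  fun x y z s hk hs => ⟨h x y z s hk.1 hs, h' x y z s hk.2 hs⟩

theorem starAbout_const {p : Prop} {α β γ : ℝ} : StarAbout (fun _ _ _ => p) α β γ :=
  fun _ _ _ _ hk _ => hk

theorem convexComb_lt {x y α β s : ℝ} (hxy : x < y) (hs : s ∈ unitInterval) (h : α < β) :
    (1 - s) * x + s * α < (1 - s) * y + s * β := by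
  obtain ⟨h0, h1⟩ := hs
  rcases h0.eq_or_lt with rfl | h0
  · simpa using hxy
  · nlinarith [mul_le_mul_of_nonneg_left hxy.le (sub_nonneg.2 h1), mul_lt_mul_of_pos_left h h0]

theorem starAbout_order₀₁ {α β γ : ℝ} (h : α < β) : StarAbout (fun x y _ => x < y) α β γ :=
  fun _ _ _ _ hk hs => convexComb_lt hk hs h

theorem starAbout_order₀₂ {α β γ : ℝ} (h : α < γ) : StarAbout (fun x _ z => x < z) α β γ :=
  fun _ _ _ _ hk hs => convexComb_lt hk hs h

theorem starAbout_order₁₂ {α β γ : ℝ} (h : β < γ) : StarAbout (fun _ y z => y < z) α β γ :=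
  fun _ _ _ _ hk hs => convexComb_lt hk hs h

theorem isSimplyConnected_chartW (m : Fin 4) : IsSimplyConnected (T.chartW m) := by
  refine isSimplyConnected_cell (α := 0) (β := 1 / 2) (γ := 1) ?_ ?_
    (isOpen_order₀₁.and isOpen_order₁₂) rfl (by constructor <;> norm_num) rfl
    (starAbout_and (starAbout_order₀₁ (by norm_num)) (starAbout_order₁₂ (by norm_num)))
    (by norm_num)
  · rintro x y z ⟨-, -, -, h1, h2⟩
    exact ⟨T.ne_of_h_lt h1, T.ne_of_h_lt (h1.trans h2), T.ne_of_h_lt h2⟩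
  · rintro s x y z x' y' z' ⟨-, -, -, h1, h2⟩ ⟨-, -, -, h1', h2'⟩ h h'
    dsimp only at *
    rcases h.eq_or h' with H | H | H | H | H | H <;> obtain ⟨rfl, rfl, rfl⟩ := H <;>
      first | exact ⟨rfl, rfl, rfl⟩ | (exfalso; linarith)

theorem isSimplyConnected_chartP {i j : Fin 4} (hij : i ≠ j) :
    IsSimplyConnected (T.chartP i j) := by
  refine isSimplyConnected_cell (α := 1 / 2) (β := 1 / 2) (γ := 1) ?_ ?_
    (isOpen_const.and (isOpen_order₀₂.and isOpen_order₁₂)) (by constructor <;> norm_num)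
    (by constructor <;> norm_num) rfl (starAbout_and starAbout_const
      (starAbout_and (starAbout_order₀₂ (by norm_num)) (starAbout_order₁₂ (by norm_num))))
    ⟨hij, by norm_num⟩
  · rintro x y z ⟨hx, hy, -, -, h1, h2⟩
    exact ⟨T.ne_of_edge hij hx hy, T.ne_of_h_lt h1, T.ne_of_h_lt h2⟩
  · rintro s x y z x' y' z' ⟨hx, hy, -, -, h1, h2⟩ ⟨hx', hy', -, -, h1', h2'⟩ h h'
    dsimp only at *
    rcases h.eq_or h' with H | H | H | H | H | H <;> obtain ⟨rfl, rfl, rfl⟩ := H <;>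
      first | exact ⟨rfl, rfl, rfl⟩ | (exfalso; linarith) | exact absurd (T.edge_unique hx hy') hij

theorem isSimplyConnected_chartQ {i j : Fin 4} (hij : i ≠ j) :
    IsSimplyConnected (T.chartQ i j) := by
  refine isSimplyConnected_cell (α := 0) (β := 1 / 2) (γ := 1 / 2) ?_ ?_
    (isOpen_const.and (isOpen_order₀₁.and isOpen_order₀₂)) rfl (by constructor <;> norm_num)
    (by constructor <;> norm_num) (starAbout_and starAbout_const
      (starAbout_and (starAbout_order₀₁ (by norm_num)) (starAbout_order₀₂ (by norm_num))))
    ⟨hij, by norm_num⟩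
  · rintro x y z ⟨-, hy, hz, -, h1, h2⟩
    exact ⟨T.ne_of_h_lt h1, T.ne_of_h_lt h2, T.ne_of_edge hij hy hz⟩
  · rintro s x y z x' y' z' ⟨-, hy, hz, -, h1, h2⟩ ⟨-, hy', hz', -, h1', h2'⟩ h h'
    dsimp only at *
    rcases h.eq_or h' with H | H | H | H | H | H <;> obtain ⟨rfl, rfl, rfl⟩ := H <;>
      first | exact ⟨rfl, rfl, rfl⟩ | (exfalso; linarith) | exact absurd (T.edge_unique hy hz') hij

theorem isSimplyConnected_chartT {i j k : Fin 4} (hd : i ≠ j ∧ i ≠ k ∧ j ≠ k) :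
    IsSimplyConnected (T.chartT i j k) := by
  refine isSimplyConnected_cell (α := 1 / 2) (β := 1 / 2) (γ := 1 / 2) ?_ ?_
    isOpen_const (by constructor <;> norm_num) (by constructor <;> norm_num)
    (by constructor <;> norm_num) starAbout_const hd
  · rintro x y z ⟨hx, hy, hz, -⟩
    exact ⟨T.ne_of_edge hd.1 hx hy, T.ne_of_edge hd.2.1 hx hz, T.ne_of_edge hd.2.2 hy hz⟩
  · rintro s x y z x' y' z' ⟨hx, hy, hz, -⟩ ⟨hx', hy', hz', -⟩ h h'
    dsimp only at *
    rcases h.eq_or h' with H | H | H | H | H | H <;> obtain ⟨rfl, rfl, rfl⟩ := H <;>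
      first
      | exact ⟨rfl, rfl, rfl⟩
      | exact absurd (T.edge_unique hx hy') hd.1
      | exact absurd (T.edge_unique hx hz') hd.2.1
      | exact absurd (T.edge_unique hy hz') hd.2.2

theorem isPathConnected_chamberP {l m : Fin 4} (hlm : l ≠ m) :
    IsPathConnected (T.chamberP l m) := by
  refine isPathConnected_cell (α := 1 / 4) (β := 1 / 2) (γ := 1) ?_ (by constructor <;> norm_num)
    (by constructor <;> norm_num) rfl (starAbout_and starAbout_const
      (starAbout_and (starAbout_order₀₁ (by norm_num)) (starAbout_order₁₂ (by norm_num))))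
    ⟨hlm, by norm_num⟩
  rintro x y z ⟨-, -, -, -, h1, h2⟩
  exact ⟨T.ne_of_h_lt h1, T.ne_of_h_lt (h1.trans h2), T.ne_of_h_lt h2⟩

theorem isPathConnected_chamberQ {m u : Fin 4} (hmu : m ≠ u) :
    IsPathConnected (T.chamberQ m u) := by
  refine isPathConnected_cell (α := 0) (β := 1 / 4) (γ := 1 / 2) ?_ rfl
    (by constructor <;> norm_num) (by constructor <;> norm_num) (starAbout_and starAbout_const
      (starAbout_and (starAbout_order₀₁ (by norm_num)) (starAbout_order₁₂ (by norm_num))))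
    ⟨hmu, by norm_num⟩
  rintro x y z ⟨-, -, -, -, h1, h2⟩
  exact ⟨T.ne_of_h_lt h1, T.ne_of_h_lt (h1.trans h2), T.ne_of_h_lt h2⟩

theorem isPathConnected_chamberT {l m u : Fin 4} (hd : l ≠ m ∧ l ≠ u ∧ m ≠ u) :
    IsPathConnected (T.chamberT l m u) := by
  refine isPathConnected_cell (α := 1 / 4) (β := 1 / 2) (γ := 3 / 4) ?_
    (by constructor <;> norm_num) (by constructor <;> norm_num) (by constructor <;> norm_num)
    (starAbout_and starAbout_const
      (starAbout_and (starAbout_order₀₁ (by norm_num)) (starAbout_order₁₂ (by norm_num))))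
    ⟨hd, by norm_num⟩
  rintro x y z ⟨-, -, -, -, h1, h2⟩
  exact ⟨T.ne_of_h_lt h1, T.ne_of_h_lt (h1.trans h2), T.ne_of_h_lt h2⟩

theorem isPathConnected_wallP {l m u : Fin 4} (hd : l ≠ m ∧ l ≠ u ∧ m ≠ u) :
    IsPathConnected (T.wallP l m u) := by
  refine isPathConnected_cell (α := 1 / 4) (β := 1 / 4) (γ := 3 / 4) ?_
    (by constructor <;> norm_num) (by constructor <;> norm_num) (by constructor <;> norm_num)
    (starAbout_and starAbout_const
      (starAbout_and (starAbout_order₀₂ (by norm_num)) (starAbout_order₁₂ (by norm_num))))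
    ⟨hd, by norm_num⟩
  rintro x y z ⟨hx, hy, hz, -⟩
  exact ⟨T.ne_of_edge hd.1 hx hy, T.ne_of_edge hd.2.1 hx hz, T.ne_of_edge hd.2.2 hy hz⟩

theorem isPathConnected_wallQ {l m u : Fin 4} (hd : l ≠ m ∧ l ≠ u ∧ m ≠ u) :
    IsPathConnected (T.wallQ l m u) := by
  refine isPathConnected_cell (α := 1 / 4) (β := 3 / 4) (γ := 3 / 4) ?_
    (by constructor <;> norm_num) (by constructor <;> norm_num) (by constructor <;> norm_num)
    (starAbout_and starAbout_const
      (starAbout_and (starAbout_order₀₁ (by norm_num)) (starAbout_order₀₂ (by norm_num))))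
    ⟨hd, by norm_num⟩
  rintro x y z ⟨hx, hy, hz, -⟩
  exact ⟨T.ne_of_edge hd.1 hx hy, T.ne_of_edge hd.2.1 hx hz, T.ne_of_edge hd.2.2 hy hz⟩

end Topology

section Intersections

variable {T} {s : UConf 3 Y} {i j k l m u : Fin 4}

theorem h_ne_of_mem_generic (hs : s ∈ T.generic) {x y z : Y} (h : IsConf s x y z) :
    T.h x ≠ T.h y ∧ T.h x ≠ T.h z ∧ T.h y ≠ T.h z := by
  obtain ⟨x', y', z', h', h1, h2⟩ := hs
  have h3 := h1.trans h2
  rcases h'.eq_or h with H | H | H | H | H | H <;> obtain ⟨rfl, rfl, rfl⟩ := H <;>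
    exact ⟨by grind, by grind, by grind⟩

theorem chartW_subset_generic : T.chartW m ⊆ T.generic := by
  rintro s ⟨x, y, z, ⟨-, -, -, h1, h2⟩, h⟩
  exact ⟨x, y, z, h, h1, h2⟩

theorem exists_mem_chartW (hs : s ∈ T.generic) : ∃ m, s ∈ T.chartW m := by
  obtain ⟨x, y, z, h, h1, h2⟩ := hs
  obtain ⟨m, hm⟩ := T.exists_mem_edge ((T.h_nonneg x).trans_lt h1) (h2.trans_le (T.h_le_one z))
  exact ⟨m, x, y, z, ⟨h1.trans hm.2.2, hm, hm.2.1.trans h2, h1, h2⟩, h⟩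

theorem chartW_unique (hs : s ∈ T.chartW l) (hs' : s ∈ T.chartW m) : l = m := by
  obtain ⟨x, y, z, ⟨-, hy, -, h1, h2⟩, h⟩ := hs
  obtain ⟨x', y', z', ⟨-, hy', -, h1', h2'⟩, h'⟩ := hs'
  dsimp only at *
  rcases h.eq_or h' with H | H | H | H | H | H <;> obtain ⟨rfl, rfl, rfl⟩ := H <;>
      first | exact T.edge_unique hy hy' | (exfalso; linarith)

theorem mem_chamberP_or (hs : s ∈ T.generic) (h : s ∈ T.chartP i j) :
    s ∈ T.chamberP i j ∨ s ∈ T.chamberP j i := by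
  obtain ⟨x, y, z, ⟨hx, hy, hz, hd, h1, h2⟩, h⟩ := h
  rcases (h_ne_of_mem_generic hs h).1.lt_or_gt with h3 | h3
  · exact .inl ⟨x, y, z, ⟨hx, hy, hz, hd, h3, h2⟩, h⟩
  · exact .inr ⟨y, x, z, ⟨hy, hx, hz, hd.symm, h3, h1⟩, h.swap₀₁⟩

theorem mem_chamberQ_or (hs : s ∈ T.generic) (h : s ∈ T.chartQ i j) :
    s ∈ T.chamberQ i j ∨ s ∈ T.chamberQ j i := by
  obtain ⟨x, y, z, ⟨hx, hy, hz, hd, h1, h2⟩, h⟩ := h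
  rcases (h_ne_of_mem_generic hs h).2.2.lt_or_gt with h3 | h3
  · exact .inl ⟨x, y, z, ⟨hx, hy, hz, hd, h1, h3⟩, h⟩
  · exact .inr ⟨x, z, y, ⟨hx, hz, hy, hd.symm, h2, h3⟩, h.swap₁₂⟩

theorem mem_chamberT_or (hs : s ∈ T.generic) (h : s ∈ T.chartT i j k) :
    s ∈ T.chamberT i j k ∨ s ∈ T.chamberT i k j ∨ s ∈ T.chamberT j i k ∨ s ∈ T.chamberT j k i ∨
      s ∈ T.chamberT k i j ∨ s ∈ T.chamberT k j i := by
  obtain ⟨x, y, z, ⟨hx, hy, hz, d1, d2, d3⟩, h⟩ := h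
  obtain ⟨n1, n2, n3⟩ := h_ne_of_mem_generic hs h
  have e1 := d1.symm
  have e2 := d2.symm
  have e3 := d3.symm
  dsimp only at *
  rcases n1.lt_or_gt with h1 | h1 <;> rcases n3.lt_or_gt with h2 | h2
  · exact .inl ⟨x, y, z, ⟨hx, hy, hz, ⟨d1, d2, d3⟩, h1, h2⟩, h⟩
  · rcases n2.lt_or_gt with h3 | h3
    · exact .inr (.inl ⟨x, z, y, ⟨hx, hz, hy, ⟨d2, d1, e3⟩, h3, h2⟩, h.swap₁₂⟩)
    · exact .inr (.inr (.inr (.inr (.inl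
        ⟨z, x, y, ⟨hz, hx, hy, ⟨e2, e3, d1⟩, h3, h1⟩, h.swap₁₂.swap₀₁⟩))))
  · rcases n2.lt_or_gt with h3 | h3
    · exact .inr (.inr (.inl ⟨y, x, z, ⟨hy, hx, hz, ⟨e1, d3, d2⟩, h1, h3⟩, h.swap₀₁⟩))
    · exact .inr (.inr (.inr (.inl
        ⟨y, z, x, ⟨hy, hz, hx, ⟨d3, e1, e2⟩, h2, h3⟩, h.swap₀₁.swap₁₂⟩)))
  · exact .inr (.inr (.inr (.inr (.inr
      ⟨z, y, x, ⟨hz, hy, hx, ⟨e3, e2, e1⟩, h2, h1⟩, h.swap₀₁.swap₁₂.swap₀₁⟩))))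

theorem mem_generic_of_chartP_chartQ (h : s ∈ T.chartP i j) (h' : s ∈ T.chartQ k l) :
    s ∈ T.generic := by
  obtain ⟨x, y, z, ⟨-, -, -, -, h1, h2⟩, h⟩ := h
  obtain ⟨x', y', z', ⟨-, -, -, -, h1', h2'⟩, h'⟩ := h'
  dsimp only at *
  rcases h.eq_or h' with H | H | H | H | H | H <;> obtain ⟨rfl, rfl, rfl⟩ := H <;>
    first
    | exact ⟨_, _, _, h, by assumption, by assumption⟩
    | exact ⟨_, _, _, h.swap₀₁, by assumption, by assumption⟩
    | (exfalso; linarith)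

theorem exists_mem_wallP (h : s ∈ T.chartP i j) (h' : s ∈ T.chartT k l m) :
    ∃ u, s ∈ T.wallP i j u := by
  obtain ⟨x, y, z, ⟨hx, hy, -, hd, h1, h2⟩, h⟩ := h
  obtain ⟨x', y', z', ⟨hx', hy', hz', d1, d2, d3⟩, h'⟩ := h'
  have e1 := d1.symm
  have e2 := d2.symm
  have e3 := d3.symm
  dsimp only at *
  rcases h.eq_or h' with H | H | H | H | H | H <;> obtain ⟨rfl, rfl, rfl⟩ := H <;>
    first
    | (obtain rfl := T.edge_unique hx hx'; obtain rfl := T.edge_unique hy hy')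
    | (obtain rfl := T.edge_unique hx hx'; obtain rfl := T.edge_unique hy hz')
    | (obtain rfl := T.edge_unique hx hy'; obtain rfl := T.edge_unique hy hx')
    | (obtain rfl := T.edge_unique hx hz'; obtain rfl := T.edge_unique hy hx')
    | (obtain rfl := T.edge_unique hx hy'; obtain rfl := T.edge_unique hy hz')
    | (obtain rfl := T.edge_unique hx hz'; obtain rfl := T.edge_unique hy hy')
  all_goals
    exact ⟨_, _, _, _, ⟨hx, hy, by assumption, ⟨hd, by assumption, by assumption⟩, h1, h2⟩, h⟩

theorem exists_mem_wallQ (h : s ∈ T.chartQ i j) (h' : s ∈ T.chartT k l m) :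
    ∃ u, s ∈ T.wallQ u i j := by
  obtain ⟨x, y, z, ⟨-, hx, hy, hd, h1, h2⟩, h⟩ := h
  obtain ⟨x', y', z', ⟨hx', hy', hz', d1, d2, d3⟩, h'⟩ := h'
  have e1 := d1.symm
  have e2 := d2.symm
  have e3 := d3.symm
  dsimp only at *
  rcases h.eq_or h' with H | H | H | H | H | H <;> obtain ⟨rfl, rfl, rfl⟩ := H <;>
    first
    | (obtain rfl := T.edge_unique hx hx'; obtain rfl := T.edge_unique hy hy')
    | (obtain rfl := T.edge_unique hx hx'; obtain rfl := T.edge_unique hy hz')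
    | (obtain rfl := T.edge_unique hx hy'; obtain rfl := T.edge_unique hy hx')
    | (obtain rfl := T.edge_unique hx hz'; obtain rfl := T.edge_unique hy hx')
    | (obtain rfl := T.edge_unique hx hy'; obtain rfl := T.edge_unique hy hz')
    | (obtain rfl := T.edge_unique hx hz'; obtain rfl := T.edge_unique hy hy')
  all_goals
    exact ⟨_, _, _, _, ⟨by assumption, hx, hy, ⟨by assumption, by assumption, hd⟩, h1, h2⟩, h⟩

theorem exists_mem_chart (T : ThetaSpace Y) (s : UConf 3 Y) :
    (∃ m, s ∈ T.chartW m) ∨ (∃ i j, s ∈ T.chartP i j) ∨ (∃ i j, s ∈ T.chartQ i j) ∨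
      ∃ i j k, s ∈ T.chartT i j k := by
  obtain ⟨x, y, z, h, hxy, hyz⟩ := T.exists_sorted s
  obtain ⟨n1, n2, n3⟩ := h.ne
  rcases hxy.eq_or_lt with h1 | h1 <;> rcases hyz.eq_or_lt with h2 | h2
  · obtain ⟨i, j, hij, hi, hj⟩ := T.exists_edges_of_tie n1 h1
    obtain ⟨j', k, hjk, hj', hk⟩ := T.exists_edges_of_tie n3 h2
    obtain ⟨i', k', hik, hi', hk'⟩ := T.exists_edges_of_tie n2 (h1.trans h2)
    obtain rfl := T.edge_unique hj hj'
    obtain rfl := T.edge_unique hi hi'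
    obtain rfl := T.edge_unique hk hk'
    exact .inr (.inr (.inr ⟨i, j, k, x, y, z, ⟨hi, hj, hk, hij, hik, hjk⟩, h⟩))
  · obtain ⟨i, j, hij, hi, hj⟩ := T.exists_edges_of_tie n1 h1
    exact .inr (.inl ⟨i, j, x, y, z, ⟨hi, hj, hj.2.1.trans h2, hij, h1 ▸ h2, h2⟩, h⟩)
  · obtain ⟨i, j, hij, hi, hj⟩ := T.exists_edges_of_tie n3 h2
    exact .inr (.inr (.inl ⟨i, j, x, y, z, ⟨h1.trans hi.2.2, hi, hj, hij, h1, h2 ▸ h1⟩, h⟩))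
  · exact .inl (exists_mem_chartW ⟨x, y, z, h, h1, h2⟩)

end Intersections

end ThetaSpace

section Words

variable {H : Type*} [Group H] (p q : Fin 4 → Fin 4 → H)

/-- The potential of an ordered pair of lower edges. -/
def lowerWord (l m : Fin 4) : H := if l < m then 1 else p l m

/-- The potential of an ordered pair of upper edges. -/
def upperWord (m u : Fin 4) : H := if m < u then 1 else q u m

/-- The potential of an ordered triple of edges. -/
def tripleWord (l m u : Fin 4) : H :=
  if l < m then
    if m < u then 1 else if l < u then q u m else p l u * q u m
  else
    if l < u then p l m else if m < u then q u l * p l m else p m u * q u l * p l m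

variable {p q}

theorem SwapData.lowerWord_mul (h : SwapData p q) {l m : Fin 4} (hlm : l ≠ m) :
    lowerWord p l m * p m l = lowerWord p m l := by
  rcases hlm.lt_or_gt with h1 | h1
  · simp [lowerWord, h1, h1.not_gt]
  · simp [lowerWord, h1, h1.not_gt, h.p_inv l m]

theorem SwapData.upperWord_mul (h : SwapData p q) {m u : Fin 4} (hmu : m ≠ u) :
    upperWord q m u * q m u = upperWord q u m := by
  rcases hmu.lt_or_gt with h1 | h1
  · simp [upperWord, h1, h1.not_gt]
  · simp [upperWord, h1, h1.not_gt, h.q_inv u m]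

theorem SwapData.tripleWord_mul_lower (h : SwapData p q) {l m u : Fin 4}
    (hd : l ≠ m ∧ l ≠ u ∧ m ≠ u) : tripleWord p q l m u * p m l = tripleWord p q m l u := by
  obtain ⟨h1, h2, h3⟩ := hd
  rcases h1.lt_or_gt with h1 | h1 <;> rcases h2.lt_or_gt with h2 | h2 <;>
    rcases h3.lt_or_gt with h3 | h3 <;>
    first
    | (exfalso; omega)
    | simp [tripleWord, h1, h2, h3, h1.not_gt, h2.not_gt, h3.not_gt, h.p_inv l m, mul_assoc]

theorem SwapData.tripleWord_mul_upper (h : SwapData p q) {l m u : Fin 4}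
    (hd : l ≠ m ∧ l ≠ u ∧ m ≠ u) : tripleWord p q l m u * q m u = tripleWord p q l u m := by
  obtain ⟨h1, h2, h3⟩ := hd
  rcases h1.lt_or_gt with h1 | h1 <;> rcases h2.lt_or_gt with h2 | h2 <;>
    rcases h3.lt_or_gt with h3 | h3 <;>
    first
    | (exfalso; omega)
    | (simp [tripleWord, h1, h2, h3, h1.not_gt, h2.not_gt, h3.not_gt, h.q_inv u m, mul_assoc]; done)
    | skip
  · have := h.hex m u l h3 h2
    simp [tripleWord, h3, h1.not_gt, h2.not_gt, h3.not_gt, this]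
  · have := h.hex u m l h3 h1
    simp [tripleWord, h3, h1.not_gt, h2.not_gt, h3.not_gt, this, h.q_inv u m]

end Words

namespace ThetaSpace

variable {Y : Type*} [TopologicalSpace Y] (T : ThetaSpace Y)

/-- The two lower points are on the edges `l` and `m` in this order, ties broken by labels. -/
def LowerOrder (s : UConf 3 Y) (l m : Fin 4) : Prop :=
  ∃ x y z, IsConf s x y z ∧ x ∈ T.stratum (.edge l) ∧ y ∈ T.stratum (.edge m) ∧
    toLex (T.h x, l) < toLex (T.h y, m) ∧ T.h y < T.h z

/-- The two upper points are on the edges `m` and `u` in this order, ties broken by labels. -/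
def UpperOrder (s : UConf 3 Y) (m u : Fin 4) : Prop :=
  ∃ x y z, IsConf s x y z ∧ y ∈ T.stratum (.edge m) ∧ z ∈ T.stratum (.edge u) ∧
    T.h x < T.h y ∧ toLex (T.h y, m) < toLex (T.h z, u)

/-- The points are on the edges `l`, `m` and `u` in this order, ties broken by labels. -/
def TripleOrder (s : UConf 3 Y) (l m u : Fin 4) : Prop :=
  ∃ x y z, IsConf s x y z ∧ x ∈ T.stratum (.edge l) ∧ y ∈ T.stratum (.edge m) ∧
    z ∈ T.stratum (.edge u) ∧ toLex (T.h x, l) < toLex (T.h y, m) ∧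
    toLex (T.h y, m) < toLex (T.h z, u)

variable {T} {s : UConf 3 Y} {l m u l' m' u' : Fin 4}

theorem le_of_toLex_lt {a b : ℝ} {i j : Fin 4} (h : toLex (a, i) < toLex (b, j)) : a ≤ b := by
  rcases Prod.Lex.toLex_lt_toLex.1 h with h | h
  · exact h.le
  · exact h.1.le

theorem LowerOrder.unique (h : T.LowerOrder s l m) (h' : T.LowerOrder s l' m') :
    l' = l ∧ m' = m := by
  obtain ⟨x, y, z, h, hx, hy, h1, h2⟩ := h
  obtain ⟨x', y', z', h', hx', hy', h1', h2'⟩ := h'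
  have h3 := le_of_toLex_lt h1
  have h3' := le_of_toLex_lt h1'
  rcases h.eq_or h' with H | H | H | H | H | H <;> obtain ⟨rfl, rfl, rfl⟩ := H <;>
    first
    | (exfalso; linarith)
    | exact ⟨T.edge_unique hx' hx, T.edge_unique hy' hy⟩
    | (obtain rfl := T.edge_unique hx' hy
       obtain rfl := T.edge_unique hy' hx
       exact absurd h1 h1'.not_gt)

theorem UpperOrder.unique (h : T.UpperOrder s m u) (h' : T.UpperOrder s m' u') :
    m' = m ∧ u' = u := by
  obtain ⟨x, y, z, h, hy, hz, h2, h1⟩ := h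
  obtain ⟨x', y', z', h', hy', hz', h2', h1'⟩ := h'
  have h3 := le_of_toLex_lt h1
  have h3' := le_of_toLex_lt h1'
  rcases h.eq_or h' with H | H | H | H | H | H <;> obtain ⟨rfl, rfl, rfl⟩ := H <;>
    first
    | (exfalso; linarith)
    | exact ⟨T.edge_unique hy' hy, T.edge_unique hz' hz⟩
    | (obtain rfl := T.edge_unique hy' hz
       obtain rfl := T.edge_unique hz' hy
       exact absurd h1 h1'.not_gt)

theorem TripleOrder.unique (h : T.TripleOrder s l m u) (h' : T.TripleOrder s l' m' u') :
    l' = l ∧ m' = m ∧ u' = u := by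
  obtain ⟨x, y, z, h, hx, hy, hz, h1, h2⟩ := h
  obtain ⟨x', y', z', h', hx', hy', hz', h1', h2'⟩ := h'
  have h3 := h1.trans h2
  have h3' := h1'.trans h2'
  rcases h.eq_or h' with H | H | H | H | H | H <;> obtain ⟨rfl, rfl, rfl⟩ := H
  · exact ⟨T.edge_unique hx' hx, T.edge_unique hy' hy, T.edge_unique hz' hz⟩
  · obtain rfl := T.edge_unique hy' hz
    obtain rfl := T.edge_unique hz' hy
    exact absurd h2 h2'.not_gt
  · obtain rfl := T.edge_unique hx' hy
    obtain rfl := T.edge_unique hy' hx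
    exact absurd h1 h1'.not_gt
  · obtain rfl := T.edge_unique hx' hy
    obtain rfl := T.edge_unique hz' hx
    exact absurd h1 h3'.not_gt
  · obtain rfl := T.edge_unique hx' hz
    obtain rfl := T.edge_unique hz' hy
    exact absurd h2 h3'.not_gt
  · obtain rfl := T.edge_unique hx' hz
    obtain rfl := T.edge_unique hz' hx
    exact absurd h3 h3'.not_gt

theorem lowerOrder_of_mem_chamberP (h : s ∈ T.chamberP l m) : T.LowerOrder s l m := by
  obtain ⟨x, y, z, ⟨hx, hy, hz, -, h1, h2⟩, h⟩ := h
  exact ⟨x, y, z, h, hx, hy, Prod.Lex.toLex_lt_toLex.2 (.inl h1), h2⟩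

theorem upperOrder_of_mem_chamberQ (h : s ∈ T.chamberQ m u) : T.UpperOrder s m u := by
  obtain ⟨x, y, z, ⟨hx, hy, hz, -, h1, h2⟩, h⟩ := h
  exact ⟨x, y, z, h, hy, hz, h1, Prod.Lex.toLex_lt_toLex.2 (.inl h2)⟩

theorem tripleOrder_of_mem_chamberT (h : s ∈ T.chamberT l m u) : T.TripleOrder s l m u := by
  obtain ⟨x, y, z, ⟨hx, hy, hz, -, h1, h2⟩, h⟩ := h
  exact ⟨x, y, z, h, hx, hy, hz, Prod.Lex.toLex_lt_toLex.2 (.inl h1),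
    Prod.Lex.toLex_lt_toLex.2 (.inl h2)⟩

theorem order_of_mem_wallP (h : s ∈ T.wallP l m u) :
    (T.LowerOrder s l m ∧ T.TripleOrder s l m u) ∨ (T.LowerOrder s m l ∧ T.TripleOrder s m l u) := by
  obtain ⟨x, y, z, ⟨hx, hy, hz, hd, h1, h2⟩, h⟩ := h
  rcases lt_trichotomy (toLex (T.h x, l)) (toLex (T.h y, m)) with h3 | h3 | h3
  · exact .inl ⟨⟨x, y, z, h, hx, hy, h3, h2⟩,
      x, y, z, h, hx, hy, hz, h3, Prod.Lex.toLex_lt_toLex.2 (.inl h2)⟩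
  · exact absurd (congrArg (fun v => (ofLex v).2) h3) hd.1
  · exact .inr ⟨⟨y, x, z, h.swap₀₁, hy, hx, h3, h1⟩,
      y, x, z, h.swap₀₁, hy, hx, hz, h3, Prod.Lex.toLex_lt_toLex.2 (.inl h1)⟩

theorem order_of_mem_wallQ (h : s ∈ T.wallQ l m u) :
    (T.UpperOrder s m u ∧ T.TripleOrder s l m u) ∨ (T.UpperOrder s u m ∧ T.TripleOrder s l u m) := by
  obtain ⟨x, y, z, ⟨hx, hy, hz, hd, h1, h2⟩, h⟩ := h
  rcases lt_trichotomy (toLex (T.h y, m)) (toLex (T.h z, u)) with h3 | h3 | h3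
  · exact .inl ⟨⟨x, y, z, h, hy, hz, h1, h3⟩,
      x, y, z, h, hx, hy, hz, Prod.Lex.toLex_lt_toLex.2 (.inl h1), h3⟩
  · exact absurd (congrArg (fun v => (ofLex v).2) h3) hd.2.2
  · exact .inr ⟨⟨x, z, y, h.swap₁₂, hz, hy, h2, h3⟩,
      x, z, y, h.swap₁₂, hx, hz, hy, Prod.Lex.toLex_lt_toLex.2 (.inl h2), h3⟩

variable {H : Type*} [Group H] {p q : Fin 4 → Fin 4 → H}

variable (T p q)

open Classical in
/-- The potential on the charts `chartP`. -/
noncomputable def lowerPotential (s : UConf 3 Y) : H :=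
  if h : ∃ v : Fin 4 × Fin 4, T.LowerOrder s v.1 v.2 then lowerWord p h.choose.1 h.choose.2 else 1

open Classical in
/-- The potential on the charts `chartQ`. -/
noncomputable def upperPotential (s : UConf 3 Y) : H :=
  if h : ∃ v : Fin 4 × Fin 4, T.UpperOrder s v.1 v.2 then upperWord q h.choose.1 h.choose.2 else 1

open Classical in
/-- The potential on the charts `chartT`. -/
noncomputable def triplePotential (s : UConf 3 Y) : H :=
  if h : ∃ v : Fin 4 × Fin 4 × Fin 4, T.TripleOrder s v.1 v.2.1 v.2.2 then
    tripleWord p q h.choose.1 h.choose.2.1 h.choose.2.2 else 1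

variable {T}

theorem lowerPotential_eq (h : T.LowerOrder s l m) : T.lowerPotential p s = lowerWord p l m := by
  have h' : ∃ v : Fin 4 × Fin 4, T.LowerOrder s v.1 v.2 := ⟨(l, m), h⟩
  obtain ⟨h1, h2⟩ := h.unique h'.choose_spec
  rw [lowerPotential, dif_pos h', h1, h2]

theorem upperPotential_eq (h : T.UpperOrder s m u) : T.upperPotential q s = upperWord q m u := by
  have h' : ∃ v : Fin 4 × Fin 4, T.UpperOrder s v.1 v.2 := ⟨(m, u), h⟩
  obtain ⟨h1, h2⟩ := h.unique h'.choose_spec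
  rw [upperPotential, dif_pos h', h1, h2]

theorem triplePotential_eq (h : T.TripleOrder s l m u) :
    T.triplePotential p q s = tripleWord p q l m u := by
  have h' : ∃ v : Fin 4 × Fin 4 × Fin 4, T.TripleOrder s v.1 v.2.1 v.2.2 := ⟨(l, m, u), h⟩
  obtain ⟨h1, h2, h3⟩ := h.unique h'.choose_spec
  rw [triplePotential, dif_pos h', h1, h2, h3]

variable {p q}

theorem potential_on_wallP (hpq : SwapData p q) (hd : l ≠ m ∧ l ≠ u ∧ m ≠ u)
    (h : s ∈ T.wallP l m u) :
    T.triplePotential p q s * (T.lowerPotential p s)⁻¹ =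
      tripleWord p q l m u * (lowerWord p l m)⁻¹ := by
  rcases order_of_mem_wallP h with ⟨h1, h2⟩ | ⟨h1, h2⟩
  · rw [triplePotential_eq p q h2, lowerPotential_eq p h1]
  · rw [triplePotential_eq p q h2, lowerPotential_eq p h1, ← hpq.tripleWord_mul_lower hd,
      ← hpq.lowerWord_mul hd.1]
    group

theorem potential_on_wallQ (hpq : SwapData p q) (hd : l ≠ m ∧ l ≠ u ∧ m ≠ u)
    (h : s ∈ T.wallQ l m u) :
    T.triplePotential p q s * (T.upperPotential q s)⁻¹ =
      tripleWord p q l m u * (upperWord q m u)⁻¹ := by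
  rcases order_of_mem_wallQ h with ⟨h1, h2⟩ | ⟨h1, h2⟩
  · rw [triplePotential_eq p q h2, upperPotential_eq q h1]
  · rw [triplePotential_eq p q h2, upperPotential_eq q h1, ← hpq.tripleWord_mul_upper hd,
      ← hpq.upperWord_mul hd.2.2]
    group

/-- The charts covering the configuration space. -/
abbrev ChartIndex := Fin 4 ⊕ (Fin 4 × Fin 4) ⊕ (Fin 4 × Fin 4) ⊕ (Fin 4 × Fin 4 × Fin 4)

variable (T) in
/-- The open cover by simply connected charts. -/
def chart : ChartIndex → Set (UConf 3 Y)
  | .inl m => T.chartW m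
  | .inr (.inl v) => T.chartP v.1 v.2
  | .inr (.inr (.inl v)) => T.chartQ v.1 v.2
  | .inr (.inr (.inr v)) => T.chartT v.1 v.2.1 v.2.2

variable (T p q) in
/-- The potentials on the charts. -/
noncomputable def potential : ChartIndex → UConf 3 Y → H
  | .inl _ => fun _ => 1
  | .inr (.inl _) => T.lowerPotential p
  | .inr (.inr (.inl _)) => T.upperPotential q
  | .inr (.inr (.inr _)) => T.triplePotential p q

theorem isOpen_chart (c : ChartIndex) : IsOpen (T.chart c) := by
  rcases c with m | v | v | v
  · exact T.isOpen_chartW m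
  · exact T.isOpen_chartP _ _
  · exact T.isOpen_chartQ _ _
  · exact T.isOpen_chartT _ _ _

theorem exists_mem_chart' (s : UConf 3 Y) : ∃ c, s ∈ T.chart c := by
  rcases T.exists_mem_chart s with ⟨m, h⟩ | ⟨i, j, h⟩ | ⟨i, j, h⟩ | ⟨i, j, k, h⟩
  · exact ⟨.inl m, h⟩
  · exact ⟨.inr (.inl (i, j)), h⟩
  · exact ⟨.inr (.inr (.inl (i, j))), h⟩
  · exact ⟨.inr (.inr (.inr (i, j, k))), h⟩

theorem eventually_potential_eq (hs : s ∈ T.generic) (c : ChartIndex) (hc : s ∈ T.chart c) :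
    ∀ᶠ t in 𝓝 s, T.potential p q c t = T.potential p q c s := by
  rcases c with m | v | v | v
  · exact .of_forall fun _ => rfl
  · have key (l m : Fin 4) (h : s ∈ T.chamberP l m) :
        ∀ᶠ t in 𝓝 s, T.lowerPotential p t = T.lowerPotential p s := by
      filter_upwards [(T.isOpen_chamberP l m).mem_nhds h] with t ht
      rw [lowerPotential_eq p (lowerOrder_of_mem_chamberP ht),
        lowerPotential_eq p (lowerOrder_of_mem_chamberP h)]
    exact (mem_chamberP_or hs hc).elim (key _ _) (key _ _)
  · have key (l m : Fin 4) (h : s ∈ T.chamberQ l m) :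
        ∀ᶠ t in 𝓝 s, T.upperPotential q t = T.upperPotential q s := by
      filter_upwards [(T.isOpen_chamberQ l m).mem_nhds h] with t ht
      rw [upperPotential_eq q (upperOrder_of_mem_chamberQ ht),
        upperPotential_eq q (upperOrder_of_mem_chamberQ h)]
    exact (mem_chamberQ_or hs hc).elim (key _ _) (key _ _)
  · have key (l m u : Fin 4) (h : s ∈ T.chamberT l m u) :
        ∀ᶠ t in 𝓝 s, T.triplePotential p q t = T.triplePotential p q s := by
      filter_upwards [(T.isOpen_chamberT l m u).mem_nhds h] with t ht
      rw [triplePotential_eq p q (tripleOrder_of_mem_chamberT ht),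
        triplePotential_eq p q (tripleOrder_of_mem_chamberT h)]
    rcases mem_chamberT_or hs hc with h | h | h | h | h | h <;> exact key _ _ _ h

theorem eventually_lower_triple (hpq : SwapData p q) {i j a b c : Fin 4} (h : s ∈ T.chartP i j)
    (h' : s ∈ T.chartT a b c) :
    ∀ᶠ t in 𝓝 s, T.triplePotential p q t * (T.lowerPotential p t)⁻¹ =
      T.triplePotential p q s * (T.lowerPotential p s)⁻¹ := by
  obtain ⟨u, hu⟩ := exists_mem_wallP h h'
  have hd := ne_of_mem_chartT (wallP_subset_chartT hu)
  filter_upwards [(T.isOpen_wallP i j u).mem_nhds hu] with t ht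
  rw [potential_on_wallP hpq hd ht, potential_on_wallP hpq hd hu]

theorem eventually_upper_triple (hpq : SwapData p q) {i j a b c : Fin 4} (h : s ∈ T.chartQ i j)
    (h' : s ∈ T.chartT a b c) :
    ∀ᶠ t in 𝓝 s, T.triplePotential p q t * (T.upperPotential q t)⁻¹ =
      T.triplePotential p q s * (T.upperPotential q s)⁻¹ := by
  obtain ⟨u, hu⟩ := exists_mem_wallQ h h'
  have hd := ne_of_mem_chartT (wallQ_subset_chartT hu)
  filter_upwards [(T.isOpen_wallQ u i j).mem_nhds hu] with t ht
  rw [potential_on_wallQ hpq hd ht, potential_on_wallQ hpq hd hu]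

theorem eventually_potential_div_eq (hpq : SwapData p q) (c d : ChartIndex) (s : UConf 3 Y)
    (hc : s ∈ T.chart c) (hd : s ∈ T.chart d) :
    ∀ᶠ t in 𝓝 s, T.potential p q c t * (T.potential p q d t)⁻¹ =
      T.potential p q c s * (T.potential p q d s)⁻¹ := by
  have generic (hs : s ∈ T.generic) : ∀ᶠ t in 𝓝 s,
      T.potential p q c t * (T.potential p q d t)⁻¹ =
        T.potential p q c s * (T.potential p q d s)⁻¹ := by
    filter_upwards [eventually_potential_eq (p := p) (q := q) hs c hc,
      eventually_potential_eq (p := p) (q := q) hs d hd]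
      with t h1 h2
    rw [h1, h2]
  have flip {f g : UConf 3 Y → H} (h : ∀ᶠ t in 𝓝 s, f t * (g t)⁻¹ = f s * (g s)⁻¹) :
      ∀ᶠ t in 𝓝 s, g t * (f t)⁻¹ = g s * (f s)⁻¹ := by
    filter_upwards [h] with t ht
    simpa using congrArg (·⁻¹) ht
  rcases c with m | v | v | v
  · exact generic (chartW_subset_generic hc)
  all_goals rcases d with m' | v' | v' | v'
  any_goals exact generic (chartW_subset_generic hd)
  · exact .of_forall fun t => by simp [potential]
  · exact generic (mem_generic_of_chartP_chartQ hc hd)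
  · exact flip (eventually_lower_triple hpq hc hd)
  · exact generic (mem_generic_of_chartP_chartQ hd hc)
  · exact .of_forall fun t => by simp [potential]
  · exact flip (eventually_upper_triple hpq hc hd)
  · exact eventually_lower_triple hpq hd hc
  · exact eventually_upper_triple hpq hd hc
  · exact .of_forall fun t => by simp [potential]

/-- The cocycle defined by the potentials. -/
theorem exists_pathCocycle (hpq : SwapData p q) : ∃ Φ : PathCocycle (UConf 3 Y) H,
    ∀ c {s t : UConf 3 Y} (γ : Path s t), range γ ⊆ T.chart c →
      Φ.val (.mk γ) = (T.potential p q c s)⁻¹ * T.potential p q c t := by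
  obtain ⟨Φ, h1, h2⟩ := exists_cocycle (U := T.chart) (g := T.potential p q) isOpen_chart
    exists_mem_chart' (eventually_potential_div_eq hpq)
  exact ⟨⟨Φ, h1⟩, h2⟩

end ThetaSpace

namespace ThetaSpace

variable {Y : Type*} [TopologicalSpace Y] {T : ThetaSpace Y} {H : Type*} [Group H]
  {Ψ : PathCocycle (UConf 3 Y) H} {p q : Fin 4 → Fin 4 → H} {i j k l m u : Fin 4}
  {s t : UConf 3 Y}

variable (T Ψ p q) in
/-- The values of a cocycle across the walls of the charts are given by `p` and `q`. -/
structure HasSwaps : Prop where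
  trivial : ∀ m, ∀ s ∈ T.chartW m, ∀ t ∈ T.chartW m, Ψ.on (T.chartW m) s t = 1
  lower : ∀ l m, ∀ s ∈ T.chamberP l m, ∀ t ∈ T.chamberP m l, Ψ.on (T.chartP l m) s t = p m l
  upper : ∀ m u, ∀ s ∈ T.chamberQ m u, ∀ t ∈ T.chamberQ u m, Ψ.on (T.chartQ m u) s t = q m u

theorem on_chartP_eq_one
    (hW : ∀ m, ∀ s ∈ T.chartW m, ∀ t ∈ T.chartW m, Ψ.on (T.chartW m) s t = 1)
    (hs : s ∈ T.chamberP l m) (ht : t ∈ T.chamberP l m) :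
    Ψ.on (T.chartP l m) s t = 1 := by
  have hlm := ne_of_mem_chartP (chamberP_subset_chartP hs)
  rw [Ψ.on_eq_on (T.isSimplyConnected_chartP hlm) (T.isSimplyConnected_chartW m)
    chamberP_subset_chartP chamberP_subset_chartW
    ((T.isPathConnected_chamberP hlm).joinedIn s hs t ht)]
  exact hW m s (chamberP_subset_chartW hs) t (chamberP_subset_chartW ht)

theorem on_chartQ_eq_one
    (hW : ∀ m, ∀ s ∈ T.chartW m, ∀ t ∈ T.chartW m, Ψ.on (T.chartW m) s t = 1)
    (hs : s ∈ T.chamberQ m u) (ht : t ∈ T.chamberQ m u) :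
    Ψ.on (T.chartQ m u) s t = 1 := by
  have hmu := ne_of_mem_chartQ (chamberQ_subset_chartQ hs)
  rw [Ψ.on_eq_on (T.isSimplyConnected_chartQ hmu) (T.isSimplyConnected_chartW m)
    chamberQ_subset_chartQ chamberQ_subset_chartW
    ((T.isPathConnected_chamberQ hmu).joinedIn s hs t ht)]
  exact hW m s (chamberQ_subset_chartW hs) t (chamberQ_subset_chartW ht)

theorem on_chartP_eq_on {s' t' : UConf 3 Y}
    (hW : ∀ m, ∀ s ∈ T.chartW m, ∀ t ∈ T.chartW m, Ψ.on (T.chartW m) s t = 1)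
    (hs : s ∈ T.chamberP l m) (ht : t ∈ T.chamberP m l)
    (hs' : s' ∈ T.chamberP l m) (ht' : t' ∈ T.chamberP m l) :
    Ψ.on (T.chartP l m) s t = Ψ.on (T.chartP l m) s' t' := by
  have hU := T.isSimplyConnected_chartP (ne_of_mem_chartP (chamberP_subset_chartP hs))
  have h1 := on_chartP_eq_one hW hs hs'
  have h2 := on_chartP_eq_one hW ht' ht
  rw [chartP_comm] at h2
  have ms := chamberP_subset_chartP hs
  have ms' := chamberP_subset_chartP hs'
  have mt := chartP_comm (T := T) m l ▸ chamberP_subset_chartP ht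
  have mt' := chartP_comm (T := T) m l ▸ chamberP_subset_chartP ht'
  rw [← Ψ.on_mul_on hU ms ms' mt, ← Ψ.on_mul_on hU ms' mt' mt, h1, h2, one_mul, mul_one]

theorem on_chartQ_eq_on {s' t' : UConf 3 Y}
    (hW : ∀ m, ∀ s ∈ T.chartW m, ∀ t ∈ T.chartW m, Ψ.on (T.chartW m) s t = 1)
    (hs : s ∈ T.chamberQ l m) (ht : t ∈ T.chamberQ m l)
    (hs' : s' ∈ T.chamberQ l m) (ht' : t' ∈ T.chamberQ m l) :
    Ψ.on (T.chartQ l m) s t = Ψ.on (T.chartQ l m) s' t' := by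
  have hU := T.isSimplyConnected_chartQ (ne_of_mem_chartQ (chamberQ_subset_chartQ hs))
  have h1 := on_chartQ_eq_one hW hs hs'
  have h2 := on_chartQ_eq_one hW ht' ht
  rw [chartQ_comm] at h2
  have ms := chamberQ_subset_chartQ hs
  have ms' := chamberQ_subset_chartQ hs'
  have mt := chartQ_comm (T := T) m l ▸ chamberQ_subset_chartQ ht
  have mt' := chartQ_comm (T := T) m l ▸ chamberQ_subset_chartQ ht'
  rw [← Ψ.on_mul_on hU ms ms' mt, ← Ψ.on_mul_on hU ms' mt' mt, h1, h2, one_mul, mul_one]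

theorem HasSwaps.lower_triple (h : T.HasSwaps Ψ p q) (hs : s ∈ T.chamberT l m u)
    (ht : t ∈ T.chamberT m l u) : Ψ.on (T.chartT l m u) s t = p m l := by
  have hd := ne_of_mem_chartT (chamberT_subset_chartT hs)
  rw [Ψ.on_eq_on (T.isSimplyConnected_chartT hd) (T.isSimplyConnected_chartP hd.1)
    wallP_subset_chartT wallP_subset_chartP ((T.isPathConnected_wallP hd).joinedIn s
      (chamberT_subset_wallP hs) t (wallP_comm (T := T) m l u ▸ chamberT_subset_wallP ht))]
  exact h.lower l m s (chamberT_subset_chamberP hs) t (chamberT_subset_chamberP ht)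

theorem HasSwaps.upper_triple (h : T.HasSwaps Ψ p q) (hs : s ∈ T.chamberT l m u)
    (ht : t ∈ T.chamberT l u m) : Ψ.on (T.chartT l m u) s t = q m u := by
  have hd := ne_of_mem_chartT (chamberT_subset_chartT hs)
  rw [Ψ.on_eq_on (T.isSimplyConnected_chartT hd) (T.isSimplyConnected_chartQ hd.2.2)
    wallQ_subset_chartT wallQ_subset_chartQ ((T.isPathConnected_wallQ hd).joinedIn s
      (chamberT_subset_wallQ hs) t (wallQ_comm (T := T) l u m ▸ chamberT_subset_wallQ ht))]
  exact h.upper m u s (chamberT_subset_chamberQ hs) t (chamberT_subset_chamberQ ht)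

theorem HasSwaps.hex (h : T.HasSwaps Ψ p q) (hij : i ≠ j) (hik : i ≠ k) (hjk : j ≠ k) :
    p j i * q i k * p k j = q j k * p k i * q i j := by
  have hU := T.isSimplyConnected_chartT ⟨hij, hik, hjk⟩
  obtain ⟨a, ha⟩ := (T.isPathConnected_chamberT ⟨hij, hik, hjk⟩).nonempty
  obtain ⟨b, hb⟩ := (T.isPathConnected_chamberT ⟨hij.symm, hjk, hik⟩).nonempty
  obtain ⟨c, hc⟩ := (T.isPathConnected_chamberT ⟨hjk, hij.symm, hik.symm⟩).nonempty
  obtain ⟨d, hd⟩ := (T.isPathConnected_chamberT ⟨hjk.symm, hik.symm, hij.symm⟩).nonempty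
  obtain ⟨b', hb'⟩ := (T.isPathConnected_chamberT ⟨hik, hij, hjk.symm⟩).nonempty
  obtain ⟨c', hc'⟩ := (T.isPathConnected_chamberT ⟨hik.symm, hjk.symm, hij⟩).nonempty
  have eb : T.chartT j i k = T.chartT i j k := chartT_swap₀₁ _ _ _
  have ec : T.chartT j k i = T.chartT i j k := (chartT_swap₁₂ _ _ _).trans eb
  have ed : T.chartT k j i = T.chartT i j k := (chartT_swap₀₁ _ _ _).trans ec
  have eb' : T.chartT i k j = T.chartT i j k := chartT_swap₁₂ _ _ _
  have ec' : T.chartT k i j = T.chartT i j k := (chartT_swap₀₁ _ _ _).trans eb'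
  have h1 := h.lower_triple ha hb
  have h2 := h.upper_triple hb hc
  have h3 := h.lower_triple hc hd
  have h1' := h.upper_triple ha hb'
  have h2' := h.lower_triple hb' hc'
  have h3' := h.upper_triple hc' hd
  rw [eb] at h2
  rw [ec] at h3
  rw [eb'] at h2'
  rw [ec'] at h3'
  have ma := chamberT_subset_chartT ha
  have mb := eb ▸ chamberT_subset_chartT hb
  have mc := ec ▸ chamberT_subset_chartT hc
  have md := ed ▸ chamberT_subset_chartT hd
  have mb' := eb' ▸ chamberT_subset_chartT hb'
  have mc' := ec' ▸ chamberT_subset_chartT hc'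
  rw [← h1, ← h2, ← h3, ← h1', ← h2', ← h3', Ψ.on_mul_on hU ma mb mc, Ψ.on_mul_on hU ma mc md,
    Ψ.on_mul_on hU ma mb' mc', Ψ.on_mul_on hU ma mc' md]

/-- A cocycle that is trivial on the charts `chartW` defines swap data. -/
theorem exists_hasSwaps
    (hW : ∀ m, ∀ s ∈ T.chartW m, ∀ t ∈ T.chartW m, Ψ.on (T.chartW m) s t = 1)
    (h0 : ∀ a, a ≠ 0 → ∃ s ∈ T.chamberP a 0, ∃ t ∈ T.chamberP 0 a, Ψ.on (T.chartP a 0) s t = 1) :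
    ∃ p q : Fin 4 → Fin 4 → H, T.HasSwaps Ψ p q ∧ SwapData p q := by
  obtain ⟨s₀, -⟩ := (T.isSimplyConnected_chartW 0).nonempty
  have hP (l m : Fin 4) : ∃ s, l ≠ m → s ∈ T.chamberP l m := by
    by_cases h : l = m
    · exact ⟨s₀, fun h' => absurd h h'⟩
    · exact (T.isPathConnected_chamberP h).nonempty.imp fun _ h _ => h
  have hQ (l m : Fin 4) : ∃ s, l ≠ m → s ∈ T.chamberQ l m := by
    by_cases h : l = m
    · exact ⟨s₀, fun h' => absurd h h'⟩
    · exact (T.isPathConnected_chamberQ h).nonempty.imp fun _ h _ => h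
  choose cp hcp using hP
  choose cq hcq using hQ
  let p (m l : Fin 4) : H := if m = l then 1 else Ψ.on (T.chartP l m) (cp l m) (cp m l)
  let q (m u : Fin 4) : H := if m = u then 1 else Ψ.on (T.chartQ m u) (cq m u) (cq u m)
  have hpq : T.HasSwaps Ψ p q := by
    refine ⟨hW, fun l m s hs t ht => ?_, fun m u s hs t ht => ?_⟩
    · have hlm := ne_of_mem_chartP (chamberP_subset_chartP hs)
      rw [show p m l = Ψ.on (T.chartP l m) (cp l m) (cp m l) from if_neg hlm.symm]
      exact on_chartP_eq_on hW hs ht (hcp l m hlm) (hcp m l hlm.symm)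
    · have hmu := ne_of_mem_chartQ (chamberQ_subset_chartQ hs)
      rw [show q m u = Ψ.on (T.chartQ m u) (cq m u) (cq u m) from if_neg hmu]
      exact on_chartQ_eq_on hW hs ht (hcq m u hmu) (hcq u m hmu.symm)
  refine ⟨p, q, hpq, fun i => if_pos rfl, fun i => if_pos rfl, fun i j => ?_, fun i j => ?_,
    fun j => ?_, fun i j k hij hjk => hpq.hex hij.ne (hij.trans hjk).ne hjk.ne⟩
  · rcases eq_or_ne i j with rfl | hij
    · simp [p]
    · simp only [p, if_neg hij, if_neg hij.symm]
      rw [chartP_comm (T := T) i j, Ψ.inv_on (T.isSimplyConnected_chartP hij.symm)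
        (chamberP_subset_chartP (hcp j i hij.symm))
        (chartP_comm (T := T) i j ▸ chamberP_subset_chartP (hcp i j hij))]
  · rcases eq_or_ne i j with rfl | hij
    · simp [q]
    · simp only [q, if_neg hij, if_neg hij.symm]
      rw [chartQ_comm (T := T) j i, Ψ.inv_on (T.isSimplyConnected_chartQ hij)
        (chamberQ_subset_chartQ (hcq i j hij))
        (chartQ_comm (T := T) j i ▸ chamberQ_subset_chartQ (hcq j i hij.symm))]
  · rcases eq_or_ne j 0 with rfl | hj
    · exact if_pos rfl
    · obtain ⟨s, hs, t, ht, h⟩ := h0 j hj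
      rw [← hpq.lower j 0 s hs t ht, h]

theorem isSimplyConnected_chart {c : ChartIndex} (hs : s ∈ T.chart c) :
    IsSimplyConnected (T.chart c) := by
  rcases c with m | v | v | v
  · exact T.isSimplyConnected_chartW m
  · exact T.isSimplyConnected_chartP (ne_of_mem_chartP hs)
  · exact T.isSimplyConnected_chartQ (ne_of_mem_chartQ hs)
  · exact T.isSimplyConnected_chartT (ne_of_mem_chartT hs)

section Comparison

variable {G : Type*} [Group G] {ψ : G →* H} {pG qG : Fin 4 → Fin 4 → G}

/-- A cocycle with given swaps is the coboundary of the potentials on each chart. -/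
theorem HasSwaps.on_chart (h : T.HasSwaps Ψ p q) (hpq : SwapData pG qG)
    (hp : ∀ i j, ψ (pG i j) = p i j) (hq : ∀ i j, ψ (qG i j) = q i j) (c : ChartIndex)
    (hs : s ∈ T.generic) (ht : t ∈ T.generic) (hsc : s ∈ T.chart c) (htc : t ∈ T.chart c) :
    Ψ.on (T.chart c) s t = ψ ((T.potential pG qG c s)⁻¹ * T.potential pG qG c t) := by
  have hU := isSimplyConnected_chart hsc
  suffices H : ∃ s₀ ∈ T.chart c, ∃ g, ∀ t ∈ T.chart c, t ∈ T.generic →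
      Ψ.on (T.chart c) s₀ t = ψ (g * T.potential pG qG c t) by
    obtain ⟨s₀, hs₀, g, hg⟩ := H
    rw [← Ψ.on_mul_on hU hsc hs₀ htc, ← Ψ.inv_on hU hs₀ hsc, hg s hsc hs, hg t htc ht,
      ← map_inv, ← map_mul]
    congr 1
    group
  rcases c with m | ⟨i, j⟩ | ⟨i, j⟩ | ⟨i, j, k⟩
  · exact ⟨s, hsc, 1, fun t ht _ => by
      rw [show T.potential pG qG (.inl m) t = 1 from rfl, one_mul, map_one]
      exact h.trivial m s hsc t ht⟩
  · have hij : i ≠ j := ne_of_mem_chartP hsc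
    obtain ⟨s₀, hs₀⟩ := (T.isPathConnected_chamberP hij).nonempty
    refine ⟨s₀, chamberP_subset_chartP hs₀, (lowerWord pG i j)⁻¹, fun t ht hg => ?_⟩
    change Ψ.on (T.chartP i j) s₀ t = ψ (_ * T.lowerPotential pG t)
    rcases mem_chamberP_or hg ht with h1 | h1
    · rw [lowerPotential_eq pG (lowerOrder_of_mem_chamberP h1),
        on_chartP_eq_one h.trivial hs₀ h1, inv_mul_cancel, map_one]
    · rw [lowerPotential_eq pG (lowerOrder_of_mem_chamberP h1), ← hpq.lowerWord_mul hij,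
        inv_mul_cancel_left, hp, h.lower i j s₀ hs₀ t h1]
  · have hij : i ≠ j := ne_of_mem_chartQ hsc
    obtain ⟨s₀, hs₀⟩ := (T.isPathConnected_chamberQ hij).nonempty
    refine ⟨s₀, chamberQ_subset_chartQ hs₀, (upperWord qG i j)⁻¹, fun t ht hg => ?_⟩
    change Ψ.on (T.chartQ i j) s₀ t = ψ (_ * T.upperPotential qG t)
    rcases mem_chamberQ_or hg ht with h1 | h1
    · rw [upperPotential_eq qG (upperOrder_of_mem_chamberQ h1),
        on_chartQ_eq_one h.trivial hs₀ h1, inv_mul_cancel, map_one]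
    · rw [upperPotential_eq qG (upperOrder_of_mem_chamberQ h1), ← hpq.upperWord_mul hij,
        inv_mul_cancel_left, hq, h.upper i j s₀ hs₀ t h1]
  · obtain ⟨hij, hik, hjk⟩ := ne_of_mem_chartT hsc
    change i ≠ j at hij
    change i ≠ k at hik
    change j ≠ k at hjk
    change IsSimplyConnected (T.chartT i j k) at hU
    obtain ⟨s₀, hs₀⟩ := (T.isPathConnected_chamberT ⟨hij, hik, hjk⟩).nonempty
    have hs₀' := chamberT_subset_chartT hs₀
    let g := (tripleWord pG qG i j k)⁻¹
    refine ⟨s₀, hs₀', g, fun t ht hg => ?_⟩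
    change Ψ.on (T.chartT i j k) s₀ t = ψ (g * T.triplePotential pG qG t)
    let C (l m u : Fin 4) : Prop := T.chartT l m u = T.chartT i j k ∧
      ∀ t ∈ T.chamberT l m u, Ψ.on (T.chartT i j k) s₀ t = ψ (g * tripleWord pG qG l m u)
    have step₀ {l m u : Fin 4} (hd : l ≠ m ∧ l ≠ u ∧ m ≠ u) (hC : C l m u) : C m l u := by
      obtain ⟨he, hC⟩ := hC
      have he' : T.chartT m l u = T.chartT i j k := (chartT_swap₀₁ _ _ _).trans he
      refine ⟨he', fun t ht => ?_⟩
      obtain ⟨r, hr⟩ := (T.isPathConnected_chamberT hd).nonempty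
      have h1 := h.lower_triple hr ht
      rw [he] at h1
      rw [← Ψ.on_mul_on hU hs₀' (he ▸ chamberT_subset_chartT hr)
        (he' ▸ chamberT_subset_chartT ht), hC r hr, h1, ← hp, ← map_mul, mul_assoc,
        hpq.tripleWord_mul_lower hd]
    have step₁ {l m u : Fin 4} (hd : l ≠ m ∧ l ≠ u ∧ m ≠ u) (hC : C l m u) : C l u m := by
      obtain ⟨he, hC⟩ := hC
      have he' : T.chartT l u m = T.chartT i j k := (chartT_swap₁₂ _ _ _).trans he
      refine ⟨he', fun t ht => ?_⟩
      obtain ⟨r, hr⟩ := (T.isPathConnected_chamberT hd).nonempty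
      have h1 := h.upper_triple hr ht
      rw [he] at h1
      rw [← Ψ.on_mul_on hU hs₀' (he ▸ chamberT_subset_chartT hr)
        (he' ▸ chamberT_subset_chartT ht), hC r hr, h1, ← hq, ← map_mul, mul_assoc,
        hpq.tripleWord_mul_upper hd]
    have c₁ : C i j k := by
      refine ⟨rfl, fun t ht => ?_⟩
      have hd : i ≠ j ∧ i ≠ k ∧ j ≠ k := ⟨hij, hik, hjk⟩
      rw [Ψ.on_eq_on hU (T.isSimplyConnected_chartW j) chamberT_subset_chartT
        chamberT_subset_chartW ((T.isPathConnected_chamberT hd).joinedIn s₀ hs₀ t ht),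
        h.trivial j s₀ (chamberT_subset_chartW hs₀) t (chamberT_subset_chartW ht),
        inv_mul_cancel, map_one]
    have c₂ : C j i k := step₀ ⟨hij, hik, hjk⟩ c₁
    have c₃ : C i k j := step₁ ⟨hij, hik, hjk⟩ c₁
    have c₄ : C j k i := step₁ ⟨hij.symm, hjk, hik⟩ c₂
    have c₅ : C k i j := step₀ ⟨hik, hij, hjk.symm⟩ c₃
    have c₆ : C k j i := step₀ ⟨hjk, hij.symm, hik.symm⟩ c₄
    rcases mem_chamberT_or hg ht with h1 | h1 | h1 | h1 | h1 | h1 <;>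
      rw [triplePotential_eq pG qG (tripleOrder_of_mem_chamberT h1)]
    · exact c₁.2 t h1
    · exact c₃.2 t h1
    · exact c₂.2 t h1
    · exact c₄.2 t h1
    · exact c₅.2 t h1
    · exact c₆.2 t h1

end Comparison

end ThetaSpace

theorem JoinedIn.exists_path {X : Type*} [TopologicalSpace X] {U : Set X} {s t : X}
    (h : JoinedIn U s t) : ∃ γ : Path s t, range γ ⊆ U :=
  ⟨h.somePath, range_subset_iff.2 h.somePath_mem⟩

theorem PathCocycle.closeUp_val_eq_one {X : Type*} [TopologicalSpace X] {x₀ : X}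
    {b : ∀ s, Path.Homotopic.Quotient x₀ s} {s t : X} {q : Path.Homotopic.Quotient s t}
    (h : (b s).trans q = b t) : (closeUp b).val q = 1 := by
  rw [closeUp_val, h, Path.Homotopic.Quotient.trans_symm]
  rfl

namespace ThetaSpace

variable {Y : Type*} [TopologicalSpace Y] {T : ThetaSpace Y} {H : Type*} [Group H]

/-- Classes of paths from a base point to all configurations, on which a given cocycle vanishes and
which are compatible with a maximal tree of chambers. -/
theorem exists_frame {Φ : PathCocycle (UConf 3 Y) H}
    (hW : ∀ m, ∀ {s t : UConf 3 Y} (γ : Path s t), range γ ⊆ T.chartW m → Φ.val (.mk γ) = 1)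
    (h0 : ∀ a, ∀ s ∈ T.chamberP a 0, ∀ t ∈ T.chamberP 0 a, ∀ γ : Path s t,
      range γ ⊆ T.chartP a 0 → Φ.val (.mk γ) = 1) :
    ∃ x₀ ∈ T.chartW 0, ∃ b : ∀ s, Path.Homotopic.Quotient x₀ s, b x₀ = .refl x₀ ∧
      (∀ s ∈ T.generic, Φ.val (b s) = 1) ∧
      (∀ m, ∀ {s t : UConf 3 Y} (γ : Path s t), range γ ⊆ T.chartW m →
        (b s).trans (.mk γ) = b t) ∧
      ∀ a, a ≠ 0 → ∃ s ∈ T.chamberP a 0, ∃ t ∈ T.chamberP 0 a, ∃ γ : Path s t,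
        range γ ⊆ T.chartP a 0 ∧ (b s).trans (.mk γ) = b t := by
  have hsc := T.isSimplyConnected_chartW
  obtain ⟨x₀, hx₀⟩ := (hsc 0).nonempty
  have hβ (a : Fin 4) : ∃ x ∈ T.chartW a, ∃ β : Path.Homotopic.Quotient x₀ x, Φ.val β = 1 ∧
      (a = 0 → ∃ δ : Path x₀ x, range δ ⊆ T.chartW 0 ∧ β = .mk δ) ∧
      (a ≠ 0 → x ∈ T.chamberP 0 a ∧ ∃ s ∈ T.chamberP a 0, ∃ δ : Path x₀ s,
        range δ ⊆ T.chartW 0 ∧ ∃ γ : Path s x, range γ ⊆ T.chartP a 0 ∧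
          β = Path.Homotopic.Quotient.trans (.mk δ) (.mk γ)) := by
    rcases eq_or_ne a 0 with rfl | ha
    · refine ⟨x₀, hx₀, .refl x₀, Φ.val_refl x₀, fun _ => ⟨Path.refl x₀, ?_, rfl⟩,
        fun h => absurd rfl h⟩
      simpa using hx₀
    · obtain ⟨s, hs⟩ := (T.isPathConnected_chamberP ha).nonempty
      obtain ⟨x, hx⟩ := (T.isPathConnected_chamberP ha.symm).nonempty
      obtain ⟨δ, hδ⟩ :=
        ((hsc 0).isPathConnected.joinedIn x₀ hx₀ s (chamberP_subset_chartW hs)).exists_path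
      obtain ⟨γ, hγ⟩ := ((T.isSimplyConnected_chartP ha).isPathConnected.joinedIn s
        (chamberP_subset_chartP hs) x
        (chartP_comm (T := T) 0 a ▸ chamberP_subset_chartP hx)).exists_path
      refine ⟨x, chamberP_subset_chartW hx, _, ?_, fun h => absurd h ha,
        fun _ => ⟨hx, s, hs, δ, hδ, γ, hγ, rfl⟩⟩
      rw [Φ.val_trans, hW 0 δ hδ, h0 a s hs x hx γ hγ, one_mul]
  choose x hx β hΦβ hβ0 hβ1 using hβ
  have hb' (a : Fin 4) (s : UConf 3 Y) (hs : s ∈ T.chartW a) : ∃ b : Path.Homotopic.Quotient x₀ s,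
      ∀ a, s ∈ T.chartW a → ∃ δ : Path (x a) s, range δ ⊆ T.chartW a ∧
        b = (β a).trans (.mk δ) := by
    obtain ⟨δ, hδ⟩ := ((hsc a).isPathConnected.joinedIn (x a) (hx a) s hs).exists_path
    refine ⟨(β a).trans (.mk δ), fun a' ha' => ?_⟩
    obtain rfl := chartW_unique hs ha'
    exact ⟨δ, hδ, rfl⟩
  have hb (s : UConf 3 Y) : ∃ b : Path.Homotopic.Quotient x₀ s,
      ∀ a, s ∈ T.chartW a → ∃ δ : Path (x a) s, range δ ⊆ T.chartW a ∧
        b = (β a).trans (.mk δ) := by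
    by_cases hs : s ∈ T.generic
    · obtain ⟨a, ha⟩ := exists_mem_chartW hs
      exact hb' a s ha
    · obtain ⟨s', hs', hj⟩ := T.exists_generic_joinedIn s univ isOpen_univ (mem_univ s)
      obtain ⟨a, ha⟩ := exists_mem_chartW hs'
      obtain ⟨b, -⟩ := hb' a s' ha
      exact ⟨b.trans (.mk hj.somePath), fun a ha => absurd (chartW_subset_generic ha) hs⟩
  choose b hb using hb
  have hb0 (s : UConf 3 Y) (δ : Path x₀ s) (hδ : range δ ⊆ T.chartW 0) : b s = .mk δ := by
    obtain ⟨δ₀, hδ₀, h⟩ := hβ0 0 rfl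
    obtain ⟨δ₁, hδ₁, h'⟩ := hb s 0 (hδ ⟨1, δ.target⟩)
    rw [h', h, ← Path.Homotopic.Quotient.mk_trans]
    refine (hsc 0).mk_eq_mk ?_ hδ
    rw [Path.trans_range]
    exact union_subset hδ₀ hδ₁
  refine ⟨x₀, hx₀, b, hb0 x₀ (Path.refl x₀) (by simpa using hx₀), fun s hs => ?_,
    fun m s t γ hγ => ?_, fun a ha => ?_⟩
  · obtain ⟨a, ha⟩ := exists_mem_chartW hs
    obtain ⟨δ, hδ, h⟩ := hb s a ha
    rw [h, Φ.val_trans, hΦβ, hW a δ hδ, one_mul]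
  · obtain ⟨δ, hδ, h⟩ := hb s m (hγ ⟨0, γ.source⟩)
    obtain ⟨δ', hδ', h'⟩ := hb t m (hγ ⟨1, γ.target⟩)
    rw [h, h', Path.Homotopic.Quotient.trans_assoc, ← Path.Homotopic.Quotient.mk_trans]
    congr 1
    refine (hsc m).mk_eq_mk ?_ hδ'
    rw [Path.trans_range]
    exact union_subset hδ hγ
  · obtain ⟨hxa, s, hs, δ, hδ, γ, hγ, h⟩ := hβ1 a ha
    refine ⟨s, hs, x a, hxa, γ, hγ, ?_⟩
    obtain ⟨δ', hδ', h'⟩ := hb (x a) a (hx a)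
    have : Path.Homotopic.Quotient.mk δ' = .refl (x a) :=
      (hsc a).mk_eq_mk (δ := Path.refl (x a)) hδ' (by simpa using hx a)
    rw [hb0 s δ hδ, h', this, Path.Homotopic.Quotient.trans_refl, h]

/-- The fundamental group of the configuration space of three points on a theta graph with four
edges. -/
theorem nonempty_fundamentalGroup_mulEquiv (T : ThetaSpace Y) (x : UConf 3 Y) :
    Nonempty (FundamentalGroup (UConf 3 Y) x ≃* genus3SurfaceGroup) := by
  have hG := swapData_pG_qG
  obtain ⟨Φ, hΦ⟩ := exists_pathCocycle (T := T) hG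
  have hΦP {l m : Fin 4} {s t : UConf 3 Y} (hs : s ∈ T.chamberP l m) (ht : t ∈ T.chamberP m l)
      (γ : Path s t) (hγ : range γ ⊆ T.chartP l m) : Φ.val (.mk γ) = pG m l := by
    rw [hΦ (.inr (.inl (l, m))) γ hγ]
    change (T.lowerPotential pG s)⁻¹ * T.lowerPotential pG t = _
    rw [lowerPotential_eq pG (lowerOrder_of_mem_chamberP hs),
      lowerPotential_eq pG (lowerOrder_of_mem_chamberP ht),
      ← hG.lowerWord_mul (ne_of_mem_chartP (chamberP_subset_chartP hs)), inv_mul_cancel_left]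
  have hΦQ {m u : Fin 4} {s t : UConf 3 Y} (hs : s ∈ T.chamberQ m u) (ht : t ∈ T.chamberQ u m)
      (γ : Path s t) (hγ : range γ ⊆ T.chartQ m u) : Φ.val (.mk γ) = qG m u := by
    rw [hΦ (.inr (.inr (.inl (m, u)))) γ hγ]
    change (T.upperPotential qG s)⁻¹ * T.upperPotential qG t = _
    rw [upperPotential_eq qG (upperOrder_of_mem_chamberQ hs),
      upperPotential_eq qG (upperOrder_of_mem_chamberQ ht),
      ← hG.upperWord_mul (ne_of_mem_chartQ (chamberQ_subset_chartQ hs)), inv_mul_cancel_left]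
  obtain ⟨x₀, hx₀, b, hbx₀, hΦb, hbW, hb0⟩ := exists_frame (T := T) (Φ := Φ)
    (fun m s t γ hγ => (hΦ (.inl m) γ hγ).trans (inv_mul_cancel 1))
    (fun a s hs t ht γ hγ => (hΦP hs ht γ hγ).trans (hG.p_zero a))
  obtain ⟨p, q, hpq, hS⟩ := exists_hasSwaps (T := T) (Ψ := .closeUp b)
    (fun m s hs t ht => by
      obtain ⟨γ, hγ⟩ :=
        ((T.isSimplyConnected_chartW m).isPathConnected.joinedIn s hs t ht).exists_path
      rw [← PathCocycle.val_eq_on _ (T.isSimplyConnected_chartW m) γ hγ]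
      exact PathCocycle.closeUp_val_eq_one (hbW m γ hγ))
    (fun a ha => by
      obtain ⟨s, hs, t, ht, γ, hγ, h⟩ := hb0 a ha
      refine ⟨s, hs, t, ht, ?_⟩
      rw [← PathCocycle.val_eq_on _ (T.isSimplyConnected_chartP ha) γ hγ]
      exact PathCocycle.closeUp_val_eq_one h)
  obtain ⟨ψ, hψp, hψq⟩ := hS.exists_hom
  have hgen₀ := chartW_subset_generic hx₀
  have key : Nonempty (FundamentalGroup (UConf 3 Y) x₀ ≃* genus3SurfaceGroup) := by
    refine Φ.nonempty_mulEquiv ψ (fun r => ?_) fun S hS => ?_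
    · have h := PathCocycle.val_eq_of_cover isOpen_chart exists_mem_chart'
        T.exists_generic_joinedIn (Φ.comp ψ) (.closeUp b) (fun c s hs t ht γ hγ => by
          have hsc : s ∈ T.chart c := hγ ⟨0, γ.source⟩
          rw [PathCocycle.val_eq_on (.closeUp b) (isSimplyConnected_chart hsc) γ hγ,
            hpq.on_chart hG hψp hψq c hs ht hsc (hγ ⟨1, γ.target⟩), ← hΦ c γ hγ]
          rfl) hgen₀ hgen₀ r
      refine h.trans ?_
      rw [PathCocycle.closeUp_val, hbx₀, Path.Homotopic.Quotient.refl_trans]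
      congr 1
      exact Path.Homotopic.Quotient.trans_refl r
    · have hmem {s t : UConf 3 Y} (hs : s ∈ T.generic) (ht : t ∈ T.generic) (γ : Path s t) :
          Φ.val (.mk γ) ∈ S := by
        have h := hS (((b s).trans (.mk γ)).trans (b t).symm)
        rwa [Φ.val_trans, Φ.val_trans, Φ.val_symm, hΦb s hs, hΦb t ht, one_mul, inv_one,
          mul_one] at h
      refine closure_pG_qG S (fun m l => ?_) fun m u => ?_
      · rcases eq_or_ne l m with rfl | hlm
        · rw [hG.p_self]
          exact S.one_mem
        obtain ⟨s, hs⟩ := (T.isPathConnected_chamberP hlm).nonempty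
        obtain ⟨t, ht⟩ := (T.isPathConnected_chamberP hlm.symm).nonempty
        obtain ⟨γ, hγ⟩ := ((T.isSimplyConnected_chartP hlm).isPathConnected.joinedIn s
          (chamberP_subset_chartP hs) t
          (chartP_comm (T := T) m l ▸ chamberP_subset_chartP ht)).exists_path
        rw [← hΦP hs ht γ hγ]
        exact hmem (chartW_subset_generic (chamberP_subset_chartW hs))
          (chartW_subset_generic (chamberP_subset_chartW ht)) γ
      · rcases eq_or_ne m u with rfl | hmu
        · rw [hG.q_self]
          exact S.one_mem
        obtain ⟨s, hs⟩ := (T.isPathConnected_chamberQ hmu).nonempty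
        obtain ⟨t, ht⟩ := (T.isPathConnected_chamberQ hmu.symm).nonempty
        obtain ⟨γ, hγ⟩ := ((T.isSimplyConnected_chartQ hmu).isPathConnected.joinedIn s
          (chamberQ_subset_chartQ hs) t
          (chartQ_comm (T := T) u m ▸ chamberQ_subset_chartQ ht)).exists_path
        rw [← hΦQ hs ht γ hγ]
        exact hmem (chartW_subset_generic (chamberQ_subset_chartW hs))
          (chartW_subset_generic (chamberQ_subset_chartW ht)) γ
  obtain ⟨e⟩ := key
  obtain ⟨γ, -⟩ := Path.Homotopic.Quotient.mk_surjective (b x)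
  exact ⟨(FundamentalGroup.fundamentalGroupMulEquivOfPath γ).symm.trans e⟩

end ThetaSpace

/-- For any realization `Θ ⊆ ℝ²` of the generalized theta graph `Θ₄`, the fundamental
group of `UConf₃(Θ)` at any basepoint is the genus-3 surface group. -/
theorem theta4_three_strand_braid_group_surface
    (p q : ℝ × ℝ) (hpq : p ≠ q)
    (γ : Fin 4 → C(unitInterval, ℝ × ℝ))
    (hγinj : ∀ i, Function.Injective (γ i))
    (hγ0 : ∀ i, γ i 0 = p) (hγ1 : ∀ i, γ i 1 = q)
    (hγint : ∀ i j, i ≠ j → Set.range (γ i) ∩ Set.range (γ j) = {p, q})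
    (Θ : Set (ℝ × ℝ)) (hΘ : Θ = ⋃ i, Set.range (γ i)) :
    ∀ x : UConf 3 ↥Θ,
      Nonempty (FundamentalGroup (UConf 3 ↥Θ) x ≃* genus3SurfaceGroup) := by
  obtain ⟨T⟩ := nonempty_thetaSpace p q γ hγinj hγ0 hγ1 hγint Θ hΘ
  exact T.nonempty_fundamentalGroup_mulEquiv
end

section
/- Let m ≥ 4 and let Θ ⊆ ℝ² be a realization of the generalized theta graph Θ_m. Then for every basepoint x of UConf_3(Θ), the fundamental group π₁(UConf_3(Θ), x) is not a free group, i.e. it is not isomorphic to FreeGroup(ι) for any type ι. (The 3-strand braid group of a generalized theta graph on at least 4 arcs contains a genus-3 surface group, hence is not free.) -/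
open unitInterval

/-- The Heisenberg group over `ℂ`, with product opposite to that of upper triangular matrices. -/
@[ext] structure Heisenberg where
  fst : ℂ
  snd : ℂ
  ctr : ℂ

namespace Heisenberg

instance : Mul Heisenberg :=
  ⟨fun g h => ⟨g.fst + h.fst, g.snd + h.snd, g.ctr + h.ctr + h.fst * g.snd⟩⟩

instance : One Heisenberg := ⟨⟨0, 0, 0⟩⟩

instance : Inv Heisenberg := ⟨fun g => ⟨-g.fst, -g.snd, -g.ctr + g.fst * g.snd⟩⟩

theorem mul_def (g h : Heisenberg) :
    g * h = ⟨g.fst + h.fst, g.snd + h.snd, g.ctr + h.ctr + h.fst * g.snd⟩ := rfl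

theorem one_def : (1 : Heisenberg) = ⟨0, 0, 0⟩ := rfl

theorem inv_def (g : Heisenberg) :
    g⁻¹ = ⟨-g.fst, -g.snd, -g.ctr + g.fst * g.snd⟩ := rfl

instance : Group Heisenberg :=
  Group.ofLeftAxioms
    (fun a b c => by ext <;> simp only [mul_def] <;> ring)
    (fun a => by ext <;> simp [mul_def, one_def])
    (fun a => by ext <;> simp [mul_def, one_def, inv_def])

/-- The projection of the Heisenberg group to the first coordinate. -/
def fstHom : Heisenberg →* Multiplicative ℂ where
  toFun g := Multiplicative.ofAdd g.fst
  map_one' := rfl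
  map_mul' _ _ := rfl

/-- The projection of the Heisenberg group to the second coordinate. -/
def sndHom : Heisenberg →* Multiplicative ℂ where
  toFun g := Multiplicative.ofAdd g.snd
  map_one' := rfl
  map_mul' _ _ := rfl

end Heisenberg

/-- On a group isomorphic to a free group, the product of two additive characters is a
coboundary. -/
theorem exists_cobounding_of_free {G : Type*} [Group G] {ι : Type*} (e : G ≃* FreeGroup ι)
    (f g : G →* Multiplicative ℂ) :
    ∃ ζ : G → ℂ, ∀ a b, ζ (a * b) = ζ a + ζ b + (f b).toAdd * (g a).toAdd := by
  let φ : FreeGroup ι →* Heisenberg := FreeGroup.lift fun i =>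
    ⟨(f (e.symm (.of i))).toAdd, (g (e.symm (.of i))).toAdd, 0⟩
  have hf : Heisenberg.fstHom.comp φ = f.comp e.symm.toMonoidHom := by
    ext i
    simp [φ, Heisenberg.fstHom]
  have hg : Heisenberg.sndHom.comp φ = g.comp e.symm.toMonoidHom := by
    ext i
    simp [φ, Heisenberg.sndHom]
  have hf' (a : G) : (φ (e a)).fst = (f a).toAdd := by
    simpa [Heisenberg.fstHom] using congrArg Multiplicative.toAdd (DFunLike.congr_fun hf (e a))
  have hg' (a : G) : (φ (e a)).snd = (g a).toAdd := by
    simpa [Heisenberg.sndHom] using congrArg Multiplicative.toAdd (DFunLike.congr_fun hg (e a))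
  refine ⟨fun a => (φ (e a)).ctr, fun a b => ?_⟩
  simp only [map_mul, Heisenberg.mul_def, hf', hg']

/-- On a path connected space with free fundamental group, the product of two additive functions
on the fundamental groupoid is a coboundary. -/
theorem exists_cobounding_groupoid {X : Type*} [TopologicalSpace X] [PathConnectedSpace X]
    (x₀ : X) {ι : Type*} (e : FundamentalGroup X x₀ ≃* FreeGroup ι)
    (f g : ∀ {a b : X}, Path.Homotopic.Quotient a b → ℂ)
    (hf : ∀ {a b c : X} (P : Path.Homotopic.Quotient a b) (Q : Path.Homotopic.Quotient b c),
      f (P.trans Q) = f P + f Q)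
    (hg : ∀ {a b c : X} (P : Path.Homotopic.Quotient a b) (Q : Path.Homotopic.Quotient b c),
      g (P.trans Q) = g P + g Q) :
    ∃ z : ∀ {a b : X}, Path.Homotopic.Quotient a b → ℂ,
      ∀ {a b c : X} (P : Path.Homotopic.Quotient a b) (Q : Path.Homotopic.Quotient b c),
        z (P.trans Q) = z P + z Q + f P * g Q := by
  let F : FundamentalGroup X x₀ →* Multiplicative ℂ :=
    MonoidHom.mk' (fun a => Multiplicative.ofAdd (f a.toPath)) fun a b => by
      rw [mul_comm]
      exact congrArg Multiplicative.ofAdd (hf b.toPath a.toPath)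
  let G : FundamentalGroup X x₀ →* Multiplicative ℂ :=
    MonoidHom.mk' (fun a => Multiplicative.ofAdd (g a.toPath)) fun a b => by
      rw [mul_comm]
      exact congrArg Multiplicative.ofAdd (hg b.toPath a.toPath)
  obtain ⟨ζ, hζ⟩ := exists_cobounding_of_free e F G
  let τ (a : X) : Path.Homotopic.Quotient x₀ a :=
    Path.Homotopic.Quotient.mk (PathConnectedSpace.somePath x₀ a)
  let L {a b : X} (P : Path.Homotopic.Quotient a b) : Path.Homotopic.Quotient x₀ x₀ :=
    ((τ a).trans P).trans (τ b).symm
  have hsymm (h : ∀ {a b : X}, Path.Homotopic.Quotient a b → ℂ)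
      (hh : ∀ {a b c : X} (P : Path.Homotopic.Quotient a b) (Q : Path.Homotopic.Quotient b c),
      h (P.trans Q) = h P + h Q) {a b : X} (P : Path.Homotopic.Quotient a b) :
      h P.symm = - h P := by
    have h1 := hh P P.symm
    have h2 := hh (Path.Homotopic.Quotient.refl a) (Path.Homotopic.Quotient.refl a)
    rw [Path.Homotopic.Quotient.trans_symm] at h1
    rw [Path.Homotopic.Quotient.trans_refl] at h2
    linear_combination -h1 - h2
  have hL {a b c : X} (P : Path.Homotopic.Quotient a b) (Q : Path.Homotopic.Quotient b c) :
      L (P.trans Q) = (L P).trans (L Q) := by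
    simp only [L, Path.Homotopic.Quotient.trans_assoc]
    rw [← Path.Homotopic.Quotient.trans_assoc (τ b).symm, Path.Homotopic.Quotient.symm_trans,
      Path.Homotopic.Quotient.refl_trans]
  have hζ' (P Q : Path.Homotopic.Quotient x₀ x₀) :
      ζ (P.trans Q) = ζ P + ζ Q + f P * g Q := by
    rw [add_comm (ζ P)]
    exact hζ Q P
  refine ⟨fun {a b} P => ζ (L P) - f (τ a) * g P + f P * g (τ b) - f (τ b) * g (τ b)
    + f (τ a) * g (τ b), fun {a b c} P Q => ?_⟩
  have e1 : f (L P) = f (τ a) + f P - f (τ b) := by simp only [L, hf, hsymm f hf]; ring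
  have e2 : g (L Q) = g (τ b) + g Q - g (τ c) := by simp only [L, hg, hsymm g hg]; ring
  simp only [hL, hζ', hf, hg, e1, e2]
  ring

instance : LocallyPathConnectedSpace I :=
  (convex_Icc (0 : ℝ) 1).locallyPathConnectedSpace

instance : ContractibleSpace I :=
  (convex_Icc (0 : ℝ) 1).contractibleSpace ⟨0, by simp⟩

/-- A nowhere vanishing continuous function on a simply connected space has a logarithm. -/
theorem exists_continuous_log {A : Type*} [TopologicalSpace A] [SimplyConnectedSpace A]
    [LocallyPathConnectedSpace A] (w : C(A, ℂ)) (hw : ∀ a, w a ≠ 0) :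
    ∃ l : C(A, ℂ), ∀ a, Complex.exp (l a) = w a := by
  obtain ⟨a₀⟩ : Nonempty A := inferInstance
  obtain ⟨l, ⟨-, hl⟩, -⟩ := Complex.isCoveringMapOn_exp.existsUnique_continuousMap_lifts w
    (Complex.exp_log (hw a₀)) hw
  exact ⟨l, congrFun hl⟩

open Classical in
/-- The variation of a continuous logarithm along a path in `ℂ`, with junk value `0` if no such
logarithm exists. -/
noncomputable def logVariation (w : C(I, ℂ)) : ℂ :=
  if h : ∃ l : C(I, ℂ), ∀ t, Complex.exp (l t) = w t then h.choose 1 - h.choose 0 else 0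

theorem logVariation_eq {w : C(I, ℂ)} (l : C(I, ℂ)) (hl : ∀ t, Complex.exp (l t) = w t) :
    logVariation w = l 1 - l 0 := by
  have h : ∃ l : C(I, ℂ), ∀ t, Complex.exp (l t) = w t := ⟨l, hl⟩
  rw [logVariation, dif_pos h]
  have hw (t) : w t ≠ 0 := hl t ▸ Complex.exp_ne_zero _
  obtain ⟨n, hn⟩ := Complex.exp_eq_exp_iff_exists_int.1 ((h.choose_spec 0).trans (hl 0).symm)
  obtain ⟨l', -, huniq⟩ := Complex.isCoveringMapOn_exp.existsUnique_continuousMap_lifts w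
    (h.choose_spec 0) hw
  have h1 := huniq h.choose ⟨rfl, funext h.choose_spec⟩
  have h2 := huniq (l + .const I (n * (2 * Real.pi * Complex.I))) ⟨hn.symm, funext fun t => by
    simp [Complex.exp_add, hl, Complex.exp_int_mul_two_pi_mul_I]⟩
  rw [h1, ← h2]
  simp

theorem logVariation_const (c : ℂ) (hc : c ≠ 0) : logVariation (.const I c) = 0 := by
  rw [logVariation_eq (w := .const I c) (.const I (Complex.log c)) fun t => Complex.exp_log hc]
  simp

theorem logVariation_square (W : C(I × I, ℂ)) (hW : ∀ a, W a ≠ 0) (b r l t : C(I, ℂ))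
    (hb : ∀ s, W (s, 0) = b s) (hr : ∀ s, W (1, s) = r s)
    (hl : ∀ s, W (0, s) = l s) (ht : ∀ s, W (s, 1) = t s) :
    logVariation b + logVariation r = logVariation l + logVariation t := by
  obtain ⟨L, hL⟩ := exists_continuous_log W hW
  rw [logVariation_eq (L.comp ⟨fun s => (s, 0), by fun_prop⟩) fun s => (hL _).trans (hb s),
    logVariation_eq (L.comp ⟨fun s => (1, s), by fun_prop⟩) fun s => (hL _).trans (hr s),
    logVariation_eq (L.comp ⟨fun s => (0, s), by fun_prop⟩) fun s => (hL _).trans (hl s),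
    logVariation_eq (L.comp ⟨fun s => (s, 1), by fun_prop⟩) fun s => (hL _).trans (ht s)]
  simp

section logVariation

variable {X : Type*} [TopologicalSpace X]

theorem logVariation_homotopic (u : C(X, ℂ)) (hu : ∀ x, u x ≠ 0) {a b : X} {P Q : Path a b}
    (h : P.Homotopic Q) :
    logVariation (u.comp P.toContinuousMap) = logVariation (u.comp Q.toContinuousMap) := by
  obtain ⟨H⟩ := h
  have := logVariation_square (u.comp H.toContinuousMap) (fun _ => hu _) (.const I (u a))
    (u.comp Q.toContinuousMap) (u.comp P.toContinuousMap) (.const I (u b))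
    (by simp) (by simp) (by simp) (by simp)
  rw [logVariation_const _ (hu a), logVariation_const _ (hu b)] at this
  linear_combination -this

theorem logVariation_trans (u : C(X, ℂ)) (hu : ∀ x, u x ≠ 0) {a b c : X} (P : Path a b)
    (Q : Path b c) :
    logVariation (u.comp (P.trans Q).toContinuousMap) =
      logVariation (u.comp P.toContinuousMap) + logVariation (u.comp Q.toContinuousMap) := by
  obtain ⟨l, hl⟩ := exists_continuous_log (u.comp (P.trans Q).toContinuousMap) fun _ => hu _
  rw [logVariation_eq l hl,
    logVariation_eq (w := u.comp P.toContinuousMap)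
      (l.comp ⟨fun s => ⟨s / 2, unitInterval.div_mem s.2.1 zero_le_two (by linarith [s.2.2])⟩,
        by fun_prop⟩) fun s => (hl _).trans ?_,
    logVariation_eq (w := u.comp Q.toContinuousMap)
      (l.comp ⟨fun s => ⟨(1 + s) / 2, unitInterval.div_mem (by linarith [s.2.1]) zero_le_two
        (by linarith [s.2.2])⟩, by fun_prop⟩) fun s => (hl _).trans ?_]
  · simp
  · have hs := s.2.1
    have hs' := s.2.2
    rcases hs.eq_or_lt with h0 | h0
    · obtain rfl : s = 0 := Subtype.ext h0.symm
      simp [Path.trans_apply]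
    · simp only [ContinuousMap.comp_apply, ContinuousMap.coe_mk, Path.coe_toContinuousMap,
        Path.trans_apply]
      rw [dif_neg (by simp; linarith)]
      congr 2
      ext
      simp
      ring
  · have hs := s.2.1
    have hs' := s.2.2
    simp only [ContinuousMap.comp_apply, ContinuousMap.coe_mk, Path.coe_toContinuousMap,
      Path.trans_apply]
    rw [dif_pos (by simp; linarith)]
    congr 2
    ext
    simp
    ring

/-- The logarithmic variation of `u` along a homotopy class of paths. -/
noncomputable def logVariationQuotient (u : C(X, ℂ)) (hu : ∀ x, u x ≠ 0) {a b : X} :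
    Path.Homotopic.Quotient a b → ℂ :=
  Quotient.lift (fun P => logVariation (u.comp P.toContinuousMap))
    fun _ _ h => logVariation_homotopic u hu h

theorem logVariationQuotient_trans (u : C(X, ℂ)) (hu : ∀ x, u x ≠ 0) {a b c : X}
    (P : Path.Homotopic.Quotient a b) (Q : Path.Homotopic.Quotient b c) :
    logVariationQuotient u hu (P.trans Q) =
      logVariationQuotient u hu P + logVariationQuotient u hu Q := by
  induction P using Path.Homotopic.Quotient.ind
  induction Q using Path.Homotopic.Quotient.ind
  exact logVariation_trans u hu _ _

theorem Path.Homotopic.square (F : C(I × I, X)) :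
    ((Path.mk ⟨fun s => F (s, 0), by fun_prop⟩ rfl rfl : Path (F (0, 0)) (F (1, 0))).trans
      (Path.mk ⟨fun s => F (1, s), by fun_prop⟩ rfl rfl : Path (F (1, 0)) (F (1, 1)))).Homotopic
    ((Path.mk ⟨fun s => F (0, s), by fun_prop⟩ rfl rfl : Path (F (0, 0)) (F (0, 1))).trans
      (Path.mk ⟨fun s => F (s, 1), by fun_prop⟩ rfl rfl : Path (F (0, 1)) (F (1, 1)))) := by
  have := (SimplyConnectedSpace.paths_homotopic
    ((Path.mk ⟨fun s => (s, 0), by fun_prop⟩ rfl rfl : Path ((0, 0) : I × I) (1, 0)).trans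
      (Path.mk ⟨fun s => (1, s), by fun_prop⟩ rfl rfl : Path ((1, 0) : I × I) (1, 1)))
    ((Path.mk ⟨fun s => (0, s), by fun_prop⟩ rfl rfl : Path ((0, 0) : I × I) (0, 1)).trans
      (Path.mk ⟨fun s => (s, 1), by fun_prop⟩ rfl rfl : Path ((0, 1) : I × I) (1, 1)))).map F
  rw [Path.map_trans, Path.map_trans] at this
  exact this

/-- On a path connected space with free fundamental group, the cubical cup product of two
logarithmic variations is a coboundary. -/
theorem exists_cobounding_squares [PathConnectedSpace X]
    (x₀ : X) {ι : Type*} (e : FundamentalGroup X x₀ ≃* FreeGroup ι)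
    (u v : C(X, ℂ)) (hu : ∀ x, u x ≠ 0) (hv : ∀ x, v x ≠ 0) :
    ∃ z : C(I, X) → ℂ, ∀ (F : C(I × I, X)) (b r l t : C(I, X)),
      (∀ s, F (s, 0) = b s) → (∀ s, F (1, s) = r s) →
      (∀ s, F (0, s) = l s) → (∀ s, F (s, 1) = t s) →
      z b + z r + logVariation (u.comp b) * logVariation (v.comp r) =
        z l + z t + logVariation (u.comp l) * logVariation (v.comp t) := by
  obtain ⟨z, hz⟩ := exists_cobounding_groupoid x₀ e
    (logVariationQuotient u hu) (logVariationQuotient v hv)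
    (logVariationQuotient_trans u hu) (logVariationQuotient_trans v hv)
  refine ⟨fun f => z (Path.Homotopic.Quotient.mk (Path.mk f rfl rfl)), ?_⟩
  intro F b r l t hb hr hl ht
  obtain rfl : b = ⟨fun s => F (s, 0), by fun_prop⟩ := by ext s; exact (hb s).symm
  obtain rfl : r = ⟨fun s => F (1, s), by fun_prop⟩ := by ext s; exact (hr s).symm
  obtain rfl : l = ⟨fun s => F (0, s), by fun_prop⟩ := by ext s; exact (hl s).symm
  obtain rfl : t = ⟨fun s => F (s, 1), by fun_prop⟩ := by ext s; exact (ht s).symm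
  have h := congrArg z (Path.Homotopic.Quotient.eq.2 (Path.Homotopic.square F))
  rw [Path.Homotopic.Quotient.mk_trans, Path.Homotopic.Quotient.mk_trans, hz, hz] at h
  exact h

end logVariation

theorem injective_triple_s11 {S : Type*} {a b c : S} (hab : a ≠ b) (hac : a ≠ c) (hbc : b ≠ c) :
    Function.Injective ![a, b, c] := by
  intro i j h
  fin_cases i <;> fin_cases j <;> simp_all

section Configurations

variable {n : ℕ} {T Y : Type*} [TopologicalSpace T] [TopologicalSpace Y]

/-- The continuous family of unordered configurations given by a continuous family of injective
tuples. -/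
def confMap (f : C(Y, Fin n → T)) (h : ∀ y, Function.Injective (f y)) : C(Y, UConf n T) where
  toFun y := Quot.mk _ ⟨f y, h y⟩
  continuous_toFun := continuous_quot_mk.comp (f.continuous.subtype_mk h)

/-- A symmetric continuous function of tuples descends to the unordered configuration space. -/
def UConf.lift {S : Type*} [TopologicalSpace S] (F : C(Fin n → T, S))
    (hF : ∀ (ρ : Equiv.Perm (Fin n)) (c : Fin n → T), F (c ∘ ρ) = F c) : C(UConf n T, S) where
  toFun := Quot.lift (fun c => F c.1) fun a b ⟨ρ, hρ⟩ => by rw [← hρ, hF]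
  continuous_toFun := continuous_quot_lift _ (by fun_prop)

/-- The product of the values of `f` over a configuration. -/
noncomputable def configProd (f : C(T, ℂ)) : C(UConf n T, ℂ) :=
  UConf.lift ⟨fun c => ∏ i, f (c i), by fun_prop⟩ fun ρ c => Equiv.prod_comp ρ fun i => f (c i)

theorem configProd_mk (f : C(T, ℂ)) (c : {c : Fin n → T // Function.Injective c}) :
    configProd f (Quot.mk _ c) = ∏ i, f (c.1 i) := rfl

theorem configProd_ne_zero (f : C(T, ℂ)) (hf : ∀ x, f x ≠ 0) (c : UConf n T) :
    configProd f c ≠ 0 := by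
  induction c using Quot.ind
  rw [configProd_mk]
  exact Finset.prod_ne_zero_iff.2 fun i _ => hf _

/-- The discriminant of the image of a configuration under `g`, up to sign. -/
noncomputable def configDiscr (g : C(T, ℂ)) : C(UConf n T, ℂ) :=
  UConf.lift ⟨fun c => ∏ i, ∏ j, if i = j then 1 else g (c i) - g (c j), by
      refine continuous_finsetProd _ fun i _ => continuous_finsetProd _ fun j _ => ?_
      split_ifs <;> fun_prop⟩ fun ρ c => by
    simp only [ContinuousMap.coe_mk, Function.comp_apply]
    rw [← Equiv.prod_comp ρ.symm]
    refine Finset.prod_congr rfl fun i _ => ?_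
    rw [← Equiv.prod_comp ρ.symm]
    simp

theorem configDiscr_mk (g : C(T, ℂ)) (c : {c : Fin n → T // Function.Injective c}) :
    configDiscr g (Quot.mk _ c) =
      ∏ i, ∏ j, if i = j then 1 else g (c.1 i) - g (c.1 j) := rfl

theorem configDiscr_ne_zero (g : C(T, ℂ)) (hg : Function.Injective g) (c : UConf n T) :
    configDiscr g c ≠ 0 := by
  induction c using Quot.ind with | mk c =>
  rw [configDiscr_mk]
  refine Finset.prod_ne_zero_iff.2 fun i _ => Finset.prod_ne_zero_iff.2 fun j _ => ?_
  split_ifs with h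
  · exact one_ne_zero
  · exact sub_ne_zero.2 fun h' => h (c.2 (hg h'))

/-- Three continuous maps, as a map to triples. -/
def tripleMap (A B C : C(Y, T)) : C(Y, Fin 3 → T) where
  toFun y := ![A y, B y, C y]
  continuous_toFun := by
    refine continuous_pi fun i => ?_
    fin_cases i <;> simp <;> fun_prop

theorem tripleMap_apply (A B C : C(Y, T)) (y : Y) : tripleMap A B C y = ![A y, B y, C y] := rfl

open Classical in
/-- The value of `φ` on the path of configurations formed by three paths, or `0` if these are not
disjoint at all times. -/
noncomputable def evalTriple (φ : C(I, UConf 3 T) → ℂ) (A B C : C(I, T)) : ℂ :=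
  if h : ∀ t, Function.Injective (tripleMap A B C t) then φ (confMap (tripleMap A B C) h) else 0

theorem evalTriple_eq (φ : C(I, UConf 3 T) → ℂ) {A B C : C(I, T)}
    (h : ∀ t, Function.Injective (tripleMap A B C t)) :
    evalTriple φ A B C = φ (confMap (tripleMap A B C) h) :=
  dif_pos h

theorem evalTriple_perm (φ : C(I, UConf 3 T) → ℂ) {A B C A' B' C' : C(I, T)}
    (ρ : Equiv.Perm (Fin 3)) (hρ : ∀ t, tripleMap A B C t ∘ ρ = tripleMap A' B' C' t) :
    evalTriple φ A B C = evalTriple φ A' B' C' := by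
  by_cases h : ∀ t, Function.Injective (tripleMap A B C t)
  · have h' : ∀ t, Function.Injective (tripleMap A' B' C' t) := fun t => by
      rw [← hρ]
      exact (h t).comp ρ.injective
    rw [evalTriple_eq φ h, evalTriple_eq φ h']
    congr 1
    ext t
    exact Quot.sound ⟨ρ, hρ t⟩
  · have h' : ¬ ∀ t, Function.Injective (tripleMap A' B' C' t) := fun h' => h fun t => by
      rw [show tripleMap A B C t = tripleMap A' B' C' t ∘ ρ.symm by
        rw [← hρ, Function.comp_assoc, Equiv.self_comp_symm, Function.comp_id]]
      exact (h' t).comp ρ.symm.injective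
    rw [evalTriple, evalTriple, dif_neg h, dif_neg h']

theorem evalTriple_swap_fst (φ : C(I, UConf 3 T) → ℂ) (A B C : C(I, T)) :
    evalTriple φ A B C = evalTriple φ C B A :=
  evalTriple_perm φ (Equiv.swap 0 2) fun t => by
    ext i
    fin_cases i <;> rfl

theorem evalTriple_swap_snd (φ : C(I, UConf 3 T) → ℂ) (A B C : C(I, T)) :
    evalTriple φ A B C = evalTriple φ A C B :=
  evalTriple_perm φ (Equiv.swap 1 2) fun t => by
    ext i
    fin_cases i <;> rfl

theorem evalTriple_square {u v : C(UConf 3 T, ℂ)} {z : C(I, UConf 3 T) → ℂ}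
    (hz : ∀ (F : C(I × I, UConf 3 T)) (b r l t : C(I, UConf 3 T)),
      (∀ s, F (s, 0) = b s) → (∀ s, F (1, s) = r s) →
      (∀ s, F (0, s) = l s) → (∀ s, F (s, 1) = t s) →
      z b + z r + logVariation (u.comp b) * logVariation (v.comp r) =
        z l + z t + logVariation (u.comp l) * logVariation (v.comp t))
    (A B : C(I, T)) (c : T) (hAB : ∀ s t, A s ≠ B t) (hA : ∀ s, A s ≠ c) (hB : ∀ s, B s ≠ c) :
    evalTriple z A (.const I (B 0)) (.const I c) + evalTriple z (.const I (A 1)) B (.const I c)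
        + evalTriple (fun b => logVariation (u.comp b)) A (.const I (B 0)) (.const I c)
        * evalTriple (fun b => logVariation (v.comp b)) (.const I (A 1)) B (.const I c) =
      evalTriple z (.const I (A 0)) B (.const I c) + evalTriple z A (.const I (B 1)) (.const I c)
        + evalTriple (fun b => logVariation (u.comp b)) (.const I (A 0)) B (.const I c)
        * evalTriple (fun b => logVariation (v.comp b)) A (.const I (B 1)) (.const I c) := by
  have h1 (x : I) (t : I) : Function.Injective (tripleMap A (.const I (B x)) (.const I c) t) :=
    injective_triple_s11 (hAB _ _) (hA _) (hB _)
  have h2 (x : I) (t : I) : Function.Injective (tripleMap (.const I (A x)) B (.const I c) t) :=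
    injective_triple_s11 (hAB _ _) (hA _) (hB _)
  have h3 (x : I × I) : Function.Injective
      (tripleMap (A.comp ContinuousMap.fst) (B.comp ContinuousMap.snd) (.const (I × I) c) x) :=
    injective_triple_s11 (hAB _ _) (hA _) (hB _)
  rw [evalTriple_eq _ (h1 0), evalTriple_eq _ (h1 0), evalTriple_eq _ (h1 1),
    evalTriple_eq _ (h1 1), evalTriple_eq _ (h2 0), evalTriple_eq _ (h2 0),
    evalTriple_eq _ (h2 1), evalTriple_eq _ (h2 1)]
  exact hz (confMap _ h3) _ _ _ _ (fun _ => rfl) (fun _ => rfl) (fun _ => rfl) fun _ => rfl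

theorem evalTriple_logVariation_configProd (f : C(T, ℂ)) {A B C : C(I, T)}
    (h : ∀ t, Function.Injective (tripleMap A B C t)) (l : C(I, ℂ))
    (hl : ∀ t, Complex.exp (l t) = f (A t) * f (B t) * f (C t)) :
    evalTriple (fun b => logVariation ((configProd f).comp b)) A B C = l 1 - l 0 := by
  rw [evalTriple_eq _ h]
  refine logVariation_eq l fun t => (hl t).trans ?_
  exact (Fin.prod_univ_three fun i => f (tripleMap A B C t i)).symm

/-- The Vandermonde determinant of the values of `g` at three points. -/
noncomputable def vandermondeTriple (g : C(T, ℂ)) (a b c : T) : ℂ :=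
  (g a - g b) * (g b - g c) * (g c - g a)

theorem vandermondeTriple_ne_zero {g : C(T, ℂ)} (hg : Function.Injective g) {a b c : T}
    (hab : a ≠ b) (hac : a ≠ c) (hbc : b ≠ c) : vandermondeTriple g a b c ≠ 0 :=
  mul_ne_zero (mul_ne_zero (sub_ne_zero.2 (hg.ne hab)) (sub_ne_zero.2 (hg.ne hbc)))
    (sub_ne_zero.2 (hg.ne hac.symm))

theorem evalTriple_logVariation_configDiscr {g : C(T, ℂ)} (hg : Function.Injective g)
    {A B C : C(I, T)} (hAB : ∀ t, A t ≠ B t) (hAC : ∀ t, A t ≠ C t) (hBC : ∀ t, B t ≠ C t) :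
    Complex.exp (evalTriple (fun b => logVariation ((configDiscr g).comp b)) A B C / 2) *
      vandermondeTriple g (A 0) (B 0) (C 0) = vandermondeTriple g (A 1) (B 1) (C 1) := by
  obtain ⟨l, hl⟩ := exists_continuous_log
    ⟨fun t => vandermondeTriple g (A t) (B t) (C t), by unfold vandermondeTriple; fun_prop⟩
    fun t => vandermondeTriple_ne_zero hg (hAB t) (hAC t) (hBC t)
  simp only [ContinuousMap.coe_mk] at hl
  rw [evalTriple_eq _ fun t => injective_triple_s11 (hAB t) (hAC t) (hBC t),
    logVariation_eq (l + l + .const I (Real.pi * Complex.I)), ← hl, ← hl, ← Complex.exp_add]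
  · congr 1
    simp
    ring
  · intro t
    simp only [ContinuousMap.add_apply, ContinuousMap.const_apply, Complex.exp_add,
      Complex.exp_pi_mul_I, hl]
    change _ = ∏ i, ∏ j, if i = j then 1 else
      g (tripleMap A B C t i) - g (tripleMap A B C t j)
    simp [Fin.prod_univ_three, tripleMap_apply, vandermondeTriple]
    ring

end Configurations

section Connectedness

variable {n : ℕ} {T : Type*} [TopologicalSpace T]

theorem joined_of_family (f : C(I, Fin n → T)) (h : ∀ t, Function.Injective (f t))
    {a b : {c : Fin n → T // Function.Injective c}} (ha : f 0 = a) (hb : f 1 = b) :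
    Joined (Quot.mk _ a : UConf n T) (Quot.mk _ b) := by
  obtain ⟨a, ha'⟩ := a
  obtain ⟨b, hb'⟩ := b
  subst ha hb
  exact ⟨⟨confMap f h, rfl, rfl⟩⟩

theorem joined_update (c : {c : Fin n → T // Function.Injective c}) (l : Fin n) (y : T)
    (h : JoinedIn {x | ∀ k ≠ l, c.1 k ≠ x} (c.1 l) y) :
    ∃ h' : Function.Injective (Function.update c.1 l y),
      Joined (Quot.mk _ c : UConf n T) (Quot.mk _ ⟨Function.update c.1 l y, h'⟩) := by
  obtain ⟨P, hP⟩ := h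
  have hinj (x : T) (hx : ∀ k ≠ l, c.1 k ≠ x) : Function.Injective (Function.update c.1 l x) := by
    intro j k hjk
    by_cases hj : j = l <;> by_cases hk : k = l
    · rw [hj, hk]
    · subst hj
      rw [Function.update_self, Function.update_of_ne hk] at hjk
      exact (hx k hk hjk.symm).elim
    · subst hk
      rw [Function.update_self, Function.update_of_ne hj] at hjk
      exact (hx j hj hjk).elim
    · rw [Function.update_of_ne hk, Function.update_of_ne hj] at hjk
      exact c.2 hjk
  refine ⟨hinj y (by simpa using hP 1), joined_of_family
    ⟨fun t => Function.update c.1 l (P t), continuous_const.update l P.continuous⟩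
    (fun t => hinj _ (hP t)) ?_ ?_⟩ <;> simp

theorem joinedIn_image_Icc (f : C(I, T)) {a b : I} (hab : a ≤ b) :
    JoinedIn (f '' Set.Icc a b) (f a) (f b) := by
  have h := ((convex_Icc (a : ℝ) b).isPathConnected ⟨a, le_rfl, hab⟩).joinedIn a ⟨le_rfl, hab⟩
    b ⟨hab, le_rfl⟩
  have h' := h.map_continuousOn (f := Set.IccExtend zero_le_one f)
    (f.continuous.Icc_extend').continuousOn
  simp only [Set.IccExtend_val] at h'
  refine h'.mono ?_
  rintro _ ⟨x, hx, rfl⟩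
  have hx' : x ∈ I := ⟨a.2.1.trans hx.1, hx.2.trans b.2.2⟩
  exact ⟨⟨x, hx'⟩, hx, (Set.IccExtend_of_mem zero_le_one f hx').symm⟩

/-- The arcs `γ i` join `p` to `q`, cover `T`, and meet only at their endpoints. -/
structure IsTheta {m : ℕ} (γ : Fin m → C(I, T)) (p q : T) : Prop where
  inj : ∀ i, Function.Injective (γ i)
  map_zero : ∀ i, γ i 0 = p
  map_one : ∀ i, γ i 1 = q
  inter : ∀ {i j : Fin m} {s t : I}, i ≠ j → γ i s = γ j t → s = 0 ∧ t = 0 ∨ s = 1 ∧ t = 1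
  surj : ∀ x, ∃ i s, γ i s = x

theorem joined_of_mem_arc (f : C(I, T)) (hf : Function.Injective f)
    (a b : {c : Fin n → T // Function.Injective c}) (ha : ∀ k, a.1 k ∈ Set.range f)
    (hb : ∀ k, b.1 k ∈ Set.range f) : Joined (Quot.mk _ a : UConf n T) (Quot.mk _ b) := by
  have key (c : {c : Fin n → T // Function.Injective c}) (hc : ∀ k, c.1 k ∈ Set.range f) :
      ∃ t : Fin n → I, ∃ ht : StrictMono t,
        (Quot.mk _ c : UConf n T) = Quot.mk _ ⟨f ∘ t, hf.comp ht.injective⟩ := by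
    choose t ht using hc
    have htinj : Function.Injective t := fun j k h => c.2 (by rw [← ht, ← ht, h])
    refine ⟨t ∘ Tuple.sort t, (Tuple.monotone_sort t).strictMono_of_injective
      (htinj.comp (Tuple.sort t).injective), Quot.sound ⟨Tuple.sort t, ?_⟩⟩
    ext k
    exact (ht _).symm
  obtain ⟨s, hs, ha⟩ := key a ha
  obtain ⟨t, ht, hb⟩ := key b hb
  rw [ha, hb]
  have hmem (r : I) (k : Fin n) : (1 - r : ℝ) * s k + r * t k ∈ I :=
    convex_Icc (0 : ℝ) 1 (s k).2 (t k).2 (sub_nonneg.2 r.2.2) r.2.1 (by ring)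
  refine joined_of_family ⟨fun r k => f ⟨_, hmem r k⟩, by fun_prop⟩ (fun r => ?_) ?_ ?_
  · refine hf.comp (StrictMono.injective (β := I) fun j k hjk => ?_)
    have h1 : (s j : ℝ) < s k := hs hjk
    have h2 : (t j : ℝ) < t k := ht hjk
    have h3 := r.2.1
    have h4 := r.2.2
    change (1 - r : ℝ) * s j + r * t j < (1 - r : ℝ) * s k + r * t k
    rcases h3.eq_or_lt with h5 | h5
    · rw [← h5]
      linarith
    · nlinarith
  · ext k
    simp
  · ext k
    simp

namespace IsTheta

variable [T1Space T] {m : ℕ} {γ : Fin m → C(I, T)} {p q : T}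

theorem exists_joined_of_notMem (hγ : IsTheta γ p q) {i₀ i₁ : Fin m} (hi : i₁ ≠ i₀)
    (c : {c : Fin n → T // Function.Injective c}) (h : ∃ k, c.1 k ∉ γ i₀ '' Set.Ioo 0 1) :
    ∃ l, c.1 l ∉ γ i₀ '' Set.Ioo 0 1 ∧ ∃ y ∈ γ i₀ '' Set.Ioo 0 1,
      JoinedIn {x | ∀ k ≠ l, c.1 k ≠ x} (c.1 l) y := by
  classical
  obtain ⟨k, hk⟩ := h
  obtain ⟨i, hi, hki⟩ : ∃ i, i ≠ i₀ ∧ c.1 k ∈ Set.range (γ i) := by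
    obtain ⟨i, t, ht⟩ := hγ.surj (c.1 k)
    by_cases hii : i = i₀
    · subst hii
      rcases t.2.1.eq_or_lt with h0 | h0
      · obtain rfl : t = 0 := Subtype.ext h0.symm
        exact ⟨i₁, hi, 0, by rw [← ht, hγ.map_zero, hγ.map_zero]⟩
      rcases t.2.2.eq_or_lt with h1 | h1
      · obtain rfl : t = 1 := Subtype.ext h1
        exact ⟨i₁, hi, 1, by rw [← ht, hγ.map_one, hγ.map_one]⟩
      exact (hk ⟨t, ⟨h0, h1⟩, ht⟩).elim
    · exact ⟨i, hii, t, ht⟩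
  let S := Finset.univ.filter fun k => c.1 k ∈ Set.range (γ i)
  obtain ⟨l, hl, hmax⟩ := S.exists_max_image (fun k => Function.invFun (γ i) (c.1 k))
    ⟨k, by simpa [S] using hki⟩
  obtain ⟨t, ht⟩ : c.1 l ∈ Set.range (γ i) := by simpa [S] using hl
  have hfree (s : I) (hs : t ≤ s) (k : Fin n) (hk : k ≠ l) : c.1 k ≠ γ i s := by
    intro h
    have := hmax k (Finset.mem_filter.2 ⟨Finset.mem_univ k, s, h.symm⟩)
    simp only [h, ← ht, Function.leftInverse_invFun (hγ.inj i) _] at this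
    obtain rfl := le_antisymm this hs
    exact hk (c.2 (h.trans ht))
  have hnhds : ∀ᶠ s in nhds (1 : I), ∀ k ≠ l, γ i₀ s ≠ c.1 k := by
    refine Filter.eventually_all.2 fun k => Filter.eventually_all.2 fun hk => ?_
    refine (γ i₀).continuous.continuousAt.eventually_ne ?_
    rw [hγ.map_one, ← hγ.map_one i]
    exact (hfree 1 t.2.2 k hk).symm
  obtain ⟨a, ha, haS⟩ := exists_Ioc_subset_of_mem_nhds hnhds ⟨0, zero_lt_one⟩
  obtain ⟨r, har, hr⟩ := exists_between ha
  refine ⟨l, ?_, γ i₀ r, ⟨r, ⟨a.2.1.trans_lt har, hr⟩, rfl⟩, JoinedIn.trans (y := q) ?_ ?_⟩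
  · rintro ⟨s, hs, h⟩
    rcases hγ.inter hi.symm (h.trans ht.symm) with h | h
    · exact hs.1.ne' h.1
    · exact hs.2.ne h.1
  · rw [← ht, ← hγ.map_one i]
    refine (joinedIn_image_Icc (γ i) (le_one' : t ≤ 1)).mono ?_
    rintro _ ⟨s, hs, rfl⟩ k hk
    exact hfree s hs.1 k hk
  · rw [← hγ.map_one i₀]
    refine (joinedIn_image_Icc (γ i₀) hr.le).symm.mono ?_
    rintro _ ⟨s, hs, rfl⟩ k hk
    exact (haS ⟨har.trans_le hs.1, hs.2⟩ k hk).symm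

theorem exists_joined_mem_arc (hγ : IsTheta γ p q) {i₀ i₁ : Fin m} (hi : i₁ ≠ i₀)
    (c : {c : Fin n → T // Function.Injective c}) :
    ∃ d : {c : Fin n → T // Function.Injective c}, (∀ k, d.1 k ∈ γ i₀ '' Set.Ioo 0 1) ∧
      Joined (Quot.mk _ c : UConf n T) (Quot.mk _ d) := by
  classical
  induction hN : (Finset.univ.filter fun k => c.1 k ∉ γ i₀ '' Set.Ioo 0 1).card
    using Nat.strong_induction_on generalizing c with | _ N ih
  by_cases h : ∃ k, c.1 k ∉ γ i₀ '' Set.Ioo 0 1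
  · obtain ⟨l, hl, y, hy, hj⟩ := hγ.exists_joined_of_notMem hi c h
    obtain ⟨hinj, hj'⟩ := joined_update c l y hj
    obtain ⟨d, hd, hcd⟩ := ih _ (by
      rw [← hN]
      refine Finset.card_lt_card ((Finset.ssubset_iff_of_subset fun k hk => ?_).2 ⟨l, ?_, ?_⟩)
      · rw [Finset.mem_filter] at hk ⊢
        refine ⟨hk.1, ?_⟩
        rcases eq_or_ne k l with rfl | hkl
        · exact hl
        · simpa only [Function.update_of_ne hkl] using hk.2
      · exact Finset.mem_filter.2 ⟨Finset.mem_univ l, hl⟩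
      · intro h
        refine (Finset.mem_filter.1 h).2 ?_
        simpa only [Function.update_self] using hy) ⟨Function.update c.1 l y, hinj⟩ rfl
    exact ⟨d, hd, hj'.trans hcd⟩
  · push Not at h
    exact ⟨c, h, Joined.refl _⟩

/-- The unordered configuration spaces of a theta graph are path connected. -/
theorem joined_uconf (hγ : IsTheta γ p q) (hm : 2 ≤ m) (x y : UConf n T) : Joined x y := by
  induction x using Quot.ind with | mk a
  induction y using Quot.ind with | mk b
  have hi : (⟨1, hm⟩ : Fin m) ≠ ⟨0, by lia⟩ := by simp
  obtain ⟨a', ha', ha⟩ := hγ.exists_joined_mem_arc hi a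
  obtain ⟨b', hb', hb⟩ := hγ.exists_joined_mem_arc hi b
  exact ha.trans ((joined_of_mem_arc _ (hγ.inj _) a' b'
    (fun k => Set.image_subset_range _ _ (ha' k))
    fun k => Set.image_subset_range _ _ (hb' k)).trans hb.symm)

end IsTheta

end Connectedness

/-- On a theta graph there is a nowhere vanishing function winding once along the first half of one
arc and equal to one on the other arcs. -/
theorem IsTheta.exists_winding {T : Type*} [TopologicalSpace T] [T2Space T] {m : ℕ}
    {γ : Fin m → C(I, T)} {p q : T} (hγ : IsTheta γ p q) (i₀ : Fin m) :
    ∃ f : C(T, ℂ), (∀ x, f x ≠ 0) ∧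
      (∀ s : I, f (γ i₀ s) = Complex.exp (2 * Real.pi * Complex.I * (min 1 (2 * s) : ℝ))) ∧
      ∀ i ≠ i₀, ∀ s, f (γ i s) = 1 := by
  let F : C(Fin m × I, T) := ⟨fun x => γ x.1 x.2,
    continuous_prod_of_discrete_left.2 fun i => (γ i).continuous⟩
  let φ : C(Fin m × I, ℂ) := ⟨fun x => if x.1 = i₀ then
      Complex.exp (2 * Real.pi * Complex.I * (min 1 (2 * x.2) : ℝ)) else 1,
    continuous_prod_of_discrete_left.2 fun i => by
      dsimp only
      split_ifs <;> fun_prop⟩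
  have hF : Topology.IsQuotientMap F := F.continuous.isClosedMap.isQuotientMap F.continuous
    fun x => by
      obtain ⟨i, s, h⟩ := hγ.surj x
      exact ⟨(i, s), h⟩
  have hφ0 (i : Fin m) : φ (i, 0) = 1 := by
    simp [φ]
  have hφ1 (i : Fin m) : φ (i, 1) = 1 := by
    simp [φ, Complex.exp_two_pi_mul_I]
  have hφ : Function.FactorsThrough φ F := by
    rintro ⟨i, s⟩ ⟨j, t⟩ (h : γ i s = γ j t)
    rcases eq_or_ne i j with rfl | hij
    · rw [hγ.inj i h]
    · rcases hγ.inter hij h with ⟨rfl, rfl⟩ | ⟨rfl, rfl⟩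
      · rw [hφ0, hφ0]
      · rw [hφ1, hφ1]
  have hlift (i : Fin m) (s : I) : hF.lift φ hφ (γ i s) = φ (i, s) :=
    congrArg (fun f => f (i, s)) (hF.lift_comp φ hφ)
  refine ⟨hF.lift φ hφ, fun x => ?_, fun s => ?_, fun i hi s => ?_⟩
  · obtain ⟨i, s, rfl⟩ := hγ.surj x
    rw [hlift]
    simp only [φ, ContinuousMap.coe_mk]
    split_ifs
    · exact Complex.exp_ne_zero _
    · exact one_ne_zero
  · rw [hlift]
    simp [φ]
  · rw [hlift]
    simp [φ, hi]

/-- The antisymmetrization of the square relations over the orderings of four arcs. -/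
theorem antisymmetrized_squares {zα zδ : Fin 4 → Fin 4 → ℂ}
    {zβ zε y : Fin 4 → Fin 4 → Fin 4 → ℂ}
    {c : ℂ} (hβ : ∀ i j k, zβ i j k = zβ i k j) (hε : ∀ j i k, zε j i k = zε j k i)
    (h : ∀ i j k, i ≠ j → i ≠ k → j ≠ k →
      zα i k + zε j i k + (if i = 0 then c else 0) * y j i k = zδ j k + zβ i j k) :
    c * (y 1 0 2 - y 2 0 1 + y 2 0 3 - y 3 0 2 + y 3 0 1 - y 1 0 3) = 0 := by
  have h0 (j k : Fin 4) (hj : 0 ≠ j := by decide) (hk : 0 ≠ k := by decide)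
      (hjk : j ≠ k := by decide) :
      zα 0 k + zε j 0 k + c * y j 0 k = zδ j k + zβ 0 j k := by
    simpa using h 0 j k hj hk hjk
  have hne (i j k : Fin 4) (hi : i ≠ 0 := by decide) (hj : i ≠ j := by decide)
      (hk : i ≠ k := by decide) (hjk : j ≠ k := by decide) :
      zα i k + zε j i k = zδ j k + zβ i j k := by
    simpa [hi] using h i j k hj hk hjk
  linear_combination
    h0 1 2 - h0 1 3 - h0 2 1 + h0 2 3 + h0 3 1 - h0 3 2
      - hne 1 0 2 + hne 1 0 3 + hne 1 2 0 - hne 1 2 3 - hne 1 3 0 + hne 1 3 2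
      + hne 2 0 1 - hne 2 0 3 - hne 2 1 0 + hne 2 1 3 + hne 2 3 0 - hne 2 3 1
      - hne 3 0 1 + hne 3 0 2 + hne 3 1 0 - hne 3 1 2 - hne 3 2 0 + hne 3 2 1
      + hβ 0 1 2 - hβ 0 1 3 + hβ 0 2 3 - hβ 1 0 2 + hβ 1 0 3 - hβ 1 2 3
      + hβ 2 0 1 - hβ 2 0 3 + hβ 2 1 3 - hβ 3 0 1 + hβ 3 0 2 - hβ 3 1 2
      + hε 0 1 2 - hε 0 1 3 + hε 0 2 3 - hε 1 0 2 + hε 1 0 3 - hε 1 2 3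
      + hε 2 0 1 - hε 2 0 3 + hε 2 1 3 - hε 3 0 1 + hε 3 0 2 - hε 3 1 2

/-- The parametrization of the first half of the unit interval. -/
noncomputable def firstHalf : C(I, I) where
  toFun s := ⟨s / 2, by constructor <;> linarith [s.2.1, s.2.2]⟩

/-- The parametrization of the second half of the unit interval, backwards. -/
noncomputable def secondHalf : C(I, I) where
  toFun s := ⟨1 - s / 2, by constructor <;> linarith [s.2.1, s.2.2]⟩

theorem firstHalf_ne_one (s : I) : firstHalf s ≠ 1 := fun h => by
  have h' : (s / 2 : ℝ) = 1 := congrArg Subtype.val h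
  linarith [s.2.2]

theorem secondHalf_ne_zero (s : I) : secondHalf s ≠ 0 := fun h => by
  have h' : (1 - s / 2 : ℝ) = 0 := congrArg Subtype.val h
  linarith [s.2.2]

theorem firstHalf_zero : firstHalf 0 = 0 := Subtype.ext (by simp [firstHalf])

theorem secondHalf_zero : secondHalf 0 = 1 := Subtype.ext (by simp [secondHalf])

theorem secondHalf_one : secondHalf 1 = firstHalf 1 :=
  Subtype.ext (by norm_num [firstHalf, secondHalf])

theorem IsTheta.arc_ne {T : Type*} [TopologicalSpace T] {m : ℕ} {γ : Fin m → C(I, T)} {p q : T}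
    (hγ : IsTheta γ p q) {i j : Fin m} (hij : i ≠ j) {s t : I} (hs : s ≠ 1) (ht : t ≠ 0) :
    γ i s ≠ γ j t := fun h => by
  rcases hγ.inter hij h with h | h
  · exact ht h.2
  · exact hs h.1

theorem vandermondeTriple_swap {T : Type*} [TopologicalSpace T] (g : C(T, ℂ)) (a b c : T) :
    vandermondeTriple g a c b = -vandermondeTriple g a b c := by
  unfold vandermondeTriple
  ring

/-- The three-strand braid group of a planar theta graph with at least four arcs is not free. -/
theorem IsTheta.not_free {T : Type*} [TopologicalSpace T] [T2Space T] {m : ℕ}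
    {γ : Fin m → C(I, T)} {p q : T} (hγ : IsTheta γ p q) (hm : 4 ≤ m) {g : C(T, ℂ)}
    (hg : Function.Injective g) (x₀ : UConf 3 T) {ι : Type*}
    (e : FundamentalGroup (UConf 3 T) x₀ ≃* FreeGroup ι) : False := by
  have : PathConnectedSpace (UConf 3 T) := ⟨⟨x₀⟩, hγ.joined_uconf (by lia)⟩
  let a : Fin 4 → Fin m := Fin.castLE hm
  have ha : Function.Injective a := Fin.castLE_injective hm
  obtain ⟨f, hf, hf0, hf1⟩ := hγ.exists_winding (a 0)
  obtain ⟨z, hz⟩ := exists_cobounding_squares x₀ e (configProd f) (configDiscr g)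
    (configProd_ne_zero f hf) (configDiscr_ne_zero g hg)
  let A (i : Fin 4) : C(I, T) := (γ (a i)).comp firstHalf
  let B (i : Fin 4) : C(I, T) := (γ (a i)).comp secondHalf
  have hA0 (i : Fin 4) : A i 0 = p := by
    simp only [A, ContinuousMap.comp_apply, firstHalf_zero, hγ.map_zero]
  have hB0 (i : Fin 4) : B i 0 = q := by
    simp only [B, ContinuousMap.comp_apply, secondHalf_zero, hγ.map_one]
  have hB1 (i : Fin 4) : B i 1 = A i 1 := by
    simp only [A, B, ContinuousMap.comp_apply, secondHalf_one]
  have hAB {i j : Fin 4} (hij : i ≠ j) (s t : I) : A i s ≠ B j t :=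
    hγ.arc_ne (ha.ne hij) (firstHalf_ne_one s) (secondHalf_ne_zero t)
  have hAA {i j : Fin 4} (hij : i ≠ j) (s : I) : A i s ≠ A j 1 := by
    rw [← hB1]
    exact hAB hij s 1
  have hBA {i j : Fin 4} (hij : i ≠ j) (s : I) : B i s ≠ A j 1 := (hAB hij.symm 1 s).symm
  have hfp : f p = 1 := by
    rw [← hγ.map_zero (a 0), hf0]
    simp
  have hfB (i : Fin 4) (s : I) : f (B i s) = 1 := by
    rcases eq_or_ne i 0 with rfl | hi
    · have h : min (1 : ℝ) (2 * (1 - s / 2)) = 1 := min_eq_left (by linarith [s.2.2])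
      refine (hf0 _).trans ?_
      simp only [secondHalf, ContinuousMap.coe_mk, h]
      simp [Complex.exp_two_pi_mul_I]
    · exact hf1 _ (ha.ne hi) _
  have hfq : f q = 1 := by rw [← hB0 0, hfB]
  have hfA1 (i : Fin 4) : f (A i 1) = 1 := by rw [← hB1, hfB]
  let y (j i k : Fin 4) : ℂ := evalTriple (fun b => logVariation ((configDiscr g).comp b))
    (.const I (A i 1)) (B j) (.const I (A k 1))
  have hsq (i j k : Fin 4) (hij : i ≠ j) (hik : i ≠ k) (hjk : j ≠ k) :
      evalTriple z (A i) (.const I q) (.const I (A k 1))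
          + evalTriple z (.const I (A i 1)) (B j) (.const I (A k 1))
          + (if i = 0 then 2 * Real.pi * Complex.I else 0) * y j i k =
        evalTriple z (.const I p) (B j) (.const I (A k 1))
          + evalTriple z (A i) (.const I (A j 1)) (.const I (A k 1)) := by
    have h := evalTriple_square hz (A i) (B j) (A k 1) (hAB hij) (hAA hik) (hBA hjk)
    rw [evalTriple_logVariation_configProd f
      (fun t => injective_triple_s11 (hAB hij t 0) (hAA hik t) (hBA hjk 0))
      ⟨fun t => (if i = 0 then 2 * Real.pi * Complex.I else 0) * (t : ℝ), by fun_prop⟩ ?_,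
      evalTriple_logVariation_configProd f
      (fun t => injective_triple_s11 (hAB hij 0 t) (hAA hik 0) (hBA hjk t)) 0 ?_] at h
    · simpa [hA0, hB0, hB1] using h
    · intro t
      simp only [ContinuousMap.const_apply, hA0, hfp, hfB, hfA1]
      simp
    · intro t
      simp only [ContinuousMap.const_apply, ContinuousMap.coe_mk, hB0, hfq, hfA1, mul_one]
      rcases eq_or_ne i 0 with rfl | hi
      · have h : min (1 : ℝ) (2 * (t / 2)) = t := by
          rw [mul_div_cancel₀ _ two_ne_zero, min_eq_right t.2.2]
        refine Eq.trans ?_ (hf0 _).symm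
        simp only [firstHalf, ContinuousMap.coe_mk, h, if_true]
      · simp only [hi, if_false, zero_mul, Complex.exp_zero]
        exact (hf1 _ (ha.ne hi) _).symm
  have hsum := antisymmetrized_squares
    (fun i j k => evalTriple_swap_snd z (A i) (.const I (A j 1)) (.const I (A k 1)))
    (fun j i k => evalTriple_swap_fst z (.const I (A i 1)) (B j) (.const I (A k 1))) hsq
  have hexp (j k : Fin 4) (hj : 0 ≠ j) (hk : 0 ≠ k) (hjk : j ≠ k) :
      Complex.exp (y j 0 k / 2) * vandermondeTriple g (A 0 1) q (A k 1) =
        vandermondeTriple g (A 0 1) (A j 1) (A k 1) := by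
    have h := evalTriple_logVariation_configDiscr hg (A := .const I (A 0 1)) (B := B j)
      (C := .const I (A k 1)) (hAB hj 1) (fun _ => hAA hk 1) (hBA hjk)
    simpa only [ContinuousMap.const_apply, hB0, hB1] using h
  have hV (k : Fin 4) (hk : 0 ≠ k) : vandermondeTriple g (A 0 1) q (A k 1) ≠ 0 := by
    rw [← hB0 (if k = 1 then 2 else 1)]
    have h1 : 0 ≠ (if k = 1 then 2 else 1 : Fin 4) := by revert k; decide
    have h2 : (if k = 1 then 2 else 1 : Fin 4) ≠ k := by revert k; decide
    exact vandermondeTriple_ne_zero hg (hAB h1 1 0) (hAA hk 1) (hBA h2 0)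
  have hexp_eq : Complex.exp (y 1 0 2 / 2) * Complex.exp (y 2 0 3 / 2) * Complex.exp (y 3 0 1 / 2)
      = Complex.exp (y 2 0 1 / 2) * Complex.exp (y 3 0 2 / 2) * Complex.exp (y 1 0 3 / 2) := by
    rw [← Complex.exp_add, ← Complex.exp_add, ← Complex.exp_add, ← Complex.exp_add]
    congr 1
    linear_combination (mul_eq_zero.1 hsum).resolve_left Complex.two_pi_I_ne_zero / 2
  have h12 := hexp 1 2 (by decide) (by decide) (by decide)
  have h23 := hexp 2 3 (by decide) (by decide) (by decide)
  have h31 := hexp 3 1 (by decide) (by decide) (by decide)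
  have h21 := hexp 2 1 (by decide) (by decide) (by decide)
  have h32 := hexp 3 2 (by decide) (by decide) (by decide)
  have h13 := hexp 1 3 (by decide) (by decide) (by decide)
  rw [vandermondeTriple_swap g _ (A 1 1) (A 2 1), ← h12] at h21
  rw [vandermondeTriple_swap g _ (A 2 1) (A 3 1), ← h23] at h32
  rw [vandermondeTriple_swap g _ (A 3 1) (A 1 1), ← h31] at h13
  have hne : Complex.exp (y 1 0 2 / 2) * Complex.exp (y 2 0 3 / 2) * Complex.exp (y 3 0 1 / 2) *
      (vandermondeTriple g (A 0 1) q (A 1 1) * vandermondeTriple g (A 0 1) q (A 2 1) *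
        vandermondeTriple g (A 0 1) q (A 3 1)) ≠ 0 :=
    mul_ne_zero (by simp [Complex.exp_ne_zero]) (mul_ne_zero (mul_ne_zero
      (hV 1 (by decide)) (hV 2 (by decide))) (hV 3 (by decide)))
  have hprod := congrArg₂ (· * ·) (congrArg₂ (· * ·) h21 h32) h13
  refine hne (self_eq_neg.1 ?_)
  linear_combination (vandermondeTriple g (A 0 1) q (A 1 1) *
    vandermondeTriple g (A 0 1) q (A 2 1) * vandermondeTriple g (A 0 1) q (A 3 1)) * hexp_eq + hprod

/-- For `m ≥ 4` and any realization `Θ ⊆ ℝ²` of the generalized theta graph `Θ_m`,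
the fundamental group of `UConf₃(Θ)` at any basepoint is not a free group. -/
theorem theta_braid_group_not_free
    (m : ℕ) (hm : 4 ≤ m)
    (p q : ℝ × ℝ) (hpq : p ≠ q)
    (γ : Fin m → C(unitInterval, ℝ × ℝ))
    (hγinj : ∀ i, Function.Injective (γ i))
    (hγ0 : ∀ i, γ i 0 = p) (hγ1 : ∀ i, γ i 1 = q)
    (hγint : ∀ i j, i ≠ j → Set.range (γ i) ∩ Set.range (γ j) = {p, q})
    (Θ : Set (ℝ × ℝ)) (hΘ : Θ = ⋃ i, Set.range (γ i)) :
    ∀ x : UConf 3 ↥Θ, ∀ ι : Type*,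
      ¬ Nonempty (FundamentalGroup (UConf 3 ↥Θ) x ≃* FreeGroup ι) := by
  rintro x₀ ι ⟨e⟩
  have hmem (i : Fin m) (s : I) : γ i s ∈ Θ := by
    rw [hΘ]
    exact Set.mem_iUnion.2 ⟨i, s, rfl⟩
  have i₀ : Fin m := ⟨0, by lia⟩
  have hθ : IsTheta (fun i => (⟨fun s => ⟨γ i s, hmem i s⟩, by fun_prop⟩ : C(I, Θ)))
      ⟨γ i₀ 0, hmem i₀ 0⟩ ⟨γ i₀ 1, hmem i₀ 1⟩ := by
    refine ⟨fun i s t h => hγinj i (congrArg Subtype.val h), fun i => ?_, fun i => ?_,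
      fun {i j s t} hij h => ?_, fun x => ?_⟩
    · exact Subtype.ext ((hγ0 i).trans (hγ0 i₀).symm)
    · exact Subtype.ext ((hγ1 i).trans (hγ1 i₀).symm)
    · have h' : γ i s = γ j t := congrArg Subtype.val h
      have hpt : γ i s ∈ ({p, q} : Set (ℝ × ℝ)) := by
        rw [← hγint i j hij]
        exact ⟨⟨s, rfl⟩, ⟨t, h'.symm⟩⟩
      rcases hpt with hpt | hpt
      · exact .inl ⟨hγinj i (hpt.trans (hγ0 i).symm),
          hγinj j (h'.symm.trans (hpt.trans (hγ0 j).symm))⟩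
      · exact .inr ⟨hγinj i (Eq.trans hpt (hγ1 i).symm),
          hγinj j (h'.symm.trans (Eq.trans hpt (hγ1 j).symm))⟩
    · obtain ⟨x, hx⟩ := x
      obtain ⟨i, s, hs⟩ := Set.mem_iUnion.1 (hΘ ▸ hx)
      exact ⟨i, s, Subtype.ext hs⟩
  exact hθ.not_free hm
    (g := ⟨fun x => Complex.equivRealProdCLM.symm x.1, by fun_prop⟩)
    (fun x y h => Subtype.ext (Complex.equivRealProdCLM.symm.injective h)) x₀ e
end
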